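/- Under Assumptions (H0)–(H3), for every p̲ ∈ 𝒪 and every ζ̲̌ = (τ̲̌, η̲̌, γ̲̌) ∈ ℝ^{d+1} with ζ̲̌ ≠ 0 and γ̲̌ = 0, there exist linear subspaces E̲₋, E̲₊ of ℂ^{2N} with ℂ^{2N} = E̲₋ ⊕ E̲₊ and dim E̲₋ = dim E̲₊ = N, such that for every κ ≥ 1 there are a neighborhood Ω of (p̲, ζ̲̌, 0) in ℝ^M × ℝ^{d+1} × ℝ, a C^∞ map 𝒮 : Ω → M_{2N}(ℂ) and a constant c > 0 with: (i) 𝒮(p, ζ̌, ρ) = 𝒮(p, ζ̌, ρ)* for all (p, ζ̌, ρ) ∈ Ω; (ii) ⟨𝒮(p, ζ̌, ρ)U, U⟩ ≥ κ² |Π̲₊U|² − |Π̲₋U|² for all (p, ζ̌, ρ) ∈ Ω and all U ∈ ℂ^{2N}, where Π̲₊, Π̲₋ are the projections associated with the decomposition ℂ^{2N} = E̲₋ ⊕ E̲₊; (iii) Re ⟨𝒮(p, ζ̌, ρ) 𝒢(p, ρζ̌) U, U⟩ ≥ c ρ(γ̌ + ρ) |U|² for all (p, ζ̌, ρ) ∈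 Ω with ρ ≥ 0 and γ̌ ≥ 0, and all U ∈ ℂ^{2N}. -/

import Mathlib

open Matrix Complex
open scoped ContDiff

noncomputable section

/-- Real matrix mapped to a complex matrix. -/
def cmap {N : ℕ} (A : Matrix (Fin N) (Fin N) ℝ) : Matrix (Fin N) (Fin N) ℂ :=
  A.map (fun x => (x : ℂ))

/-- Frequency variable `ζ = (τ, η, γ) ∈ ℝ × ℝ^{d-1} × ℝ` (here `d = m + 1`). -/
abbrev Freq (m : ℕ) := ℝ × (Fin m → ℝ) × ℝ

/-- The block `𝒜(p, ζ)`. -/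
def calA {N m : ℕ} (A : Fin (m + 1) → Matrix (Fin N) (Fin N) ℝ)
    (B : Fin (m + 1) → Fin (m + 1) → Matrix (Fin N) (Fin N) ℝ) (ζ : Freq m) :
    Matrix (Fin N) (Fin N) ℂ :=
  (cmap (B (Fin.last m) (Fin.last m)))⁻¹ *
    (cmap (A (Fin.last m)) -
      ∑ j : Fin m, (Complex.I * (ζ.2.1 j : ℂ)) •
        (cmap (B j.castSucc (Fin.last m)) + cmap (B (Fin.last m) j.castSucc)))

/-- The block `ℳ(p, ζ)`. -/
def calM {N m : ℕ} (A : Fin (m + 1) → Matrix (Fin N) (Fin N) ℝ)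
    (B : Fin (m + 1) → Fin (m + 1) → Matrix (Fin N) (Fin N) ℝ) (ζ : Freq m) :
    Matrix (Fin N) (Fin N) ℂ :=
  (cmap (B (Fin.last m) (Fin.last m)))⁻¹ *
    ((Complex.I * (ζ.1 : ℂ) + (ζ.2.2 : ℂ)) • (1 : Matrix (Fin N) (Fin N) ℂ) +
      ∑ j : Fin m, (Complex.I * (ζ.2.1 j : ℂ)) • cmap (A j.castSucc) +
      ∑ j : Fin m, ∑ k : Fin m, ((ζ.2.1 j * ζ.2.1 k : ℝ) : ℂ) • cmap (B j.castSucc k.castSucc))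

/-- The full `2N × 2N` matrix `𝒢(p, ζ) = [[0, Id], [ℳ, 𝒜]]`. -/
def calG {N m : ℕ} (A : Fin (m + 1) → Matrix (Fin N) (Fin N) ℝ)
    (B : Fin (m + 1) → Fin (m + 1) → Matrix (Fin N) (Fin N) ℝ) (ζ : Freq m) :
    Matrix (Fin N ⊕ Fin N) (Fin N ⊕ Fin N) ℂ :=
  Matrix.fromBlocks 0 1 (calM A B ζ) (calA A B ζ)

/-- The generalized eigenspace of `f` for eigenvalues of negative real part. -/
def stableSubspace {E : Type*} [AddCommGroup E] [Module ℂ E] (f : Module.End ℂ E) :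
    Submodule ℂ E :=
  ⨆ μ ∈ {μ : ℂ | μ.re < 0}, f.maxGenEigenspace μ

/-- The generalized eigenspace of `f` for eigenvalues of positive real part. -/
def unstableSubspace {E : Type*} [AddCommGroup E] [Module ℂ E] (f : Module.End ℂ E) :
    Submodule ℂ E :=
  ⨆ μ ∈ {μ : ℂ | 0 < μ.re}, f.maxGenEigenspace μ

/-- (H0): the coefficients are `C^∞` functions on `𝒪`. -/
def HypH0 {M N m : ℕ} (𝒪 : Set (Fin M → ℝ))
    (A : Fin (m + 1) → (Fin M → ℝ) → Matrix (Fin N) (Fin N) ℝ)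
    (B : Fin (m + 1) → Fin (m + 1) → (Fin M → ℝ) → Matrix (Fin N) (Fin N) ℝ) : Prop :=
  (∀ j i k, ContDiffOn ℝ ∞ (fun p => A j p i k) 𝒪) ∧
    (∀ j l i k, ContDiffOn ℝ ∞ (fun p => B j l p i k) 𝒪)

/-- (H1): for `p ∈ 𝒪` and `ξ ≠ 0`, the eigenvalues of `Σ ξ_j A_j(p)` are real and
semisimple, with multiplicities independent of `(p, ξ)`. -/
def HypH1 {M N m : ℕ} (𝒪 : Set (Fin M → ℝ))
    (A : Fin (m + 1) → (Fin M → ℝ) → Matrix (Fin N) (Fin N) ℝ) : Prop :=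
  ∃ mult : Multiset ℕ, ∀ p ∈ 𝒪, ∀ ξ : Fin (m + 1) → ℝ, ξ ≠ 0 →
    (∀ μ ∈ spectrum ℂ (cmap (∑ j, ξ j • A j p)), μ.im = 0) ∧
    (∀ μ : ℂ, Module.End.eigenspace (Matrix.toLin' (cmap (∑ j, ξ j • A j p))) μ =
      Module.End.maxGenEigenspace (Matrix.toLin' (cmap (∑ j, ξ j • A j p))) μ) ∧
    (((cmap (∑ j, ξ j • A j p)).charpoly.roots.dedup.map
        fun μ => (cmap (∑ j, ξ j • A j p)).charpoly.roots.count μ) = mult)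

/-- (H2): uniform parabolicity. -/
def HypH2 {M N m : ℕ} (𝒪 : Set (Fin M → ℝ))
    (A : Fin (m + 1) → (Fin M → ℝ) → Matrix (Fin N) (Fin N) ℝ)
    (B : Fin (m + 1) → Fin (m + 1) → (Fin M → ℝ) → Matrix (Fin N) (Fin N) ℝ) : Prop :=
  ∃ c > (0 : ℝ), ∀ p ∈ 𝒪, ∀ ξ : Fin (m + 1) → ℝ,
    ∀ μ ∈ spectrum ℂ
      ((∑ j, (Complex.I * (ξ j : ℂ)) • cmap (A j p)) +
        ∑ j, ∑ k, ((ξ j * ξ k : ℝ) : ℂ) • cmap (B j k p)),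
      c * ∑ j, (ξ j) ^ 2 ≤ μ.re

/-- (H3): noncharacteristic boundary. -/
def HypH3 {M N m : ℕ} (𝒪 : Set (Fin M → ℝ))
    (A : Fin (m + 1) → (Fin M → ℝ) → Matrix (Fin N) (Fin N) ℝ) : Prop :=
  ∀ p ∈ 𝒪, (A (Fin.last m) p).det ≠ 0

end

section
open Matrix Complex
open scoped ContDiff Topology
noncomputable section
set_option linter.unusedSectionVars false
set_option linter.unusedSimpArgs false
set_option linter.unusedVariables false
namespace KS
local notation "MC" n:max => Matrix n n ℂ
local notation "MR" N:max => Matrix (Fin N) (Fin N) ℝ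
section
variable {n : Type*} [Fintype n] [DecidableEq n]
/-- real part of the quadratic form -/
def rq (M : MC n) (v : n → ℂ) : ℝ := (star v ⬝ᵥ M *ᵥ v).re
/-- squared norm -/
def nq (v : n → ℂ) : ℝ := ∑ i, ‖v i‖ ^ 2
/-- positive definite real part -/
def PD (M : MC n) : Prop := ∀ v, v ≠ 0 → 0 < rq M v
lemma rq_add (M M' : MC n) (v) : rq (M + M') v = rq M v + rq M' v := by
  simp [rq, add_mulVec, dotProduct_add]
lemma rq_sub (M M' : MC n) (v) : rq (M - M') v = rq M v - rq M' v := by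
  simp [rq, sub_mulVec, dotProduct_sub]
lemma rq_neg (M : MC n) (v) : rq (-M) v = - rq M v := by
  simp [rq, neg_mulVec, dotProduct_neg]
lemma rq_zero (v : n → ℂ) : rq (0 : MC n) v = 0 := by simp [rq]
lemma rq_smul (a : ℝ) (M : MC n) (v) : rq ((a : ℂ) • M) v = a * rq M v := by
  simp [rq, smul_mulVec, dotProduct_smul]
lemma rq_rsmul (a : ℝ) (M : MC n) (v) : rq (a • M) v = a * rq M v := by
  simp [rq, smul_mulVec, dotProduct_smul]
lemma star_dot_mulVec (M : MC n) (u v : n → ℂ) :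
    star u ⬝ᵥ M *ᵥ v = star (Mᴴ *ᵥ u) ⬝ᵥ v := by
  rw [Matrix.star_mulVec, Matrix.conjTranspose_conjTranspose, Matrix.dotProduct_mulVec]
lemma rq_ct (M : MC n) (v) : rq Mᴴ v = rq M v := by
  unfold rq
  rw [star_dot_mulVec, Matrix.conjTranspose_conjTranspose]
  have : star (M *ᵥ v) ⬝ᵥ v = star (star v ⬝ᵥ M *ᵥ v) := by
    rw [Matrix.star_dotProduct]
  rw [this]; simp
lemma rq_conj {m : Type*} [Fintype m] (M : Matrix m m ℂ) (X : Matrix m n ℂ) (v : n → ℂ) :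
    rq (Xᴴ * M * X) v = rq M (X *ᵥ v) := by
  unfold rq
  rw [Matrix.star_mulVec, ← mulVec_mulVec, ← mulVec_mulVec, Matrix.dotProduct_mulVec]
lemma rq_smulv (M : MC n) (a : ℂ) (v) : rq M (a • v) = ‖a‖ ^ 2 * rq M v := by
  unfold rq
  rw [mulVec_smul, star_smul, smul_dotProduct, dotProduct_smul, smul_smul]
  have : star a * a = ((‖a‖ ^ 2 : ℝ) : ℂ) := by
    rw [← Complex.normSq_eq_norm_sq]; exact Complex.normSq_eq_conj_mul_self.symm
  rw [this, smul_eq_mul, Complex.re_ofReal_mul]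
lemma nq_eq (v : n → ℂ) : ((nq v : ℝ) : ℂ) = star v ⬝ᵥ v := by
  simp only [nq, dotProduct, Complex.ofReal_sum, Pi.star_apply]
  refine Finset.sum_congr rfl fun i _ => ?_
  rw [← Complex.normSq_eq_norm_sq]; exact Complex.normSq_eq_conj_mul_self
lemma rq_one (v : n → ℂ) : rq 1 v = nq v := by
  unfold rq; rw [one_mulVec, ← nq_eq]; simp
lemma nq_nonneg (v : n → ℂ) : 0 ≤ nq v := Finset.sum_nonneg fun i _ => by positivity
lemma nq_pos {v : n → ℂ} (h : v ≠ 0) : 0 < nq v := by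
  obtain ⟨i, hi⟩ := Function.ne_iff.1 h
  exact Finset.sum_pos' (fun i _ => by positivity) ⟨i, Finset.mem_univ _, by
    have : ‖v i‖ ≠ 0 := by simpa using hi
    positivity⟩
lemma nq_eq_zero {v : n → ℂ} : nq v = 0 ↔ v = 0 := by
  constructor
  · intro h; by_contra h'; exact (nq_pos h').ne' h
  · rintro rfl; simp [nq]
lemma rq_ctmul {m : Type*} [Fintype m] (X : Matrix m n ℂ) (v : n → ℂ) :
    rq (Xᴴ * X) v = nq (X *ᵥ v) := by
  classical
  have := rq_conj (1 : Matrix m m ℂ) X v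
  rw [Matrix.mul_one] at this; rw [this, rq_one]
lemma PD_one : PD (1 : MC n) := fun v hv => by rw [rq_one]; exact nq_pos hv
lemma rq_zerov (M : MC n) : rq M 0 = 0 := by simp [rq]
lemma PD.nonneg {M : MC n} (h : PD M) (v) : 0 ≤ rq M v := by
  by_cases hv : v = 0
  · rw [hv, rq_zerov]
  · exact (h v hv).le
lemma PD.add {M M' : MC n} (h : PD M) (h' : ∀ v, 0 ≤ rq M' v) : PD (M + M') := by
  intro v hv; rw [rq_add]; linarith [h v hv, h' v]
lemma norm_le_sqrt_nq (v : n → ℂ) (i : n) : ‖v i‖ ^ 2 ≤ nq v :=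
  Finset.single_le_sum (f := fun i => ‖v i‖ ^ 2) (fun i _ => by positivity) (Finset.mem_univ i)
lemma abs_rq_le (M : MC n) (v) : |rq M v| ≤ (∑ i, ∑ j, ‖M i j‖) * nq v := by
  unfold rq
  refine (Complex.abs_re_le_norm _).trans ?_
  simp only [dotProduct, mulVec]
  refine (norm_sum_le _ _).trans ?_
  rw [Finset.sum_mul]
  refine Finset.sum_le_sum fun i _ => ?_
  rw [norm_mul, Finset.sum_mul]
  refine (mul_le_mul_of_nonneg_left (norm_sum_le _ _) (norm_nonneg _)).trans ?_
  rw [Finset.mul_sum]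
  refine Finset.sum_le_sum fun j _ => ?_
  rw [norm_mul, Pi.star_apply, norm_star]
  have h1 := norm_le_sqrt_nq v i
  have h2 := norm_le_sqrt_nq v j
  have h3 : ‖v i‖ * ‖v j‖ ≤ nq v := by nlinarith [sq_nonneg (‖v i‖ - ‖v j‖)]
  nlinarith [norm_nonneg (M i j)]
lemma continuous_rq (M : MC n) : Continuous (rq M) := by
  unfold rq
  simp only [dotProduct, mulVec]
  fun_prop
lemma continuous_nq : Continuous (nq : (n → ℂ) → ℝ) := by
  unfold nq; fun_prop
lemma nq_smul (a : ℂ) (v : n → ℂ) : nq (a • v) = ‖a‖ ^ 2 * nq v := by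
  simp [nq, Finset.mul_sum, mul_pow]
/-- unit sphere -/
def sph (n : Type*) [Fintype n] : Set (n → ℂ) := {v | nq v = 1}
lemma isCompact_sph : IsCompact (sph n) := by
  refine Metric.isCompact_of_isClosed_isBounded
    (isClosed_eq continuous_nq continuous_const) ?_
  refine (Metric.isBounded_closedBall (x := (0 : n → ℂ)) (r := 1)).subset ?_
  intro v hv
  rw [mem_closedBall_zero_iff, pi_norm_le_iff_of_nonneg zero_le_one]
  intro i
  have := norm_le_sqrt_nq v i
  rw [show nq v = 1 from hv] at this
  nlinarith [norm_nonneg (v i)]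
lemma exists_sph {v : n → ℂ} (hv : v ≠ 0) :
    ∃ u ∈ sph n, v = ((Real.sqrt (nq v) : ℝ) : ℂ) • u := by
  have h := nq_pos hv
  have h' : Real.sqrt (nq v) ≠ 0 := (Real.sqrt_pos.2 h).ne'
  refine ⟨((Real.sqrt (nq v) : ℝ) : ℂ)⁻¹ • v, ?_, ?_⟩
  · show nq _ = 1
    rw [nq_smul, norm_inv, Complex.norm_real, Real.norm_eq_abs, inv_pow, sq_abs,
      Real.sq_sqrt h.le, inv_mul_cancel₀ h.ne']
  · rw [smul_smul, mul_inv_cancel₀ (by exact_mod_cast h'), one_smul]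
/-- general homogeneous lower bound -/
lemma hom_bound (M : MC n) (c : ℝ) (h : ∀ u ∈ sph n, c ≤ rq M u) (v) :
    c * nq v ≤ rq M v := by
  by_cases hv : v = 0
  · subst hv; rw [rq_zerov, nq_eq_zero.2 rfl]; simp
  obtain ⟨u, hu, e⟩ := exists_sph hv
  have h1 : rq M v = nq v * rq M u := by
    conv_lhs => rw [e]
    rw [rq_smulv, Complex.norm_real, Real.norm_eq_abs, sq_abs, Real.sq_sqrt (nq_nonneg v)]
  rw [h1, mul_comm]
  exact mul_le_mul_of_nonneg_left (h u hu) (nq_nonneg v)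
lemma PD.bound {M : MC n} (h : PD M) : ∃ c > 0, ∀ v, c * nq v ≤ rq M v := by
  by_cases hne : (sph n).Nonempty
  · obtain ⟨u, hu, hmin⟩ := isCompact_sph.exists_isMinOn hne (continuous_rq M).continuousOn
    refine ⟨rq M u, h u ?_, hom_bound M _ fun v hv => hmin hv⟩
    rintro rfl
    have : nq (0 : n → ℂ) = 1 := hu
    rw [nq_eq_zero.2 rfl] at this; norm_num at this
  · refine ⟨1, one_pos, hom_bound M 1 fun u hu => (hne ⟨u, hu⟩).elim⟩
lemma PD.sub_small {M : MC n} (h : PD M) (M' : MC n) :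
    ∃ ε > (0:ℝ), ∀ t : ℝ, |t| ≤ ε → PD (M + (t : ℂ) • M') := by
  obtain ⟨c, hc, hb⟩ := h.bound
  set K := ∑ i, ∑ j, ‖M' i j‖
  have hK : 0 ≤ K := Finset.sum_nonneg fun i _ => Finset.sum_nonneg fun j _ => norm_nonneg _
  refine ⟨c / (2 * (K + 1)), by positivity, fun t ht v hv => ?_⟩
  rw [rq_add, rq_smul]
  have h1 := abs_rq_le M' v
  have h2 := nq_pos hv
  have h3 : |t * rq M' v| ≤ c / (2 * (K + 1)) * (K * nq v) := by
    rw [abs_mul]; exact mul_le_mul ht h1 (abs_nonneg _) (by positivity)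
  have h4 : c / (2 * (K + 1)) * (K * nq v) ≤ c / 2 * nq v := by
    rw [div_mul_eq_mul_div, div_le_iff₀ (by positivity)]
    nlinarith [mul_pos hc h2]
  have := neg_le_of_abs_le h3
  nlinarith [hb v, mul_pos hc h2]
/-- stability of positivity -/
lemma PD.near {X : Type*} [TopologicalSpace X] {f : X → MC n} {x0 : X}
    (hf : ∀ i j, ContinuousAt (fun x => f x i j) x0) {c : ℝ} {M : MC n}
    (hM : f x0 = M)
    (hb : ∀ v, c * nq v ≤ rq M v) {c' : ℝ} (hc : c' < c) :
    ∀ᶠ x in 𝓝 x0, ∀ v, c' * nq v ≤ rq (f x) v := by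
  subst hM
  have h1 : ContinuousAt (fun x => ∑ i, ∑ j, ‖(f x - f x0) i j‖) x0 := by
    refine tendsto_finsetSum _ fun i _ => tendsto_finsetSum _ fun j _ => ?_
    exact ((hf i j).sub continuousAt_const).norm
  have h2 : ∀ᶠ x in 𝓝 x0, (∑ i, ∑ j, ‖(f x - f x0) i j‖) < c - c' := by
    refine h1.eventually_lt_const ?_
    simpa using hc
  filter_upwards [h2] with x hx v
  have h3 := abs_rq_le (f x - f x0) v
  rw [rq_sub] at h3
  have := neg_le_of_abs_le h3
  nlinarith [hb v, nq_nonneg v]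
lemma PD.near' {X : Type*} [TopologicalSpace X] {f : X → MC n} {x0 : X}
    (hf : ∀ i j, ContinuousAt (fun x => f x i j) x0) (h : PD (f x0)) :
    ∃ c > 0, ∀ᶠ x in 𝓝 x0, ∀ v, c * nq v ≤ rq (f x) v := by
  obtain ⟨c, hc, hb⟩ := h.bound
  exact ⟨c / 2, by positivity, PD.near hf rfl hb (by linarith)⟩
lemma PD_of_bound {M : MC n} {c : ℝ} (hc : 0 < c) (h : ∀ v, c * nq v ≤ rq M v) : PD M :=
  fun v hv => lt_of_lt_of_le (mul_pos hc (nq_pos hv)) (h v)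
end
section
open scoped ComplexOrder
variable {n : Type*} [Fintype n] [DecidableEq n]
lemma herm_spec (Z : MC n) (hZ : Zᴴ = Z) :
    ∃ (U : MC n) (d : n → ℝ), Uᴴ * U = 1 ∧ U * Uᴴ = 1 ∧
      Z = U * diagonal (fun i => (d i : ℂ)) * Uᴴ := by
  have h : Z.IsHermitian := hZ
  refine ⟨h.eigenvectorUnitary, h.eigenvalues, ?_, ?_, ?_⟩
  · have := (Unitary.mem_iff.1 h.eigenvectorUnitary.2).1
    exact this
  · exact (Unitary.mem_iff.1 h.eigenvectorUnitary.2).2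
  · have := h.spectral_theorem
    rw [Unitary.conjStarAlgAut_apply] at this
    exact this
lemma herm_im (Z : MC n) (hZ : Zᴴ = Z) (v) : star v ⬝ᵥ Z *ᵥ v = (rq Z v : ℂ) := by
  have h : (star v ⬝ᵥ Z *ᵥ v) = star (star v ⬝ᵥ Z *ᵥ v) := by
    conv_lhs => rw [star_dot_mulVec, hZ, Matrix.star_dotProduct]
  have h2 := congrArg Complex.im h
  simp only [Complex.star_def, Complex.conj_im] at h2
  apply Complex.ext
  · rfl
  · simp; linarith
lemma psd_of (Z : MC n) (hZ : Zᴴ = Z) (h : ∀ v, 0 ≤ rq Z v) : Z.PosSemidef := by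
  refine Matrix.posSemidef_iff_dotProduct_mulVec.2 ⟨hZ, fun x => ?_⟩
  rw [herm_im Z hZ]
  exact_mod_cast h x
lemma psd_null (Z : MC n) (hZ : Zᴴ = Z) (h : ∀ v, 0 ≤ rq Z v) (v) (hv : rq Z v = 0) :
    Z *ᵥ v = 0 := by
  have := (psd_of Z hZ h).dotProduct_mulVec_zero_iff v
  refine this.1 ?_
  rw [herm_im Z hZ, hv]; simp
lemma herm_psd_spec (Z : MC n) (hZ : Zᴴ = Z) (h : ∀ v, 0 ≤ rq Z v) :
    ∃ (U : MC n) (d : n → ℝ), Uᴴ * U = 1 ∧ U * Uᴴ = 1 ∧ (∀ i, 0 ≤ d i) ∧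
      Z = U * diagonal (fun i => (d i : ℂ)) * Uᴴ := by
  obtain ⟨U, d, h1, h2, h3⟩ := herm_spec Z hZ
  refine ⟨U, d, h1, h2, fun i => ?_, h3⟩
  have := h (U *ᵥ (Pi.single i 1))
  rw [← rq_conj, h3] at this
  have e : Uᴴ * (U * diagonal (fun i => (d i : ℂ)) * Uᴴ) * U = diagonal (fun i => (d i : ℂ)) := by
    calc _ = (Uᴴ * U) * diagonal (fun i => (d i : ℂ)) * (Uᴴ * U) := by simp only [mul_assoc]
      _ = _ := by rw [h1]; simp
  rw [e] at this
  simpa [rq, Matrix.mulVec_single, Pi.star_single] using this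
/-- trace functional through a factorization -/
lemma tr_factor (X V : MC n) :
    (trace (X * (V * Vᴴ))).re = ∑ k, rq X (fun i => V i k) := by
  rw [← mul_assoc, Matrix.trace_mul_comm, ← mul_assoc, Matrix.trace, Complex.re_sum]
  refine Finset.sum_congr rfl fun k _ => ?_
  unfold rq
  congr 1
  rw [Matrix.dotProduct_mulVec]
  simp only [diag_apply, Matrix.mul_apply, dotProduct, vecMul, conjTranspose_apply, Pi.star_apply]
lemma tr_vec (Z : MC n) (v : n → ℂ) :
    (trace (vecMulVec v (star v) * Z)).re = rq Z v := by
  unfold rq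
  congr 1
  rw [Matrix.dotProduct_mulVec]
  simp only [trace, diag_apply, Matrix.mul_apply, dotProduct, vecMul, vecMulVec_apply, Pi.star_apply,
    Finset.sum_mul]
  exact Finset.sum_congr rfl fun i _ => Finset.sum_congr rfl fun j _ => by ring
lemma rq_vec (w v : n → ℂ) : 0 ≤ rq (vecMulVec v (star v)) w := by
  have h := Matrix.posSemidef_vecMulVec_self_star v
  have := h.dotProduct_mulVec_nonneg w
  exact (Complex.le_def.1 this).1
lemma PD_open : IsOpen {X : MC n | PD X} := by
  rw [isOpen_iff_mem_nhds]
  intro X hX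
  obtain ⟨c, hc, h⟩ := PD.near' (f := fun X : MC n => X) (x0 := X)
    (fun i j => (continuous_apply_apply i j).continuousAt) hX
  filter_upwards [h] with Y hY
  exact PD_of_bound hc hY
/-- Duality -/
theorem GDL (C : Set (MC n)) (hC : Convex ℝ C) (hne : C.Nonempty) :
    (∃ X ∈ C, PD X) ∨ ∃ Z : MC n, Z ≠ 0 ∧ Zᴴ = Z ∧ (∀ v, 0 ≤ rq Z v) ∧
      ∀ X ∈ C, (trace (X * Z)).re ≤ 0 := by
  by_cases hex : ∃ X ∈ C, PD X
  · exact Or.inl hex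
  refine Or.inr ?_
  push Not at hex
  have hconv : Convex ℝ {X : MC n | PD X} := by
    intro X hX Y hY a b ha hb hab v hv
    rw [rq_add, rq_rsmul, rq_rsmul]
    have h1 := hX v hv
    have h2 := hY v hv
    rcases ha.eq_or_lt with rfl | ha'
    · have : b = 1 := by linarith
      subst this; simpa using h2
    · have := mul_pos ha' h1
      have := mul_nonneg hb h2.le
      linarith
  obtain ⟨f, u, hf1, hf2⟩ := geometric_hahn_banach_open hconv PD_open hC
    (Set.disjoint_left.2 fun X hX hXC => hex X hXC hX)
  have hu : 0 ≤ u := by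
    by_contra hlt
    push Not at hlt
    obtain ⟨t, ht, htl⟩ : ∃ t : ℝ, 0 < t ∧ t * |f 1| < -u :=
      ⟨-u / (|f 1| + 1) , div_pos (by linarith) (by positivity), by
        rw [div_mul_eq_mul_div, div_lt_iff₀ (by positivity)]; nlinarith [abs_nonneg (f 1)]⟩
    have h1 := hf1 (t • 1) (fun v hv => by
      rw [rq_rsmul]; exact mul_pos ht (PD_one v hv))
    rw [map_smul, smul_eq_mul] at h1
    have : -(t * |f 1|) ≤ t * f 1 := by nlinarith [neg_abs_le (f 1)]
    linarith
  have hle : ∀ X, PD X → f X ≤ 0 := by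
    intro X hX
    by_contra hlt
    push Not at hlt
    have h1 := hf1 (((u + 1) / f X) • X) (fun v hv => by
      rw [rq_rsmul]; exact mul_pos (by positivity) (hX v hv))
    rw [map_smul, smul_eq_mul, div_mul_cancel₀ _ hlt.ne'] at h1
    linarith
  have hle' : ∀ X, (∀ v, 0 ≤ rq X v) → f X ≤ 0 := by
    intro X hX
    have h1 : ∀ ε > (0:ℝ), f X ≤ ε * (- f 1) := by
      intro ε hε
      have := hle (ε • 1 + X) (PD.add (fun v hv => by
        rw [rq_rsmul]; exact mul_pos hε (PD_one v hv)) hX)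
      rw [map_add, map_smul, smul_eq_mul] at this
      linarith
    have hpos : 0 ≤ - f 1 := by linarith [hle 1 PD_one]
    by_contra hlt
    push Not at hlt
    have := h1 (f X / (2 * (-f 1 + 1))) (by positivity)
    rw [div_mul_eq_mul_div, le_div_iff₀ (by positivity)] at this
    nlinarith
  have hct : ∀ X, f Xᴴ = f X := by
    intro X
    have h1 := hle' (Xᴴ - X) (fun v => by rw [rq_sub, rq_ct]; simp)
    have h2 := hle' (X - Xᴴ) (fun v => by rw [rq_sub, rq_ct]; simp)
    rw [map_sub] at h1 h2; linarith
  -- representing matrix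
  set Z0 : MC n := fun j i => -(f (Matrix.single i j 1) : ℂ) + I * f (Matrix.single i j I) with hZ0
  have hrep : ∀ X, (trace (X * Z0)).re = - f X := by
    intro X
    conv_rhs => rw [Matrix.matrix_eq_sum_single X]
    rw [map_sum, trace, Complex.re_sum, ← Finset.sum_neg_distrib]
    refine Finset.sum_congr rfl fun i _ => ?_
    rw [map_sum, diag_apply, Matrix.mul_apply, Complex.re_sum, ← Finset.sum_neg_distrib]
    refine Finset.sum_congr rfl fun j _ => ?_
    have : Matrix.single i j (X i j) = (X i j).re • Matrix.single i j (1:ℂ) +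
        (X i j).im • Matrix.single i j I := by
      rw [Matrix.smul_single, Matrix.smul_single, ← Matrix.single_add]
      congr 1
      apply Complex.ext <;> simp
    rw [this, map_add, map_smul, map_smul]
    simp [hZ0, Complex.mul_re]
    ring
  have hrep2 : ∀ X, (trace (X * Z0ᴴ)).re = - f X := by
    intro X
    rw [← hct X, ← hrep Xᴴ]
    have : trace (X * Z0ᴴ) = star (trace (Xᴴ * Z0)) := by
      rw [← Matrix.trace_conjTranspose, Matrix.conjTranspose_mul, Matrix.conjTranspose_conjTranspose,
        Matrix.trace_mul_comm]
    rw [this]; simp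
  have hrep3 : ∀ X, (trace (X * (Z0 + Z0ᴴ))).re = - 2 * f X := by
    intro X
    rw [mul_add, trace_add, Complex.add_re, hrep, hrep2]; ring
  refine ⟨Z0 + Z0ᴴ, ?_, ?_, ?_, ?_⟩
  · intro h0
    have hf0 : ∀ X, f X = 0 := by
      intro X
      have := hrep3 X
      rw [h0] at this; simp at this; exact this
    obtain ⟨X, hX⟩ := hne
    have h1 := hf1 1 PD_one
    have h2 := hf2 X hX
    rw [hf0] at h1 h2
    linarith
  · rw [Matrix.conjTranspose_add, Matrix.conjTranspose_conjTranspose, add_comm]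
  · intro v
    rw [← tr_vec, hrep3]
    have := hle' (vecMulVec v (star v)) (fun w => rq_vec w v)
    linarith
  · intro X hX
    rw [hrep3]
    linarith [hf2 X hX]
/-- all eigenvalues have positive real part -/
def EP (M : MC n) : Prop := ∀ (μ : ℂ) (v : n → ℂ), v ≠ 0 → M *ᵥ v = μ • v → 0 < μ.re
lemma tr_herm_zero (W : MC n) (h : ∀ K : MC n, Kᴴ = K → (trace (K * W)).re = 0) :
    Wᴴ = -W := by
  have hK : (W + Wᴴ)ᴴ = W + Wᴴ := by
    rw [conjTranspose_add, conjTranspose_conjTranspose, add_comm]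
  have h1 := h _ hK
  have h2 : (trace ((W + Wᴴ) * Wᴴ)).re = 0 := by
    have : trace ((W + Wᴴ) * Wᴴ) = star (trace ((W + Wᴴ) * W)) := by
      rw [← Matrix.trace_conjTranspose, Matrix.conjTranspose_mul, hK, Matrix.trace_mul_comm]
    rw [this]; simpa using h1
  have h3 : (trace ((W + Wᴴ)ᴴ * (W + Wᴴ))).re = 0 := by
    rw [hK, mul_add, trace_add, Complex.add_re, h1, h2, add_zero]
  have h4 : W + Wᴴ = 0 := by
    have h5 := tr_factor (1 : MC n) (W + Wᴴ)ᴴ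
    rw [conjTranspose_conjTranspose, one_mul, h3] at h5
    have h6 := (Finset.sum_eq_zero_iff_of_nonneg (fun k _ => by rw [rq_one]; exact nq_nonneg _)).1 h5.symm
    ext i j
    have h7 := h6 i (Finset.mem_univ i)
    rw [rq_one, nq_eq_zero] at h7
    have h8 := congrFun h7 j
    rw [hK] at h8
    have h9 : (W + Wᴴ) i j = star ((W + Wᴴ)ᴴ j i) := by simp
    rw [h9, hK, h8]; simp
  exact (neg_eq_of_add_eq_zero_right h4).symm
lemma diag_mul_rank (U D W : MC n) (hW : W * Wᴴ = 1) :
    (U * D * W) * (U * D * W)ᴴ = U * (D * Dᴴ) * Uᴴ := by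
  simp only [conjTranspose_mul]
  calc _ = U * D * (W * Wᴴ) * Dᴴ * Uᴴ := by simp only [mul_assoc]
    _ = _ := by rw [hW]; simp only [mul_one, mul_assoc]
theorem DL (Q T : MC n)
    (h : ∀ (ξ : ℝ) (u : n → ℂ), u ≠ 0 → T *ᵥ u = (ξ : ℂ) • u → 0 < rq Q u) :
    ∃ K : MC n, Kᴴ = K ∧ PD (Q + I • (K * T)) := by
  set C : Set (MC n) := {X | ∃ K : MC n, Kᴴ = K ∧ X = Q + I • (K * T)}
  have hC : Convex ℝ C := by
    rintro _ ⟨K, hK, rfl⟩ _ ⟨K', hK', rfl⟩ a b ha hb hab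
    refine ⟨a • K + b • K', by simp [conjTranspose_smul, hK, hK'], ?_⟩
    have : Q = a • Q + b • Q := by rw [← add_smul, hab, one_smul]
    nth_rw 3 [this]
    simp only [smul_add, add_mul, Matrix.smul_mul, smul_comm I]
    abel
  rcases GDL C hC ⟨Q, 0, by simp, by simp⟩ with ⟨X, ⟨K, hK, rfl⟩, hX⟩ | ⟨Z, hZ0, hZ, hpsd, hle⟩
  · exact ⟨K, hK, hX⟩
  exfalso
  have hsk : (I • (T * Z))ᴴ = - (I • (T * Z)) := by
    apply tr_herm_zero
    intro K hK
    have key : ∀ t : ℝ, (trace (Q * Z)).re + t * (trace (K * (I • (T * Z)))).re ≤ 0 := by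
      intro t
      have := hle (Q + I • ((t • K) * T)) ⟨t • K, by simp [conjTranspose_smul, hK], rfl⟩
      rw [add_mul, trace_add, Complex.add_re] at this
      convert this using 2
      rw [← Complex.re_ofReal_mul]
      congr 1
      simp only [Matrix.smul_mul, Matrix.mul_smul, trace_smul, mul_assoc, smul_eq_mul, Complex.real_smul]
      ring
    set a := (trace (Q * Z)).re
    set b := (trace (K * (I • (T * Z)))).re
    by_contra hb
    have := key ((1 - a) / b)
    rw [div_mul_cancel₀ _ hb] at this
    linarith
  have hTZ : T * Z = Z * Tᴴ := by
    rw [conjTranspose_smul, conjTranspose_mul, hZ, Complex.star_def, Complex.conj_I, neg_smul, neg_inj] at hsk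
    exact (smul_right_injective _ Complex.I_ne_zero hsk).symm
  obtain ⟨U, d, hU1, hU2, hd, hZd⟩ := herm_psd_spec Z hZ hpsd
  set T' := Uᴴ * T * U with hT'
  have hT'd : ∀ i j, T' i j * d j = d i * star (T' j i) := by
    have e : T' * diagonal (fun i => (d i : ℂ)) = diagonal (fun i => (d i : ℂ)) * T'ᴴ := by
      have e1 : Uᴴ * (T * Z) * U = T' * diagonal (fun i => (d i : ℂ)) := by
        rw [hZd, hT']
        calc _ = Uᴴ * T * U * diagonal (fun i => (d i : ℂ)) * (Uᴴ * U) := by simp only [mul_assoc]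
          _ = _ := by rw [hU1, mul_one]
      have e2 : Uᴴ * (Z * Tᴴ) * U = diagonal (fun i => (d i : ℂ)) * T'ᴴ := by
        rw [hZd, hT']
        simp only [conjTranspose_mul, conjTranspose_conjTranspose]
        calc _ = (Uᴴ * U) * diagonal (fun i => (d i : ℂ)) * (Uᴴ * (Tᴴ * U)) := by simp only [mul_assoc]
          _ = _ := by rw [hU1, one_mul]
      rw [← e1, ← e2, hTZ]
    intro i j
    have := congrFun (congrFun e i) j
    rwa [Matrix.mul_diagonal, Matrix.diagonal_mul, conjTranspose_apply] at this
  set s : n → ℝ := fun i => Real.sqrt (d i) with hs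
  have hss : ∀ i, (s i : ℂ) * s i = d i := fun i => by
    rw [← Complex.ofReal_mul, Real.mul_self_sqrt (hd i)]
  set Cm : MC n := fun i j => (s i : ℂ)⁻¹ * T' i j * s j with hCm
  have hs0 : ∀ i, s i = 0 → (d i : ℂ) = 0 := fun i hi => by rw [← hss, hi]; simp
  have hTz : ∀ i j, s i = 0 → T' i j * s j = 0 := by
    intro i j hi
    have := hT'd i j
    rw [hs0 i hi, zero_mul, ← hss] at this
    rcases mul_eq_zero.1 this with h | h
    · rw [h, zero_mul]
    · rw [mul_self_eq_zero.1 h, mul_zero]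
  have hCh : Cmᴴ = Cm := by
    ext i j
    rw [conjTranspose_apply]
    simp only [hCm]
    by_cases hi : s i = 0
    · simp [hi]
    by_cases hj : s j = 0
    · simp [hj]
    have hi' : (s i : ℂ) ≠ 0 := by exact_mod_cast hi
    have hj' : (s j : ℂ) ≠ 0 := by exact_mod_cast hj
    have := hT'd i j
    rw [← hss, ← hss] at this
    simp only [star_mul', star_inv₀, Complex.star_def, Complex.conj_ofReal] at this ⊢
    field_simp
    linear_combination -this
  have hDC : diagonal (fun i => (s i : ℂ)) * Cm = T' * diagonal (fun i => (s i : ℂ)) := by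
    ext i j
    rw [Matrix.mul_diagonal, Matrix.diagonal_mul]
    simp only [hCm]
    by_cases hi : s i = 0
    · rw [hTz i j hi, hi]; simp
    · have hi' : (s i : ℂ) ≠ 0 := by exact_mod_cast hi
      field_simp
  obtain ⟨W, ξ, hW1, hW2, hCW⟩ := herm_spec Cm hCh
  set V := U * diagonal (fun i => (s i : ℂ)) * W with hV
  have hVZ : V * Vᴴ = Z := by
    rw [hV, diag_mul_rank _ _ _ hW2, hZd]
    congr 2
    rw [Matrix.diagonal_conjTranspose, Matrix.diagonal_mul_diagonal]
    congr 1; ext i; simp [hss]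
  have hTV : T * V = V * diagonal (fun i => (ξ i : ℂ)) := by
    have e1 : T * U = U * T' := by
      rw [hT', ← mul_assoc, ← mul_assoc, hU2, one_mul]
    have e2 : Cm * W = W * diagonal (fun i => (ξ i : ℂ)) := by
      conv_lhs => rw [hCW]
      rw [mul_assoc, hW1, mul_one]
    calc T * V = (T * U) * diagonal (fun i => (s i : ℂ)) * W := by rw [hV]; simp only [mul_assoc]
      _ = U * (T' * diagonal (fun i => (s i : ℂ))) * W := by rw [e1]; simp only [mul_assoc]
      _ = U * diagonal (fun i => (s i : ℂ)) * (Cm * W) := by rw [← hDC]; simp only [mul_assoc]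
      _ = _ := by rw [e2, hV]; simp only [mul_assoc]
  have hcol : ∀ k, T *ᵥ (fun i => V i k) = (ξ k : ℂ) • (fun i => V i k) := by
    intro k; ext i
    have := congrFun (congrFun hTV i) k
    rw [Matrix.mul_diagonal] at this
    simp only [Pi.smul_apply, smul_eq_mul]
    rw [mul_comm, ← this]; rfl
  have hsum := hle Q ⟨0, by simp, by simp⟩
  rw [← hVZ, tr_factor] at hsum
  have hnn : ∀ k, 0 ≤ rq Q (fun i => V i k) := by
    intro k
    by_cases h0 : (fun i => V i k) = 0
    · rw [h0, rq_zerov]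
    · exact (h (ξ k) _ h0 (hcol k)).le
  have hz := (Finset.sum_eq_zero_iff_of_nonneg (fun k _ => hnn k)).1
    (le_antisymm hsum (Finset.sum_nonneg fun k _ => hnn k))
  apply hZ0
  have hV0 : V = 0 := by
    ext i k
    by_contra hne
    have h0 : (fun i => V i k) ≠ 0 := fun h0 => hne (congrFun h0 i)
    exact (h (ξ k) _ h0 (hcol k)).ne' (hz k (Finset.mem_univ k))
  rw [← hVZ, hV0]; simp
lemma exists_eig_inv (M Z R : MC n) (hZ : Z ≠ 0) (h : M * Z = Z * R) :
    ∃ (μ : ℂ) (v : n → ℂ), Z *ᵥ v ≠ 0 ∧ M *ᵥ (Z *ᵥ v) = μ • (Z *ᵥ v) := by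
  set E := LinearMap.range (toLin' Z)
  have hinv : ∀ x ∈ E, toLin' M x ∈ E := by
    rintro _ ⟨v, rfl⟩
    refine ⟨R *ᵥ v, ?_⟩
    simp [mulVec_mulVec, h]
  have hnt : Nontrivial E := by
    rw [Submodule.nontrivial_iff_ne_bot]
    intro hb
    rw [LinearMap.range_eq_bot] at hb
    exact hZ (by simpa using hb)
  obtain ⟨μ, hμ⟩ := Module.End.exists_eigenvalue ((toLin' M).restrict hinv)
  obtain ⟨⟨x, v, hv⟩, hx⟩ := hμ.exists_hasEigenvector
  refine ⟨μ, v, ?_, ?_⟩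
  · intro h0
    apply hx.2
    apply Subtype.ext
    simpa [← hv] using h0
  · have := congrArg Subtype.val hx.apply_eq_smul
    simp only [LinearMap.coe_restrict_apply, Submodule.coe_smul] at this
    rw [← hv] at this
    simpa using this
theorem DL2 (M : MC n) (hM : EP M) :
    ∃ K : MC n, Kᴴ = K ∧ PD K ∧ PD (K * M) := by
  set C : Set (MC n) := {X | ∃ K : MC n, Kᴴ = K ∧ PD K ∧ X = K * M}
  have hC : Convex ℝ C := by
    rintro _ ⟨K, hK, hp, rfl⟩ _ ⟨K', hK', hp', rfl⟩ a b ha hb hab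
    refine ⟨a • K + b • K', by simp [conjTranspose_smul, hK, hK'], ?_, ?_⟩
    · intro v hv
      rw [rq_add, rq_rsmul, rq_rsmul]
      have h1 := hp v hv
      have h2 := hp' v hv
      rcases ha.eq_or_lt with rfl | ha'
      · have : b = 1 := by linarith
        subst this; simpa using h2
      · have := mul_pos ha' h1
        have := mul_nonneg hb h2.le
        linarith
    · simp [add_mul, Matrix.smul_mul]
  rcases GDL C hC ⟨_, 1, by simp, PD_one, rfl⟩ with ⟨X, ⟨K, hK, hp, rfl⟩, hX⟩ | ⟨Z, hZ0, hZ, hpsd, hle⟩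
  · exact ⟨K, hK, hp, hX⟩
  exfalso
  have hneg : ∀ v, rq (M * Z) v ≤ 0 := by
    intro v
    rw [← tr_vec, ← mul_assoc]
    have key : ∀ ε > (0:ℝ), (trace (vecMulVec v (star v) * M * Z)).re + ε * (trace (M * Z)).re ≤ 0 := by
      intro ε hε
      have := hle ((vecMulVec v (star v) + (ε : ℂ) • 1) * M)
        ⟨_, by simp [conjTranspose_add, conjTranspose_smul, Matrix.conjTranspose_vecMulVec], ?_, rfl⟩
      · rw [add_mul, add_mul, trace_add, Complex.add_re] at this
        convert this using 2
        rw [← Complex.re_ofReal_mul]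
        simp [Matrix.smul_mul]
      · rw [add_comm]
        refine PD.add (fun w hw => ?_) (fun w => rq_vec w v)
        rw [rq_smul]; exact mul_pos hε (PD_one w hw)
    set a := (trace (vecMulVec v (star v) * M * Z)).re
    set b := (trace (M * Z)).re
    by_contra hlt
    push Not at hlt
    have := key (a / (2 * (|b| + 1))) (by positivity)
    have h2 : a / (2 * (|b| + 1)) * (-|b|) ≤ a / (2 * (|b| + 1)) * b :=
      mul_le_mul_of_nonneg_left (neg_abs_le b) (by positivity)
    have h3 : a / (2 * (|b| + 1)) * |b| ≤ a / 2 := by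
      rw [div_mul_eq_mul_div, div_le_iff₀ (by positivity)]
      nlinarith [abs_nonneg b]
    linarith
  set W := -(M * Z + Z * Mᴴ) with hWdef
  have hWh : Wᴴ = W := by
    rw [hWdef]; simp [conjTranspose_mul, hZ, add_comm]
  have hrW : ∀ v, rq W v = - 2 * rq (M * Z) v := by
    intro v
    rw [hWdef, rq_neg, rq_add]
    have : rq (Z * Mᴴ) v = rq (M * Z) v := by rw [← rq_ct (M * Z), conjTranspose_mul, hZ]
    rw [this]; ring
  have hWp : ∀ v, 0 ≤ rq W v := fun v => by rw [hrW]; linarith [hneg v]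
  have hker : ∀ v, Z *ᵥ v = 0 → W *ᵥ v = 0 := by
    intro v hv
    apply psd_null W hWh hWp
    rw [hrW]; unfold rq; rw [← mulVec_mulVec, hv]; simp
  -- pseudo-inverse
  obtain ⟨U, d, hU1, hU2, hd, hZd⟩ := herm_psd_spec Z hZ hpsd
  set Zp := U * diagonal (fun i => (d i : ℂ)⁻¹) * Uᴴ with hZp
  have hZZZ : Z * Zp * Z = Z := by
    rw [hZp, hZd]
    calc _ = U * diagonal (fun i => (d i : ℂ)) * (Uᴴ * U) * diagonal (fun i => (d i : ℂ)⁻¹) * (Uᴴ * U) *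
          diagonal (fun i => (d i : ℂ)) * Uᴴ := by simp only [mul_assoc]
      _ = U * (diagonal (fun i => (d i : ℂ)) * diagonal (fun i => (d i : ℂ)⁻¹) *
          diagonal (fun i => (d i : ℂ))) * Uᴴ := by rw [hU1]; simp only [mul_one, mul_assoc]
      _ = _ := by
        rw [Matrix.diagonal_mul_diagonal, Matrix.diagonal_mul_diagonal]
        congr 3; ext i
        by_cases h : (d i : ℂ) = 0
        · simp [h]
        · field_simp
  have hWZ : W * (Zp * Z) = W := by
    have : W * (1 - Zp * Z) = 0 := by
      ext i j
      have h1 : Z *ᵥ (fun k => (1 - Zp * Z) k j) = 0 := by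
        have : Z * (1 - Zp * Z) = 0 := by
          rw [mul_sub, mul_one, ← mul_assoc, hZZZ, sub_self]
        ext k; exact congrFun (congrFun this k) j
      have := hker _ h1
      exact congrFun this i
    rw [mul_sub, mul_one, sub_eq_zero] at this
    exact this.symm
  have hMZ : M * Z = Z * (-(Zpᴴ * W) - Mᴴ) := by
    have h1 : W = Z * Zpᴴ * W := by
      have := congrArg conjTranspose hWZ
      rw [conjTranspose_mul, conjTranspose_mul, hWh, hZ] at this
      exact this.symm
    have h2 : M * Z = -W - Z * Mᴴ := by rw [hWdef]; abel
    rw [h2, mul_sub, mul_neg, ← mul_assoc, ← h1]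
  obtain ⟨μ, v, hv, hμ⟩ := exists_eig_inv M Z _ hZ0 hMZ
  have hre := hM μ _ hv hμ
  have h1 := hneg v
  have h2 : rq (M * Z) v = μ.re * rq Z v := by
    unfold rq
    rw [← mulVec_mulVec, hμ, dotProduct_smul, herm_im Z hZ]
    simp
  have h3 : 0 < rq Z v := lt_of_le_of_ne (hpsd v) fun h => hv (psd_null Z hZ hpsd v h.symm)
  have := mul_pos hre h3
  linarith
lemma rq_null_left (S M : MC n) (hS : Sᴴ = S) (v) (h : S *ᵥ v = 0) : rq (S * M) v = 0 := by
  unfold rq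
  rw [← mulVec_mulVec, star_dot_mulVec, hS, h]; simp
theorem INERT (S M : MC n) (hS : Sᴴ = S) (h : PD (S * M)) (hM : EP M) : PD S := by
  obtain ⟨P, hP, hPp, hPM⟩ := DL2 M hM
  by_cases hne : (sph n).Nonempty
  swap
  · intro v hv
    obtain ⟨u, hu, -⟩ := exists_sph hv
    exact (hne ⟨u, hu⟩).elim
  have h0 : ∀ u ∈ sph n, u ≠ 0 := by
    rintro u hu rfl
    have : nq (0 : n → ℂ) = 1 := hu
    rw [nq_eq_zero.2 rfl] at this; norm_num at this
  obtain ⟨u, hu, hmin⟩ := isCompact_sph.exists_isMinOn hne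
    (f := fun v => rq S v / rq P v)
    (((continuous_rq S).continuousOn).div (continuous_rq P).continuousOn
      fun v hv => (hPp v (h0 v hv)).ne')
  set l := rq S u / rq P u with hl
  have hmin' : ∀ v, 0 ≤ rq (S + ((-l : ℝ) : ℂ) • P) v := by
    intro v
    have := hom_bound (S + ((-l : ℝ) : ℂ) • P) 0 (fun w hw => ?_) v
    · simpa using this
    · have h1 : l ≤ rq S w / rq P w := hmin hw
      rw [le_div_iff₀ (hPp w (h0 w hw))] at h1
      rw [rq_add, rq_smul]; linarith
  by_cases hlp : 0 < l
  · intro v hv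
    have := hmin' v
    rw [rq_add, rq_smul] at this
    have := mul_pos hlp (hPp v hv)
    linarith
  exfalso
  push Not at hlp
  have hh : (S + ((-l : ℝ) : ℂ) • P)ᴴ = S + ((-l : ℝ) : ℂ) • P := by
    rw [conjTranspose_add, conjTranspose_smul, hS, hP, Complex.star_def, Complex.conj_ofReal]
  have hnull := psd_null _ hh hmin' u (by
    rw [rq_add, rq_smul, hl]
    have := (hPp u (h0 u hu)).ne'
    field_simp; ring)
  have h1 := rq_null_left _ M hh u hnull
  rw [add_mul, rq_add, Matrix.smul_mul, rq_smul] at h1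
  have h2 := h u (h0 u hu)
  have h3 := hPM u (h0 u hu)
  nlinarith
end
section
variable {n : Type*} [Fintype n] [DecidableEq n]
open Polynomial in
lemma aeval_eig (M : MC n) (f : ℂ[X]) (μ : ℂ) (v : n → ℂ) (h : M *ᵥ v = μ • v) :
    (aeval M f) *ᵥ v = (f.eval μ) • v := by
  induction f using Polynomial.induction_on' with
  | add p q hp hq => rw [map_add, add_mulVec, hp, hq, eval_add, add_smul]
  | monomial k a =>
    rw [aeval_monomial, eval_monomial]
    have : ∀ k : ℕ, (M ^ k) *ᵥ v = (μ ^ k) • v := by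
      intro k
      induction k with
      | zero => simp
      | succ k ih => rw [pow_succ, ← mulVec_mulVec, h, mulVec_smul, ih, smul_smul, pow_succ, mul_comm]
    rw [← mulVec_mulVec, this, Matrix.algebraMap_eq_diagonal]
    ext i; simp [Matrix.mulVec_diagonal, mul_assoc]
open Polynomial in
lemma eig_root (M : MC n) (μ : ℂ) (v : n → ℂ) (hv : v ≠ 0) (h : M *ᵥ v = μ • v)
    (f : ℂ[X]) (hf : aeval M f = 0) : f.eval μ = 0 := by
  have := aeval_eig M f μ v h
  rw [hf, zero_mulVec] at this
  rcases smul_eq_zero.1 this.symm with h | h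
  · exact h
  · exact (hv h).elim
open Polynomial in
lemma aeval_comm (M : MC n) (f : ℂ[X]) : aeval M f * M = M * aeval M f := by
  have h1 : aeval M (f * X) = aeval M f * M := by rw [map_mul, aeval_X]
  have h2 : aeval M (X * f) = M * aeval M f := by rw [map_mul, aeval_X]
  rw [← h1, ← h2, mul_comm]
open Polynomial in
theorem SPLIT (M : MC n) (A : ℂ → Prop) : ∃ f : ℂ[X],
    aeval M f * aeval M f = aeval M f ∧
    ∀ (μ : ℂ) (v : n → ℂ), v ≠ 0 → M *ᵥ v = μ • v →
      (A μ → f.eval μ = 1) ∧ (¬ A μ → f.eval μ = 0) := by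
  classical
  set r := M.charpoly.roots
  have hsp : M.charpoly = (r.map fun a => X - C a).prod :=
    (IsAlgClosed.splits M.charpoly).eq_prod_roots_of_monic (charpoly_monic M)
  set fA := ((r.filter A).map fun a => X - C a).prod with hfA
  set fB := ((r.filter fun a => ¬ A a).map fun a => X - C a).prod with hfB
  have hAB : M.charpoly = fA * fB := by
    rw [hfA, hfB, ← Multiset.prod_add, ← Multiset.map_add, Multiset.filter_add_not, ← hsp]
  have hcop : IsCoprime fA fB := by
    rw [Polynomial.isCoprime_iff_aeval_ne_zero_of_isAlgClosed ℂ ℂ]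
    intro a
    by_contra hcon
    push Not at hcon
    rw [Polynomial.coe_aeval_eq_eval] at hcon
    have e : ∀ s : Multiset ℂ, ((s.map fun a => X - C a).prod).eval a = 0 → a ∈ s := by
      intro s hs
      rw [Polynomial.eval_multiset_prod, Multiset.prod_eq_zero_iff] at hs
      simp only [Multiset.map_map, Multiset.mem_map, Function.comp] at hs
      obtain ⟨b, hb, hab⟩ := hs
      simp [sub_eq_zero] at hab
      rwa [hab]
    have h1 := e _ hcon.1
    have h2 := e _ hcon.2
    rw [Multiset.mem_filter] at h1 h2
    exact h2.2 h1.2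
  obtain ⟨a, b, hab⟩ := hcop
  have hch : aeval M (fA * fB) = 0 := by rw [← hAB]; exact Matrix.aeval_self_charpoly M
  refine ⟨b * fB, ?_, ?_⟩
  · have : b * fB * (b * fB) = b * fB - a * b * (fA * fB) := by
      linear_combination (b * fB) * hab
    rw [← map_mul, this, map_sub, map_mul _ (a * b), hch, mul_zero, sub_zero]
  · intro μ v hv hμ
    have hr : M.charpoly.eval μ = 0 := eig_root M μ v hv hμ _ (Matrix.aeval_self_charpoly M)
    have hmem : μ ∈ r := (Polynomial.mem_roots (charpoly_monic M).ne_zero).2 hr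
    have e : ∀ s : Multiset ℂ, μ ∈ s → ((s.map fun a => X - C a).prod).eval μ = 0 := by
      intro s hs
      rw [Polynomial.eval_multiset_prod, Multiset.prod_eq_zero_iff]
      simp only [Multiset.map_map, Multiset.mem_map, Function.comp]
      exact ⟨μ, hs, by simp⟩
    constructor
    · intro hA
      have h1 := e (r.filter A) (Multiset.mem_filter.2 ⟨hmem, hA⟩)
      have h2 := congrArg (eval μ) hab
      rw [eval_add, eval_mul] at h2
      rw [← hfA] at h1
      rw [h1] at h2
      simpa using h2
    · intro hA
      have h1 := e (r.filter fun a => ¬ A a) (Multiset.mem_filter.2 ⟨hmem, hA⟩)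
      rw [eval_mul, hfB, h1, mul_zero]
/-- hyperbolic splitting data -/
structure Spl (G P : MC n) : Prop where
  idem : P * P = P
  comm : P * G = G * P
  ep : EP (G * P - G * (1 - P))
theorem SSLp (M : MC n)
    (h : ∀ (μ : ℂ) (v : n → ℂ), v ≠ 0 → M *ᵥ v = μ • v → μ.re ≠ 0) : ∃ f : Polynomial ℂ, Spl M (Polynomial.aeval M f) := by
  obtain ⟨f, hi, hf⟩ := SPLIT M (fun μ => 0 < μ.re)
  refine ⟨f, hi, aeval_comm M f, ?_⟩
  set P := Polynomial.aeval M f with hP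
  have hc : P * M = M * P := aeval_comm M f
  intro μ v hv hμ
  have e1 : P * (M * P - M * (1 - P)) = M * P := by
    rw [mul_sub, ← mul_assoc, ← mul_assoc, hc, mul_sub, mul_one,
      mul_assoc, hi, sub_self, sub_zero]
  have e2 : (1 - P) * (M * P - M * (1 - P)) = - (M * (1 - P)) := by
    rw [sub_mul, e1, one_mul]; abel
  by_cases h1 : P *ᵥ v = 0
  · have h2 : (1 - P) *ᵥ v ≠ 0 := by
      rw [sub_mulVec, one_mulVec, h1, sub_zero]; exact hv
    have h3 : M *ᵥ ((1 - P) *ᵥ v) = (-μ) • ((1 - P) *ᵥ v) := by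
      have := congrArg (fun X => X *ᵥ v) e2
      simp only [← mulVec_mulVec, neg_mulVec] at this
      rw [hμ, mulVec_smul] at this
      rw [neg_smul, this, neg_neg]
    have h4 : Polynomial.eval (-μ) f = 0 := by
      have := aeval_eig M f _ _ h3
      rw [← hP, mulVec_mulVec, mul_sub, hi, mul_one, sub_self, zero_mulVec] at this
      rcases smul_eq_zero.1 this.symm with h | h
      · exact h
      · exact (h2 h).elim
    have h5 := h _ _ h2 h3
    have h6 : ¬ 0 < (-μ).re := fun hp => by
      have := (hf _ _ h2 h3).1 hp
      rw [h4] at this; norm_num at this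
    simp at h5 h6
    exact lt_of_le_of_ne h6 (Ne.symm h5)
  · have h3 : M *ᵥ (P *ᵥ v) = μ • (P *ᵥ v) := by
      have := congrArg (fun X => X *ᵥ v) e1
      simp only [← mulVec_mulVec] at this
      rw [hμ, mulVec_smul] at this
      rw [this]
    by_contra hn
    have h4 := (hf _ _ h1 h3).2 hn
    have := aeval_eig M f _ _ h3
    rw [← hP, mulVec_mulVec, hi, h4, zero_smul] at this
    exact h1 this
theorem SSL (M : MC n)
    (h : ∀ (μ : ℂ) (v : n → ℂ), v ≠ 0 → M *ᵥ v = μ • v → μ.re ≠ 0) : ∃ P, Spl M P := by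
  obtain ⟨f, hf⟩ := SSLp M h
  exact ⟨_, hf⟩
lemma split_ne {P : MC n} {v : n → ℂ} (hv : v ≠ 0) : P *ᵥ v ≠ 0 ∨ (1 - P) *ᵥ v ≠ 0 := by
  by_contra h
  push Not at h
  apply hv
  have : v = P *ᵥ v + (1 - P) *ᵥ v := by rw [← add_mulVec]; simp
  rw [this, h.1, h.2, add_zero]
lemma PD_two {M M' P : MC n} (h : PD M) (h' : PD M') {a b : ℝ} (ha : 0 < a) (hb : 0 < b)
    {v : n → ℂ} (hv : v ≠ 0) :
    0 < a * rq M (P *ᵥ v) + b * rq M' ((1 - P) *ᵥ v) := by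
  rcases split_ne (P := P) hv with h1 | h1
  · have := mul_pos ha (h _ h1)
    have := mul_nonneg hb.le (h'.nonneg ((1 - P) *ᵥ v))
    linarith
  · have := mul_pos hb (h' _ h1)
    have := mul_nonneg ha.le (h.nonneg (P *ᵥ v))
    linarith
/-- the weighted Lyapunov matrix -/
def lyap (K P : MC n) (a b : ℝ) : MC n :=
  (a : ℂ) • (Pᴴ * K * P) - (b : ℂ) • ((1 - P)ᴴ * K * (1 - P))
lemma lyap_herm {K P : MC n} (hK : Kᴴ = K) (a b : ℝ) : (lyap K P a b)ᴴ = lyap K P a b := by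
  unfold lyap
  simp [conjTranspose_sub, conjTranspose_smul, conjTranspose_mul, hK, mul_assoc]
lemma rq_lyap (K P : MC n) (a b : ℝ) (v) :
    rq (lyap K P a b) v = a * rq K (P *ᵥ v) - b * rq K ((1 - P) *ᵥ v) := by
  unfold lyap
  rw [rq_sub, rq_smul, rq_smul, rq_conj, rq_conj]
theorem Spl.exists_lyap {G P : MC n} (h : Spl G P) : ∃ K : MC n, Kᴴ = K ∧ PD K ∧
    ∀ a b : ℝ, 0 < a → 0 < b → PD (lyap K P a b * G) := by
  obtain ⟨K, hK, hp, hKM⟩ := DL2 _ h.ep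
  refine ⟨K, hK, hp, fun a b ha hb v hv => ?_⟩
  have := PD_two (P := P) hKM hKM ha hb hv
  rw [← rq_conj, ← rq_conj, ← rq_smul, ← rq_smul, ← rq_add] at this
  convert this using 2
  unfold lyap
  have e1 : (G * P - G * (1 - P)) * P = G * P := by
    rw [sub_mul, mul_assoc, mul_assoc, sub_mul, h.idem]; simp
  have e2 : (G * P - G * (1 - P)) * (1 - P) = - ((1 - P) * G) := by
    rw [mul_sub, e1, mul_one, sub_mul 1 P G, h.comm, mul_sub]; simp
  rw [sub_mul, Matrix.smul_mul, Matrix.smul_mul]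
  rw [show Pᴴ * (K * (G * P - G * (1 - P))) * P = Pᴴ * K * ((G * P - G * (1 - P)) * P) by
      simp only [mul_assoc],
    show (1 - P)ᴴ * (K * (G * P - G * (1 - P))) * (1 - P) =
      (1 - P)ᴴ * K * ((G * P - G * (1 - P)) * (1 - P)) by simp only [mul_assoc], e1, e2, ← h.comm]
  simp only [mul_neg, smul_neg, mul_assoc]
  abel
theorem Spl.sign {G P : MC n} (h : Spl G P) {S : MC n} (hS : Sᴴ = S)
    (hSG : PD (S * G)) : (∀ v, v ≠ 0 → P *ᵥ v = v → 0 < rq S v) ∧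
      (∀ v, v ≠ 0 → P *ᵥ v = 0 → rq S v < 0) := by
  have hPD : PD (lyap S P 1 1) := by
    refine INERT _ _ (lyap_herm hS 1 1) (fun v hv => ?_) h.ep
    have := PD_two (P := P) hSG hSG one_pos one_pos hv
    rw [← rq_conj, ← rq_conj, ← rq_smul, ← rq_smul, ← rq_add] at this
    convert this using 2
    unfold lyap
    have e1 : P * (G * P - G * (1 - P)) = G * P := by
      rw [mul_sub, ← mul_assoc, ← mul_assoc, h.comm, mul_assoc, h.idem,
        mul_sub, mul_one, mul_assoc, h.idem]; simp
    have e2 : (1 - P) * (G * P - G * (1 - P)) = - (G * (1 - P)) := by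
      rw [sub_mul, e1]; simp
    rw [sub_mul, Matrix.smul_mul, Matrix.smul_mul, mul_assoc _ P, e1,
      mul_assoc _ (1 - P), e2]
    simp only [mul_neg, smul_neg, mul_assoc]
    abel
  constructor
  · intro v hv hPv
    have := hPD v hv
    rw [rq_lyap, sub_mulVec, hPv, one_mulVec, sub_self, rq_zerov] at this
    linarith
  · intro v hv hPv
    have := hPD v hv
    rw [rq_lyap, sub_mulVec, hPv, one_mulVec, sub_zero, rq_zerov] at this
    linarith
theorem Spl.dim_pos {G P : MC n} (h : Spl G P) {S : MC n} (hS : Sᴴ = S)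
    (hSG : PD (S * G)) (E : Submodule ℂ (n → ℂ)) (hE : ∀ v ∈ E, v ≠ 0 → 0 < rq S v) :
    Module.finrank ℂ E ≤ P.rank := by
  have hd : Disjoint E (LinearMap.ker (toLin' P)) := by
    rw [Submodule.disjoint_def]
    intro v hv hk
    by_contra h0
    have h1 := hE v hv h0
    have h2 := (h.sign hS hSG).2 v h0 (by simpa using hk)
    linarith
  have hinj : Function.Injective ((toLin' P).domRestrict E) := by
    rw [← LinearMap.ker_eq_bot, LinearMap.ker_eq_bot']
    rintro v hv
    exact Subtype.ext (Submodule.disjoint_def.1 hd v.1 v.2 (by simpa using hv))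
  have h1 := LinearMap.finrank_range_of_inj hinj
  have h2 : LinearMap.range ((toLin' P).domRestrict E) ≤ LinearMap.range (toLin' P) := by
    rintro _ ⟨v, rfl⟩; exact ⟨v.1, rfl⟩
  rw [← h1, Matrix.rank, ← Matrix.toLin'_apply']
  exact Submodule.finrank_mono h2
lemma ker_le_range_idem {P : MC n} (hi : P * P = P) :
    LinearMap.ker (toLin' P) = LinearMap.range (toLin' (1 - P)) := by
  ext v
  constructor
  · intro hv
    refine ⟨v, ?_⟩
    have : P *ᵥ v = 0 := by simpa using hv
    simp [sub_mulVec, this]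
  · rintro ⟨w, rfl⟩
    rw [LinearMap.mem_ker, Matrix.toLin'_apply, Matrix.toLin'_apply, mulVec_mulVec, mul_sub, hi]
    simp
lemma rank_def' (P : MC n) : P.rank = Module.finrank ℂ (LinearMap.range (toLin' P)) := by
  rw [Matrix.rank, Matrix.toLin'_apply']
lemma rank_idem {P : MC n} (hi : P * P = P) : (1 - P).rank + P.rank = Fintype.card n := by
  have h1 := LinearMap.finrank_range_add_finrank_ker (toLin' P)
  rw [ker_le_range_idem hi] at h1
  rw [← rank_def', ← rank_def', Module.finrank_fintype_fun_eq_card] at h1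
  omega
theorem Spl.dim_neg {G P : MC n} (h : Spl G P) {S : MC n} (hS : Sᴴ = S)
    (hSG : PD (S * G)) (E : Submodule ℂ (n → ℂ)) (hE : ∀ v ∈ E, v ≠ 0 → rq S v < 0) :
    Module.finrank ℂ E + P.rank ≤ Fintype.card n := by
  have hd : Disjoint E (LinearMap.range (toLin' P)) := by
    rw [Submodule.disjoint_def]
    rintro v hv ⟨w, rfl⟩
    by_contra h0
    have h1 := hE _ hv h0
    have h2 := (h.sign hS hSG).1 _ h0 (by simp [h.idem])
    linarith
  have := Submodule.finrank_add_finrank_le_of_disjoint hd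
  rwa [← rank_def', Module.finrank_fintype_fun_eq_card] at this
/-- index is locally constant -/
theorem idx_loc {X : Type*} [TopologicalSpace X] (f : X → MC n) (x0 : X)
    (hf : ∀ i j, ContinuousAt (fun x => f x i j) x0) {P : MC n} (hP : Spl (f x0) P) :
    ∀ᶠ x in 𝓝 x0, ∀ P', Spl (f x) P' → P'.rank = P.rank := by
  obtain ⟨K, hK, hKp, hl⟩ := hP.exists_lyap
  obtain ⟨c, hc, hev⟩ := PD.near' (f := fun x => lyap K P 1 1 * f x) (x0 := x0) (fun i j => by
    simp only [Matrix.mul_apply]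
    exact tendsto_finsetSum _ fun k _ => (continuousAt_const.mul (hf k j))) (hl 1 1 one_pos one_pos)
  filter_upwards [hev] with x hx P' hP'
  have hpd := PD_of_bound hc hx
  have h1 := hP'.dim_pos (lyap_herm hK 1 1) hpd (LinearMap.range (toLin' P)) (by
    rintro _ ⟨w, rfl⟩ h0
    rw [rq_lyap]
    simp only [Matrix.toLin'_apply, mulVec_mulVec, sub_mul, hP.idem, one_mul, sub_self,
      zero_mulVec, rq_zerov] at h0 ⊢
    linarith [hKp _ h0])
  have h2 := hP'.dim_neg (lyap_herm hK 1 1) hpd (LinearMap.range (toLin' (1 - P))) (by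
    rintro _ ⟨w, rfl⟩ h0
    rw [rq_lyap]
    have e : (1 - P) * (1 - P) = 1 - P := by
      simp [mul_sub, sub_mul, hP.idem]
    simp only [Matrix.toLin'_apply, mulVec_mulVec, e, mul_sub, hP.idem, mul_one, sub_self,
      zero_mulVec, rq_zerov] at h0 ⊢
    linarith [hKp _ h0])
  rw [← rank_def'] at h1 h2
  have h3 := rank_idem hP.idem
  omega
/-- homotopy invariance -/
theorem idx_homotopy (f : ℝ → MC n) (hf : ∀ i j, Continuous fun t => f t i j)
    (h : ∀ t ∈ Set.Icc (0:ℝ) 1, ∃ P, Spl (f t) P) {P Q : MC n} (hP : Spl (f 0) P)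
    (hQ : Spl (f 1) Q) : P.rank = Q.rank := by
  choose! R hR using h
  have hR0 : (R 0).rank = P.rank := by
    have := (idx_loc f 0 (fun i j => (hf i j).continuousAt) hP).self_of_nhds
    exact this _ (hR 0 (by simp))
  have hR1 : (R 1).rank = Q.rank := by
    have := (idx_loc f 1 (fun i j => (hf i j).continuousAt) hQ).self_of_nhds
    exact this _ (hR 1 (by simp))
  have hlc : IsPreconnected (Set.Icc (0:ℝ) 1) := isPreconnected_Icc
  have hcont : ContinuousOn (fun t => (R t).rank) (Set.Icc (0:ℝ) 1) := by
    intro t ht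
    have := idx_loc f t (fun i j => (hf i j).continuousAt) (hR t ht)
    refine (continuousWithinAt_const (b := (R t).rank)).congr_of_eventuallyEq ?_ rfl
    filter_upwards [self_mem_nhdsWithin, nhdsWithin_le_nhds this] with s hs h'
    exact h' _ (hR s hs)
  have := hlc.constant hcont (x := 0) (y := 1) (by simp) (by simp)
  rw [← hR0, ← hR1]; exact this
/-- index of a matrix conjugate to its opposite -/
theorem idx_half {G P D : MC n} (hP : Spl G P) (hD : D * D = 1) (h : D * G * D = -G) :
    2 * P.rank = Fintype.card n := by
  have h2 : Spl G (1 - D * P * D) := by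
    have hDG : D * G = - (G * D) := by
      calc D * G = D * G * (D * D) := by rw [hD, mul_one]
        _ = (D * G * D) * D := by simp only [mul_assoc]
        _ = _ := by rw [h, neg_mul]
    have hGD : G * D = - (D * G) := by rw [hDG, neg_neg]
    have hQ : (D * P * D) * (D * P * D) = D * P * D := by
      calc _ = D * P * (D * D) * P * D := by simp only [mul_assoc]
        _ = D * (P * P) * D := by rw [hD, mul_one]; simp only [mul_assoc]
        _ = _ := by rw [hP.idem]
    have hQG : (D * P * D) * G = G * (D * P * D) := by
      calc _ = D * P * (D * G) := by simp only [mul_assoc]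
        _ = - (D * (P * G) * D) := by rw [hDG]; simp only [mul_neg, mul_assoc]
        _ = - (D * G * P * D) := by rw [hP.comm]; simp only [mul_assoc]
        _ = _ := by rw [hDG]; simp only [neg_mul, mul_assoc, neg_neg]
    refine ⟨?_, ?_, ?_⟩
    · rw [mul_sub, sub_mul, sub_mul, hQ]; simp
    · rw [mul_sub, sub_mul, hQG]; simp
    · intro μ v hv hμ
      refine hP.ep μ (D *ᵥ v) ?_ ?_
      · intro h0
        apply hv
        have := congrArg (fun w => D *ᵥ w) h0
        simpa [mulVec_mulVec, hD] using this
      · have e : (G * P - G * (1 - P)) * D = D * (G * (1 - D * P * D) - G * (1 - (1 - D * P * D))) := by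
          have e1 : D * (G * (D * P * D)) = - (G * P * D) := by
            calc _ = (D * G * D) * P * D := by simp only [mul_assoc]
              _ = _ := by rw [h]; simp only [neg_mul]
          simp only [mul_sub, sub_mul, mul_one, sub_sub_cancel]
          rw [e1, hDG]; abel
        rw [mulVec_mulVec, e, ← mulVec_mulVec, hμ, mulVec_smul]
  have h3 := (idx_loc (fun _ : ℝ => G) 0 (fun i j => continuousAt_const) hP).self_of_nhds _ h2
  have hQ : (D * P * D) * (D * P * D) = D * P * D := by
      calc _ = D * P * (D * D) * P * D := by simp only [mul_assoc]
        _ = D * (P * P) * D := by rw [hD, mul_one]; simp only [mul_assoc]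
        _ = _ := by rw [hP.idem]
  have h4 := rank_idem hQ
  have hu : IsUnit D := ⟨⟨D, D, hD, hD⟩, rfl⟩
  have h5 : (D * P * D).rank = P.rank := by
    have hdet : IsUnit D.det := (Matrix.isUnit_iff_isUnit_det D).1 hu
    rw [Matrix.rank_mul_eq_left_of_isUnit_det _ _ hdet, Matrix.rank_mul_eq_right_of_isUnit_det _ _ hdet]
  omega
end
section
variable {n : Type*} [Fintype n] [DecidableEq n]
lemma hur_ms (r : Multiset ℂ) (z0 z1 : ℂ) (δ : ℝ) (hδ : 0 < δ) (h : ∀ a ∈ r, δ ≤ a.re - z0.re) :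
    ‖(r.map fun a => z1 - a).prod‖ * δ ^ (Multiset.card r) ≤
      ‖(r.map fun a => z0 - a).prod‖ * (δ + ‖z1 - z0‖) ^ (Multiset.card r) := by
  induction r using Multiset.induction_on with
  | empty => simp
  | cons a s ih =>
    have ih := ih fun b hb => h b (Multiset.mem_cons_of_mem hb)
    have ha := h a (Multiset.mem_cons_self a s)
    have h1 : δ ≤ ‖z0 - a‖ := by
      have := Complex.abs_re_le_norm (z0 - a)
      have h2 := neg_abs_le (z0 - a).re
      simp only [Complex.sub_re] at *
      linarith
    have h2 : ‖z1 - a‖ * δ ≤ ‖z0 - a‖ * (δ + ‖z1 - z0‖) := by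
      have h3 : ‖z1 - a‖ ≤ ‖z1 - z0‖ + ‖z0 - a‖ := by
        have := norm_add_le (z1 - z0) (z0 - a); simpa using this
      nlinarith [norm_nonneg (z1 - z0), norm_nonneg (z1 - a)]
    simp only [Multiset.map_cons, Multiset.prod_cons, Multiset.card_cons, norm_mul, pow_succ]
    calc _ = (‖z1 - a‖ * δ) * (‖(s.map fun a => z1 - a).prod‖ * δ ^ (Multiset.card s)) := by ring
      _ ≤ (‖z0 - a‖ * (δ + ‖z1 - z0‖)) * (‖(s.map fun a => z0 - a).prod‖ * (δ + ‖z1 - z0‖) ^ (Multiset.card s)) := by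
        apply mul_le_mul h2 ih (by positivity) (by positivity)
      _ = _ := by ring
/-- all eigenvalues have real part at least c -/
def EPc (c : ℝ) (M : MC n) : Prop := ∀ (μ : ℂ) (v : n → ℂ), v ≠ 0 → M *ᵥ v = μ • v → c ≤ μ.re
lemma ev_iff_det (M : MC n) (μ : ℂ) :
    (∃ v : n → ℂ, v ≠ 0 ∧ M *ᵥ v = μ • v) ↔ (Matrix.scalar n μ - M).det = 0 := by
  rw [← exists_mulVec_eq_zero_iff]
  refine exists_congr fun v => and_congr_right fun _ => ?_
  rw [sub_mulVec, sub_eq_zero]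
  have : (Matrix.scalar n μ) *ᵥ v = μ • v := by
    ext i; simp [Matrix.scalar_apply, Matrix.mulVec_diagonal]
  rw [this]; exact eq_comm
lemma charpoly_norm (M : MC n) (c : ℝ) (h : EPc c M) (z0 z1 : ℂ) (hz : z0.re < c) :
    ‖(Matrix.scalar n z1 - M).det‖ * (c - z0.re) ^ (Fintype.card n) ≤
      ‖(Matrix.scalar n z0 - M).det‖ * ((c - z0.re) + ‖z1 - z0‖) ^ (Fintype.card n) := by
  have hsp : M.charpoly = (M.charpoly.roots.map fun a => Polynomial.X - Polynomial.C a).prod :=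
    (IsAlgClosed.splits M.charpoly).eq_prod_roots_of_monic (charpoly_monic M)
  have hcard : Multiset.card M.charpoly.roots = Fintype.card n := by
    rw [← (IsAlgClosed.splits M.charpoly).natDegree_eq_card_roots, Matrix.charpoly_natDegree_eq_dim]
  have he : ∀ z, (Matrix.scalar n z - M).det = (M.charpoly.roots.map fun a => z - a).prod := by
    intro z
    rw [← Matrix.eval_charpoly]
    conv_lhs => rw [hsp]
    rw [Polynomial.eval_multiset_prod, Multiset.map_map]
    simp
  rw [he, he, ← hcard]
  refine hur_ms _ _ _ _ (by linarith) fun a ha => ?_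
  have h1 := (Polynomial.mem_roots (charpoly_monic M).ne_zero).1 ha
  rw [Polynomial.IsRoot, Matrix.eval_charpoly] at h1
  obtain ⟨v, hv, hM⟩ := (ev_iff_det M a).2 h1
  linarith [h a v hv hM]
lemma cont_det {X : Type*} [TopologicalSpace X] {f : X → MC n} (hf : Continuous f) :
    Continuous fun x => (f x).det := hf.matrix_det
lemma EPc_limit (f : ℝ → MC n) (hf : Continuous f) (c : ℝ) (h : ∀ s > 0, EPc c (f s)) :
    EPc c (f 0) := by
  intro μ v hv hμ
  by_contra hlt
  push Not at hlt
  have h0 := (ev_iff_det (f 0) μ).1 ⟨v, hv, hμ⟩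
  have key : ∀ z1, (Matrix.scalar n z1 - f 0).det = 0 := by
    intro z1
    have h1 : ∀ s ∈ Set.Ioi (0:ℝ), ‖(Matrix.scalar n z1 - f s).det‖ * (c - μ.re) ^ (Fintype.card n) ≤
      ‖(Matrix.scalar n μ - f s).det‖ * ((c - μ.re) + ‖z1 - μ‖) ^ (Fintype.card n) :=
        fun s hs => charpoly_norm (f s) c (h s hs) μ z1 hlt
    have h2 := ContinuousWithinAt.closure_le (s := Set.Ioi (0:ℝ)) (x := 0) (by simp)
      (((cont_det (continuous_const.sub hf)).norm.mul continuous_const).continuousWithinAt)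
      (((cont_det (continuous_const.sub hf)).norm.mul continuous_const).continuousWithinAt) h1
    simp only [Pi.mul_apply, Pi.sub_apply] at h2
    rw [h0, norm_zero, zero_mul] at h2
    have h3 : 0 < (c - μ.re) ^ (Fintype.card n) := pow_pos (by linarith) _
    have := nonpos_of_mul_nonpos_left h2 h3
    exact norm_le_zero_iff.1 this
  have hne := (charpoly_monic (f 0)).ne_zero
  apply hne
  apply Polynomial.funext
  intro z
  rw [Matrix.eval_charpoly, key, Polynomial.eval_zero]
theorem compress (A B π : MC n) (l : ℝ) (hi : π * π = π) (h1 : π * A = (l:ℂ) • π)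
    (h3 : ∀ u, A *ᵥ u = (l:ℂ) • u → π *ᵥ u = u) (h2 : A * π = (l:ℂ) • π) (c : ℝ) (hc : 0 < c)
    (hs : ∀ s > 0, EPc (s * c) (I • A + (s:ℂ) • B)) : EP (π * B * π + (1 - π)) := by
  set A' := A - (l:ℂ) • (1 : MC n) with hA'
  have hπA' : π * A' = 0 := by rw [hA', mul_sub, h1]; simp
  have hA'π : A' * π = 0 := by rw [hA', sub_mul, h2]; simp
  set Y : ℝ → ℂ → MC n := fun s z => I • A' + π * (B - z • (1 : MC n)) + (s:ℂ) • ((1 - π) * (B - z • (1 : MC n))) with hY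
  have hYc : ∀ z, Continuous fun s => Y s z := by
    intro z; simp only [hY]; fun_prop
  have hfac : ∀ (s : ℝ) z, ((s:ℂ) • π + (1 - π)) * Y s z = I • A' + (s:ℂ) • (B - z • (1 : MC n)) := by
    intro s z
    simp only [hY]
    generalize B - z • (1 : MC n) = W
    have e1 : (1 - π) * A' = A' := by rw [sub_mul, hπA']; simp
    have e2 : (1 - π) * (π * W) = 0 := by rw [← mul_assoc, sub_mul, hi]; simp
    have e3 : (1 - π) * ((1 - π) * W) = (1 - π) * W := by
      rw [← mul_assoc]; congr 1; simp [mul_sub, sub_mul, hi]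
    have e4 : π * ((1 - π) * W) = 0 := by rw [← mul_assoc, mul_sub, hi]; simp
    have e5 : π * (π * W) = π * W := by rw [← mul_assoc, hi]
    simp only [add_mul, mul_add, Matrix.mul_smul, Matrix.smul_mul, hπA', e1, e2, e3, e4, e5]
    simp only [sub_mul, one_mul, smul_zero, smul_sub, add_zero, zero_add]
    abel
  have hmain : ∀ z0 : ℂ, z0.re < c → ∀ u, u ≠ 0 → π *ᵥ u = u → (π * B) *ᵥ u = z0 • u → False := by
    intro z0 hz0 u hu hπu hBu
    have hd0 : (Y 0 z0).det = 0 := by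
      rw [← exists_mulVec_eq_zero_iff]
      refine ⟨u, hu, ?_⟩
      simp only [hY]
      have e : A' *ᵥ u = 0 := by rw [← hπu, mulVec_mulVec, hA'π, zero_mulVec]
      rw [add_mulVec, add_mulVec, smul_mulVec, e, mul_sub, sub_mulVec, hBu,
        Matrix.mul_smul, smul_mulVec, mul_one, hπu]
      simp
    have key : ∀ z1, (Y 0 z1).det = 0 := by
      intro z1
      have hb : ∀ s ∈ Set.Ioi (0:ℝ), ‖(Y s z1).det‖ * (c - z0.re) ^ (Fintype.card n) ≤
          ‖(Y s z0).det‖ * ((c - z0.re) + ‖z1 - z0‖) ^ (Fintype.card n) := by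
        intro s hs'
        have hs0 : (0:ℝ) < s := hs'
        have hsC : (s:ℂ) ≠ 0 := by exact_mod_cast hs0.ne'
        set M := (I / s) • A' + B with hM
        have hEP : EPc c M := by
          intro μ v hv hμ
          have : (I • A + (s:ℂ) • B) *ᵥ v = ((s:ℂ) * μ + I * l) • v := by
            have e : I • A + (s:ℂ) • B = (s:ℂ) • M + (I * l) • (1 : MC n) := by
              rw [hM, hA', smul_add, smul_smul, mul_div_cancel₀ _ hsC, smul_sub, smul_smul]; abel
            rw [e, add_mulVec, smul_mulVec, hμ, smul_mulVec, one_mulVec, smul_smul, add_smul]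
          have := hs s hs0 _ v hv this
          simp at this
          exact le_of_mul_le_mul_left this hs0
        have hb := charpoly_norm M c hEP z0 z1 hz0
        have hdet : ∀ z, ((s:ℂ) • π + (1 - π)).det * (Y s z).det = (-(s:ℂ)) ^ (Fintype.card n) * (Matrix.scalar n z - M).det := by
          intro z
          rw [← Matrix.det_mul, hfac, ← Matrix.det_smul]
          congr 1
          rw [hM]
          have : Matrix.scalar n z = z • (1 : MC n) := by
            rw [Matrix.smul_one_eq_diagonal]; rfl
          rw [this, neg_smul, ← smul_neg, neg_sub, add_sub_assoc, smul_add, smul_smul, mul_div_cancel₀ _ hsC]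
        have hne : ((s:ℂ) • π + (1 - π)).det ≠ 0 := by
          have : ((s:ℂ) • π + (1 - π)) * ((s:ℂ)⁻¹ • π + (1 - π)) = 1 := by
            simp only [add_mul, mul_add, Matrix.smul_mul, Matrix.mul_smul, hi, sub_mul, mul_sub, mul_one, one_mul, smul_smul]
            simp only [sub_self, smul_add, smul_smul, inv_mul_cancel₀ hsC, smul_zero, one_smul, add_zero]; abel
          intro h0
          have h' := congrArg Matrix.det this
          rw [Matrix.det_mul, h0] at h'; simp at h'
        have hpos : 0 < ‖((s:ℂ) • π + (1 - π)).det‖ := norm_pos_iff.2 hne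
        have q : ∀ z, ‖(Matrix.scalar n z - M).det‖ * s ^ (Fintype.card n) = ‖((s:ℂ) • π + (1 - π)).det‖ * ‖(Y s z).det‖ := by
          intro z; rw [← norm_mul, hdet, norm_mul, norm_pow, norm_neg, Complex.norm_real, Real.norm_of_nonneg hs0.le, mul_comm]
        have hsp : 0 < s ^ (Fintype.card n) := pow_pos hs0 _
        refine le_of_mul_le_mul_left ?_ hpos
        have := mul_le_mul_of_nonneg_left hb hsp.le
        calc _ = (‖((s:ℂ) • π + (1 - π)).det‖ * ‖(Y s z1).det‖) * (c - z0.re) ^ (Fintype.card n) := by ring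
          _ = s ^ (Fintype.card n) * (‖(Matrix.scalar n z1 - M).det‖ * (c - z0.re) ^ (Fintype.card n)) := by rw [← q]; ring
          _ ≤ _ := this
          _ = (‖(Matrix.scalar n z0 - M).det‖ * s ^ (Fintype.card n)) * ((c - z0.re) + ‖z1 - z0‖) ^ (Fintype.card n) := by ring
          _ = _ := by rw [q]; ring
      have h2 := ContinuousWithinAt.closure_le (s := Set.Ioi (0:ℝ)) (x := 0) (by simp)
        (((cont_det (hYc z1)).norm.mul continuous_const).continuousWithinAt)
        (((cont_det (hYc z0)).norm.mul continuous_const).continuousWithinAt) hb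
      simp only [Pi.mul_apply] at h2
      rw [hd0, norm_zero, zero_mul] at h2
      have h3 : 0 < (c - z0.re) ^ (Fintype.card n) := pow_pos (by linarith) _
      exact norm_le_zero_iff.1 (nonpos_of_mul_nonpos_left h2 h3)
    apply (charpoly_monic (π * B)).ne_zero
    apply Polynomial.funext
    intro z
    rw [Matrix.eval_charpoly, Polynomial.eval_zero, ← ev_iff_det]
    obtain ⟨w, hw, hYw⟩ := exists_mulVec_eq_zero_iff.2 (key z)
    have hYw0 : I • (A' *ᵥ w) + (π * (B - z • (1 : MC n))) *ᵥ w = 0 := by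
      have := hYw
      simp only [hY] at this
      simpa [add_mulVec, smul_mulVec] using this
    have hπw0 : (π * (B - z • (1 : MC n))) *ᵥ w = 0 := by
      have := congrArg (fun v => π *ᵥ v) hYw0
      simp only [mulVec_add, mulVec_smul, mulVec_mulVec, hπA', zero_mulVec, smul_zero,
        zero_add, Matrix.mulVec_zero] at this
      rw [← mul_assoc, hi] at this
      exact this
    have hAw : A' *ᵥ w = 0 := by
      rw [hπw0, add_zero] at hYw0
      exact (smul_eq_zero.1 hYw0).resolve_left Complex.I_ne_zero
    have hw2 : π *ᵥ w = w := by
      apply h3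
      rw [hA', sub_mulVec, smul_mulVec, one_mulVec, sub_eq_zero] at hAw
      exact hAw
    refine ⟨w, hw, ?_⟩
    rw [mul_sub, sub_mulVec, Matrix.mul_smul, smul_mulVec, mul_one, hw2, sub_eq_zero] at hπw0
    exact hπw0
  intro μ v hv hμ
  by_cases hπv : π *ᵥ v = 0
  · rw [add_mulVec, sub_mulVec, one_mulVec, ← mulVec_mulVec, hπv, Matrix.mulVec_zero, zero_add, sub_zero] at hμ
    have : (1 - μ) • v = 0 := by rw [sub_smul, one_smul, ← hμ, sub_self]
    have h1 : 1 - μ = 0 := (smul_eq_zero.1 this).resolve_right hv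
    have : μ = 1 := by linear_combination -h1
    rw [this]; simp
  · by_contra hn
    refine hmain μ (by linarith) (π *ᵥ v) hπv (by rw [mulVec_mulVec, hi]) ?_
    have := congrArg (fun v => π *ᵥ v) hμ
    simp only [mulVec_mulVec, mulVec_smul, mul_add, mul_sub, mul_one, hi, sub_self, add_zero] at this
    rw [mulVec_mulVec, ← this, mul_assoc π B π, ← mul_assoc π π, hi]
end
section
/-- symbols -/
def sA {N m : ℕ} (A : Fin (m + 1) → MR N) (ξ : Fin (m+1) → ℝ) : MC (Fin N) :=
  ∑ j, (ξ j : ℂ) • cmap (A j)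
def sB {N m : ℕ} (B : Fin (m + 1) → Fin (m + 1) → MR N) (ξ : Fin (m+1) → ℝ) :
    MC (Fin N) :=
  ∑ j, ∑ k, ((ξ j * ξ k : ℝ) : ℂ) • cmap (B j k)
def H2pt {N m : ℕ} (A : Fin (m + 1) → MR N)
    (B : Fin (m + 1) → Fin (m + 1) → MR N) (c : ℝ) : Prop :=
  ∀ ξ : Fin (m+1) → ℝ, EPc (c * ∑ j, (ξ j)^2) (I • sA A ξ + sB B ξ)
lemma H2pt_of {M N m : ℕ} {𝒪 : Set (Fin M → ℝ)}
    {A : Fin (m + 1) → (Fin M → ℝ) → MR N}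
    {B : Fin (m + 1) → Fin (m + 1) → (Fin M → ℝ) → MR N} (h : HypH2 𝒪 A B) :
    ∃ c > 0, ∀ p ∈ 𝒪, H2pt (fun j => A j p) (fun j k => B j k p) c := by
  obtain ⟨c, hc, h⟩ := h
  refine ⟨c, hc, fun p hp ξ μ v hv hμ => h p hp ξ μ ?_⟩
  have e : (∑ j, (I * (ξ j : ℂ)) • cmap (A j p)) = I • sA (fun j => A j p) ξ := by
    simp only [sA, Finset.smul_sum, smul_smul]
  rw [e, spectrum.mem_iff]
  intro hu
  rw [Matrix.isUnit_iff_isUnit_det] at hu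
  refine hu.ne_zero ?_
  exact (ev_iff_det _ μ).1 ⟨v, hv, hμ⟩
section
variable {N m : ℕ} {A : Fin (m + 1) → MR N}
    {B : Fin (m + 1) → Fin (m + 1) → MR N} {c : ℝ}
lemma EPc_smul {n : Type*} [Fintype n] [DecidableEq n] {M : MC n} {c : ℝ} {t : ℝ} (ht : 0 < t) (h : EPc c M) : EPc (t * c) ((t:ℂ) • M) := by
  intro μ v hv hμ
  have htC : (t:ℂ) ≠ 0 := by exact_mod_cast ht.ne'
  have := h (μ / t) v hv (by
    rw [smul_mulVec] at hμ
    rw [div_eq_inv_mul, ← smul_smul, ← hμ, smul_smul, inv_mul_cancel₀ htC, one_smul])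
  have e : (μ / t).re = μ.re / t := Complex.div_ofReal_re μ t
  rw [e, le_div_iff₀ ht] at this
  linarith
lemma sA_smul (s : ℝ) (ξ) : sA A (s • ξ) = (s:ℂ) • sA A ξ := by
  simp only [sA, Finset.smul_sum, smul_smul, Pi.smul_apply, smul_eq_mul, Complex.ofReal_mul]
lemma sB_smul (s : ℝ) (ξ) : sB B (s • ξ) = ((s*s:ℝ):ℂ) • sB B ξ := by
  simp only [sB, Finset.smul_sum, smul_smul]
  refine Finset.sum_congr rfl fun j _ => Finset.sum_congr rfl fun k _ => ?_
  congr 1; simp; ring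
/-- `i A + s B` -/
lemma H2pt.sc (h : H2pt A B c) (ξ : Fin (m+1) → ℝ) {s : ℝ} (hs : 0 < s) :
    EPc (s * (c * ∑ j, (ξ j)^2)) (I • sA A ξ + (s:ℂ) • sB B ξ) := by
  have hsC : (s:ℂ) ≠ 0 := by exact_mod_cast hs.ne'
  have := EPc_smul (inv_pos.2 hs) (h (s • ξ))
  convert this using 1
  · simp only [Pi.smul_apply, smul_eq_mul, mul_pow, ← Finset.mul_sum]; field_simp
  · rw [sA_smul, sB_smul, smul_add, smul_smul, smul_smul, smul_smul]
    congr 2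
    · push_cast; field_simp
    · push_cast; field_simp
/-- `i s A + B`, `s ≥ 0` -/
lemma H2pt.sc' (h : H2pt A B c) (ξ : Fin (m+1) → ℝ) {s : ℝ} (hs : 0 ≤ s) :
    EPc (c * ∑ j, (ξ j)^2) ((I * s) • sA A ξ + sB B ξ) := by
  have key : ∀ s > 0, EPc (c * ∑ j, (ξ j)^2) ((I * (s:ℝ)) • sA A ξ + sB B ξ) := by
    intro s hs
    have hsC : (s:ℂ) ≠ 0 := by exact_mod_cast hs.ne'
    have := EPc_smul hs (h.sc ξ (inv_pos.2 hs))
    convert this using 1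
    · field_simp
    · rw [smul_add, smul_smul, smul_smul]
      congr 2
      · ring
      · push_cast; rw [mul_inv_cancel₀ hsC, one_smul]
  rcases hs.lt_or_eq with h0 | h0
  · exact key s h0
  · subst h0
    exact EPc_limit (fun s : ℝ => (I * (s:ℝ)) • sA A ξ + sB B ξ) (by fun_prop) _ key
lemma H2pt.sB (h : H2pt A B c) (ξ : Fin (m+1) → ℝ) : EPc (c * ∑ j, (ξ j)^2) (sB B ξ) := by
  have := h.sc' ξ le_rfl; simpa using this
lemma det_ne_of_EPc {n : Type*} [Fintype n] [DecidableEq n] {M : MC n} {c : ℝ} (hc : 0 < c) (h : EPc c M) : M.det ≠ 0 := by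
  intro h0
  obtain ⟨v, hv, h1⟩ := exists_mulVec_eq_zero_iff.2 h0
  have := h 0 v hv (by rw [h1, zero_smul])
  simp at this; linarith
lemma sB_last (t : ℝ) : KS.sB B (Pi.single (Fin.last m) t) = ((t*t:ℝ):ℂ) • cmap (B (Fin.last m) (Fin.last m)) := by
  unfold KS.sB
  rw [Finset.sum_eq_single (Fin.last m), Finset.sum_eq_single (Fin.last m)]
  · simp
  · intro b _ hb; simp [Pi.single_eq_of_ne hb]
  · simp
  · intro b _ hb; simp [Pi.single_eq_of_ne hb]
  · simp
lemma sA_last (t : ℝ) : KS.sA A (Pi.single (Fin.last m) t) = (t:ℂ) • cmap (A (Fin.last m)) := by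
  unfold KS.sA
  rw [Finset.sum_eq_single (Fin.last m)]
  · simp
  · intro b _ hb; simp [Pi.single_eq_of_ne hb]
  · simp
lemma sq_last (t : ℝ) : ∑ j, ((Pi.single (Fin.last m) t : Fin (m+1) → ℝ) j)^2 = t^2 := by
  rw [Finset.sum_eq_single (Fin.last m)]
  · simp
  · intro b _ hb; simp [Pi.single_eq_of_ne hb]
  · simp
lemma H2pt.Bdd (h : H2pt A B c) (hc : 0 < c) : (cmap (B (Fin.last m) (Fin.last m))).det ≠ 0 := by
  have := h.sB (Pi.single (Fin.last m) 1)
  rw [sB_last, sq_last] at this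
  refine det_ne_of_EPc (c := c) hc ?_
  simpa using this
lemma cmap_det {N : ℕ} (A : MR N) : (cmap A).det = (A.det : ℂ) := by
  have := (RingHom.map_det Complex.ofRealHom A)
  exact this.symm
/-- `P0 = B_dd⁻¹ A_d` has no imaginary eigenvalue -/
lemma H2pt.P0 (h : H2pt A B c) (hc : 0 < c) (hA : (A (Fin.last m)).det ≠ 0) (μ : ℂ) (v : Fin N → ℂ)
    (hv : v ≠ 0) (hμ : ((cmap (B (Fin.last m) (Fin.last m)))⁻¹ * cmap (A (Fin.last m))) *ᵥ v = μ • v) :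
    μ.re ≠ 0 := by
  intro hre
  have hB := h.Bdd hc
  obtain ⟨θ, rfl⟩ : ∃ θ : ℝ, μ = I * θ := ⟨μ.im, by apply Complex.ext <;> simp [hre]⟩
  have h1 : cmap (A (Fin.last m)) *ᵥ v = (I * θ) • (cmap (B (Fin.last m) (Fin.last m)) *ᵥ v) := by
    have := congrArg (fun w => cmap (B (Fin.last m) (Fin.last m)) *ᵥ w) hμ
    simp only [mulVec_mulVec, mulVec_smul] at this
    rwa [← mul_assoc, mul_nonsing_inv _ (isUnit_iff_ne_zero.2 hB), one_mul] at this
  have h2 := h (Pi.single (Fin.last m) θ) 0 v hv (by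
    rw [sA_last, sB_last, add_mulVec, smul_mulVec, smul_mulVec, smul_mulVec, h1, smul_smul, smul_smul,
      ← add_smul]
    have : I * (θ * (I * θ)) + ((θ * θ : ℝ) : ℂ) = 0 := by
      push_cast; linear_combination (θ:ℂ)^2 * Complex.I_sq
    rw [← mul_assoc] at this
    rw [mul_assoc, ← mul_assoc, this, zero_smul, zero_smul])
  rw [sq_last] at h2
  simp at h2
  have h3 : θ = 0 := by
    by_contra h0
    have : 0 < c * θ^2 := by positivity
    linarith
  rw [h3] at h1
  simp at h1
  have h4 : (cmap (A (Fin.last m))).det = 0 := exists_mulVec_eq_zero_iff.1 ⟨v, hv, h1⟩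
  rw [cmap_det] at h4
  exact hA (by exact_mod_cast h4)
/-- eigenvector relation for calG -/
lemma calG_eig (hB : (cmap (B (Fin.last m) (Fin.last m))).det ≠ 0) (ζ : Freq m) (ξ : ℝ) (u : Fin N → ℂ)
    (h : calM A B ζ *ᵥ u + calA A B ζ *ᵥ ((I * ξ) • u) = (I * ξ) • ((I * ξ) • u)) :
    (I • sA A (Fin.snoc ζ.2.1 ξ) + KS.sB B (Fin.snoc ζ.2.1 ξ)) *ᵥ u = (-(I * ζ.1 + ζ.2.2)) • u := by
  set b := cmap (B (Fin.last m) (Fin.last m)) with hb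
  have h1 := congrArg (fun w => b *ᵥ w) h
  simp only [mulVec_add, mulVec_smul, mulVec_mulVec] at h1
  have hbi : b * b⁻¹ = 1 := mul_nonsing_inv _ (isUnit_iff_ne_zero.2 hB)
  unfold calM calA at h1
  rw [← hb, ← mul_assoc, ← mul_assoc, hbi, one_mul, one_mul] at h1
  have e1 : sA A (Fin.snoc ζ.2.1 ξ) = ∑ j : Fin m, (ζ.2.1 j : ℂ) • cmap (A j.castSucc) + (ξ:ℂ) • cmap (A (Fin.last m)) := by
    unfold sA; rw [Fin.sum_univ_castSucc]; simp
  have e2 : KS.sB B (Fin.snoc ζ.2.1 ξ) = ∑ j : Fin m, ∑ k : Fin m, ((ζ.2.1 j * ζ.2.1 k : ℝ) : ℂ) • cmap (B j.castSucc k.castSucc)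
     + (ξ:ℂ) • ∑ j : Fin m, (ζ.2.1 j : ℂ) • (cmap (B j.castSucc (Fin.last m)) + cmap (B (Fin.last m) j.castSucc))
     + ((ξ:ℂ)*ξ) • b := by
    unfold KS.sB; rw [Fin.sum_univ_castSucc]
    simp only [Fin.sum_univ_castSucc, Fin.snoc_castSucc, Fin.snoc_last, Finset.sum_add_distrib, smul_add, Finset.smul_sum, smul_smul]
    push_cast
    have : ∀ j : Fin m, (ξ:ℂ) * (ζ.2.1 j : ℂ) = ζ.2.1 j * ξ := fun j => mul_comm _ _
    simp only [this]
    abel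
  have e3 : ∑ j : Fin m, (I * (ζ.2.1 j : ℂ)) • (cmap (B j.castSucc (Fin.last m)) + cmap (B (Fin.last m) j.castSucc))
     = I • ∑ j : Fin m, (ζ.2.1 j : ℂ) • (cmap (B j.castSucc (Fin.last m)) + cmap (B (Fin.last m) j.castSucc)) := by
    simp only [Finset.smul_sum, smul_smul]
  have e4 : ∑ j : Fin m, (I * (ζ.2.1 j : ℂ)) • cmap (A j.castSucc) = I • ∑ j : Fin m, (ζ.2.1 j : ℂ) • cmap (A j.castSucc) := by
    simp only [Finset.smul_sum, smul_smul]
  rw [e3, e4] at h1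
  rw [e1, e2]
  generalize ∑ j : Fin m, (ζ.2.1 j : ℂ) • (cmap (B j.castSucc (Fin.last m)) + cmap (B (Fin.last m) j.castSucc)) = R1 at *
  generalize ∑ j : Fin m, (ζ.2.1 j : ℂ) • cmap (A j.castSucc) = R2 at *
  generalize ∑ j : Fin m, ∑ k : Fin m, ((ζ.2.1 j * ζ.2.1 k : ℝ) : ℂ) • cmap (B j.castSucc k.castSucc) = R3 at *
  generalize cmap (A (Fin.last m)) = R4 at *
  simp only [add_mulVec, sub_mulVec, smul_mulVec, one_mulVec, smul_add, smul_sub, smul_smul] at h1 ⊢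
  generalize R1 *ᵥ u = w1 at *
  generalize R2 *ᵥ u = w2 at *
  generalize R3 *ᵥ u = w3 at *
  generalize R4 *ᵥ u = w4 at *
  generalize b *ᵥ u = w5 at *
  ext i
  have h1 := congrFun h1 i
  simp only [Pi.add_apply, Pi.sub_apply, Pi.smul_apply, smul_eq_mul] at h1 ⊢
  linear_combination h1 + (ξ * w1 i + ξ^2 * w5 i) * Complex.I_sq
lemma calG_noimag (hs : ∀ ξ : Fin (m+1) → ℝ, EPc (c * ∑ j, (ξ j)^2) (I • sA A ξ + KS.sB B ξ)) (hc : 0 < c)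
    (hB : (cmap (B (Fin.last m) (Fin.last m))).det ≠ 0) (ζ : Freq m) (hζ : ζ ≠ 0) (hγ : 0 ≤ ζ.2.2)
    (μ : ℂ) (v : Fin N ⊕ Fin N → ℂ) (hv : v ≠ 0) (hμ : calG A B ζ *ᵥ v = μ • v) : μ.re ≠ 0 := by
  intro hre
  obtain ⟨ξ, rfl⟩ : ∃ ξ : ℝ, μ = I * ξ := ⟨μ.im, by apply Complex.ext <;> simp [hre]⟩
  obtain ⟨u, w, rfl⟩ : ∃ u w, v = Sum.elim u w := ⟨v ∘ Sum.inl, v ∘ Sum.inr, by simp⟩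
  unfold calG at hμ
  rw [Matrix.fromBlocks_mulVec] at hμ
  have ha := congrArg (fun f => f ∘ Sum.inl) hμ
  have hb := congrArg (fun f => f ∘ Sum.inr) hμ
  have ha : w = (I * ξ) • u := by
    funext i; have := congrFun ha i; simpa using this
  have hb : calM A B ζ *ᵥ u + calA A B ζ *ᵥ w = (I * ξ) • w := by
    funext i; have := congrFun hb i; simpa using this
  subst ha
  have hu : u ≠ 0 := by
    rintro rfl; apply hv; funext i; rcases i with i | i <;> simp
  have h1 := calG_eig hB ζ ξ u hb
  have h2 := hs _ _ u hu h1
  simp at h2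
  have h3 : 0 ≤ ∑ j, ((Fin.snoc ζ.2.1 ξ : Fin (m+1) → ℝ) j)^2 := Finset.sum_nonneg fun j _ => sq_nonneg _
  have h4 : ∑ j, ((Fin.snoc ζ.2.1 ξ : Fin (m+1) → ℝ) j)^2 = 0 := by
    by_contra hne
    have : 0 < c * ∑ j, ((Fin.snoc ζ.2.1 ξ : Fin (m+1) → ℝ) j)^2 := mul_pos hc (lt_of_le_of_ne h3 (Ne.symm hne))
    linarith
  have h5 : ζ.2.2 = 0 := by rw [h4] at h2; linarith
  have h6 : (Fin.snoc ζ.2.1 ξ : Fin (m+1) → ℝ) = 0 := by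
    funext j
    have := (Finset.sum_eq_zero_iff_of_nonneg (fun j _ => sq_nonneg _)).1 h4 j (Finset.mem_univ _)
    simpa using this
  rw [h6, h5] at h1
  have e : sA A 0 = 0 := by simp [sA]
  have e' : KS.sB B 0 = 0 := by simp [KS.sB]
  rw [e, e'] at h1
  simp at h1
  have h7 : ζ.1 = 0 := by
    rcases h1 with h | h
    · exact h
    · exact (hu h).elim
  apply hζ
  refine Prod.ext h7 (Prod.ext ?_ h5)
  funext j
  have := congrFun h6 j.castSucc
  simpa using this
theorem calG_index (h : H2pt A B c) (hc : 0 < c) (ζ : Freq m) (hζ : ζ ≠ 0) (hγ : 0 ≤ ζ.2.2) :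
    ∃ P, Spl (calG A B ζ) P ∧ P.rank = N := by
  have hB := h.Bdd hc
  set f : ℝ → Matrix (Fin N ⊕ Fin N) (Fin N ⊕ Fin N) ℂ := fun t =>
    calG (fun j => (1 - t) • A j) B ((1 - t) • ζ + t • ((0, 0, 1) : Freq m)) with hf
  have hcm : ∀ (t : ℝ) (X : MR N), cmap (t • X) = (t:ℂ) • cmap X := by
    intro t X; ext i j; simp [cmap]
  have hfc : Continuous f := by
    simp only [hf]
    unfold calG calM calA
    simp only [hcm]
    refine Continuous.matrix_fromBlocks continuous_const continuous_const ?_ ?_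
    · simp only [Prod.fst_add, Prod.snd_add, Prod.smul_fst, Prod.smul_snd, Pi.add_apply, Pi.smul_apply, smul_eq_mul]
      fun_prop
    · simp only [Prod.fst_add, Prod.snd_add, Prod.smul_fst, Prod.smul_snd, Pi.add_apply, Pi.smul_apply, smul_eq_mul]
      fun_prop
  have hno : ∀ t ∈ Set.Icc (0:ℝ) 1, ∃ P, Spl (f t) P := by
    intro t ht
    refine SSL _ fun μ v hv hμ => ?_
    refine calG_noimag (c := c) ?_ hc hB _ ?_ ?_ μ v hv hμ
    · intro ξ
      have := h.sc' ξ (s := 1 - t) (by linarith [ht.2])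
      convert this using 2
      rw [mul_smul]; congr 1
      simp only [sA, hcm, Finset.smul_sum, smul_smul]
      refine Finset.sum_congr rfl fun j _ => ?_
      rw [mul_comm]
    · intro h0
      rcases ht.1.lt_or_eq with h1 | h1
      · have := congrArg (fun z : Freq m => z.2.2) h0
        simp at this
        nlinarith [ht.2]
      · rw [← h1] at h0; simp at h0; exact hζ h0
    · simp; nlinarith [ht.1, ht.2]
  obtain ⟨P, hP⟩ := hno 0 (by simp)
  obtain ⟨Q, hQ⟩ := hno 1 (by simp)
  have hr := idx_homotopy f (fun i j => hfc.matrix_elem i j) hno hP hQ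
  have h0 : f 0 = calG A B ζ := by
    simp only [hf, sub_zero, one_smul, zero_smul, add_zero]
  have h1 : f 1 = Matrix.fromBlocks 0 1 (cmap (B (Fin.last m) (Fin.last m)))⁻¹ 0 := by
    simp [hf, calG, calM, calA, cmap]
  refine ⟨P, h0 ▸ hP, ?_⟩
  rw [h1] at hQ
  have := idx_half (D := Matrix.fromBlocks 1 0 0 (-1)) hQ (by
    rw [Matrix.fromBlocks_multiply]; simp) (by
    rw [Matrix.fromBlocks_multiply, Matrix.fromBlocks_multiply, Matrix.fromBlocks_neg]; simp)
  rw [Fintype.card_sum, Fintype.card_fin] at this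
  omega
end
end
section
variable {n : Type*} [Fintype n] [DecidableEq n]
open Polynomial
lemma aeval_eigK {K : Type*} [Field K] (M : Matrix n n K) (f : K[X]) (μ : K) (v : n → K) (h : M *ᵥ v = μ • v) :
    (aeval M f) *ᵥ v = (f.eval μ) • v := by
  induction f using Polynomial.induction_on' with
  | add p q hp hq => rw [map_add, add_mulVec, hp, hq, eval_add, add_smul]
  | monomial k a =>
    rw [aeval_monomial, eval_monomial]
    have : ∀ k : ℕ, (M ^ k) *ᵥ v = (μ ^ k) • v := by
      intro k
      induction k with
      | zero => simp
      | succ k ih => rw [pow_succ, ← mulVec_mulVec, h, mulVec_smul, ih, smul_smul, pow_succ, mul_comm]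
    rw [← mulVec_mulVec, this, Matrix.algebraMap_eq_diagonal]
    ext i; simp [Matrix.mulVec_diagonal, mul_assoc]
/-- entrywise pairing -/
def ip {R : Type*} [CommRing R] (a b : Matrix n n R) : R := ∑ u, ∑ v, a u v * b u v
lemma ip_sum {R : Type*} [CommRing R] {ι : Type*} (t : Finset ι) (a : Matrix n n R) (c : ι → R) (b : ι → Matrix n n R) :
    ip a (∑ i ∈ t, c i • b i) = ∑ i ∈ t, ip a (b i) * c i := by
  classical
  induction t using Finset.induction_on with
  | empty => simp [ip]
  | insert j t hj ih =>
    rw [Finset.sum_insert hj, Finset.sum_insert hj, ← ih]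
    simp only [ip, Matrix.add_apply, mul_add, Finset.sum_add_distrib, Matrix.smul_apply, smul_eq_mul, Finset.sum_mul]
    congr 1
    refine Finset.sum_congr rfl fun u _ => Finset.sum_congr rfl fun v _ => by ring
lemma ip_comm {R : Type*} [CommRing R] (a b : Matrix n n R) : ip a b = ip b a := by
  simp only [ip, mul_comm]
lemma ip_zero {R : Type*} [CommRing R] (a : Matrix n n R) : ip a 0 = 0 := by simp [ip]
lemma ip_self_zero (a : Matrix n n ℝ) (h : ip a a = 0) : a = 0 := by
  have h1 := (Finset.sum_eq_zero_iff_of_nonneg (fun u _ => Finset.sum_nonneg fun v _ => mul_self_nonneg (a u v))).1 h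
  ext u v
  have h2 := (Finset.sum_eq_zero_iff_of_nonneg (fun v _ => mul_self_nonneg (a u v))).1 (h1 u (Finset.mem_univ u)) v (Finset.mem_univ v)
  simpa using h2
def gram {R : Type*} [CommRing R] (s : ℕ) (a : Matrix n n R) : Matrix (Fin s) (Fin s) R :=
  Matrix.of fun i j => ip (a ^ (i:ℕ)) (a ^ (j:ℕ))
lemma gram_mulVec {R : Type*} [CommRing R] (s : ℕ) (a : Matrix n n R) (v : Fin s → R) (i) :
    (gram s a *ᵥ v) i = ip (a ^ (i:ℕ)) (∑ j, v j • a ^ (j:ℕ)) := by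
  rw [ip_sum]; rfl
lemma gram_quad {R : Type*} [CommRing R] (s : ℕ) (a : Matrix n n R) (v : Fin s → R) (h : gram s a *ᵥ v = 0) :
    ip (∑ j, v j • a ^ (j:ℕ)) (∑ j, v j • a ^ (j:ℕ)) = 0 := by
  conv_lhs => rw [ip_sum]
  refine Finset.sum_eq_zero fun j _ => ?_
  rw [ip_comm, ← gram_mulVec, h]; simp
def gbeta (s : ℕ) (a : Matrix n n ℝ) : Fin s → ℝ := fun i => ip (a ^ (i:ℕ)) (a ^ s)
def cf (s : ℕ) (a : Matrix n n ℝ) : Fin s → ℝ := (gram s a)⁻¹ *ᵥ gbeta s a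
def gf (s : ℕ) (a : Matrix n n ℝ) (y : ℝ) : ℝ := y ^ s - ∑ i : Fin s, cf s a i * y ^ (i:ℕ)
/-- `a` is real diagonalizable with exactly `s` eigenvalues -/
def RS (s : ℕ) (a : Matrix n n ℝ) : Prop := ∃ L : Finset ℝ, L.card = s ∧
  aeval a (∏ l ∈ L, (X - C l)) = 0 ∧ ∀ l ∈ L, ∃ v : n → ℝ, v ≠ 0 ∧ a *ᵥ v = l • v
lemma RS.indep {s : ℕ} {a : Matrix n n ℝ} (h : RS s a) (f : ℝ[X]) (hd : f.degree < s) (hf : aeval a f = 0) : f = 0 := by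
  obtain ⟨L, hL, -, he⟩ := h
  refine Polynomial.eq_zero_of_degree_lt_of_eval_finset_eq_zero L (by rwa [hL]) fun l hl => ?_
  obtain ⟨v, hv, hav⟩ := he l hl
  have := aeval_eigK a f l v hav
  rw [hf, zero_mulVec] at this
  exact (smul_eq_zero.1 this.symm).resolve_right hv
lemma RS.ex {s : ℕ} {a : Matrix n n ℝ} (h : RS s a) : ∃ f : ℝ[X], f.Monic ∧ f.natDegree = s ∧ aeval a f = 0 := by
  obtain ⟨L, hL, h0, -⟩ := h
  refine ⟨_, monic_prod_of_monic _ _ fun l _ => monic_X_sub_C l, ?_, h0⟩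
  rw [natDegree_prod_of_monic _ _ fun l _ => monic_X_sub_C l]; simp [hL]
lemma sum_fin_poly {R : Type*} [CommRing R] (s : ℕ) (v : Fin s → R) (a : Matrix n n R) :
    aeval a (∑ j : Fin s, C (v j) * X ^ (j:ℕ)) = ∑ j, v j • a ^ (j:ℕ) := by
  rw [map_sum]
  refine Finset.sum_congr rfl fun j _ => ?_
  rw [map_mul, aeval_C, map_pow, aeval_X, Algebra.smul_def]
lemma sum_fin_coeff {R : Type*} [CommRing R] (s : ℕ) (v : Fin s → R) (i : Fin s) :
    (∑ j : Fin s, C (v j) * X ^ (j:ℕ) : R[X]).coeff i = v i := by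
  rw [finsetSum_coeff, Finset.sum_eq_single i]
  · simp
  · intro j _ hj
    rw [coeff_C_mul, coeff_X_pow, if_neg, mul_zero]
    intro h; exact hj (Fin.ext h.symm)
  · simp
lemma sum_fin_degree {R : Type*} [CommRing R] (s : ℕ) (v : Fin s → R) :
    (∑ j : Fin s, C (v j) * X ^ (j:ℕ) : R[X]).degree < s := by
  refine (Polynomial.degree_sum_le _ _).trans_lt ?_
  refine (Finset.sup_lt_iff (WithBot.bot_lt_coe s)).2 ?_
  intro j _
  exact (degree_C_mul_X_pow_le _ _).trans_lt (WithBot.coe_lt_coe.2 j.2)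
lemma RS.gram_det {s : ℕ} {a : Matrix n n ℝ} (h : RS s a) : (gram s a).det ≠ 0 := by
  intro h0
  obtain ⟨v, hv, hg⟩ := exists_mulVec_eq_zero_iff.2 h0
  have h1 := ip_self_zero _ (gram_quad s a v hg)
  have h2 := h.indep (∑ j : Fin s, C (v j) * X ^ (j:ℕ)) (sum_fin_degree s v) (by rw [sum_fin_poly, h1])
  apply hv
  funext i
  rw [← sum_fin_coeff s v i, h2]; simp
lemma cf_unique {s : ℕ} {a : Matrix n n ℝ} (h : (gram s a).det ≠ 0) (f : ℝ[X]) (hm : f.Monic) (hd : f.natDegree = s)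
    (hf : aeval a f = 0) (y : ℝ) : f.eval y = gf s a y := by
  have hs : f = X ^ s + ∑ j : Fin s, C (f.coeff j) * X ^ (j:ℕ) := by
    conv_lhs => rw [hm.as_sum, hd]
    rw [Finset.sum_range]
  have h1 : a ^ s = - ∑ j : Fin s, f.coeff j • a ^ (j:ℕ) := by
    have := hf
    rw [congrArg (aeval a) hs, map_add, sum_fin_poly, map_pow, aeval_X] at this
    exact eq_neg_of_add_eq_zero_left this
  have h2 : gbeta s a = gram s a *ᵥ (fun j : Fin s => - f.coeff j) := by
    funext i
    rw [gram_mulVec, gbeta, h1]; simp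
  have h3 : cf s a = fun j : Fin s => - f.coeff j := by
    rw [cf, h2, mulVec_mulVec, Matrix.nonsing_inv_mul _ (isUnit_iff_ne_zero.2 h), one_mulVec]
  rw [gf, h3]
  conv_lhs => rw [hs]
  simp [eval_finsetSum]
lemma gram_map {R S : Type*} [CommRing R] [CommRing S] (φ : R →+* S) (s : ℕ) (a : Matrix n n R) :
    (gram s a).map φ = gram s (a.map φ) := by
  ext i j
  have : ∀ k : ℕ, (a.map φ) ^ k = (a ^ k).map φ := by
    intro k; exact ((φ.mapMatrix).map_pow a k).symm
  simp [gram, ip, this]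
def lin (a b : Matrix n n ℝ) : Matrix n n ℝ[X] := a.map C + (X : ℝ[X]) • b.map C
lemma lin_eval (a b : Matrix n n ℝ) (ξ : ℝ) : (lin a b).map (evalRingHom ξ) = a + ξ • b := by
  ext i j; simp [lin]; ring
lemma map_aeval_mat {R S : Type*} [CommRing R] [CommRing S] (φ : R →+* S) (g : R[X]) (M : Matrix n n R) :
    aeval (M.map φ) (g.map φ) = (aeval M g).map φ := by
  have e := Polynomial.map_aeval_eq_aeval_map (φ := φ) (ψ := (φ.mapMatrix : Matrix n n R →+* Matrix n n S)) (by
    refine RingHom.ext fun r => Matrix.ext fun i j => ?_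
    simp [Matrix.algebraMap_matrix_apply]; split_ifs <;> simp) g M
  exact e.symm
theorem POLY (s : ℕ) (a b : Matrix n n ℝ) (h : ∀ ξ : ℝ, ξ ≠ 0 → RS s (a + ξ • b)) :
    ∃ μ : ℝ[X][X], μ.Monic ∧ μ.natDegree = s ∧ aeval (lin a b) μ = 0 := by
  have h1 : (gram (s+1) (lin a b)).det = 0 := by
    apply Polynomial.eq_zero_of_infinite_isRoot
    refine Set.Infinite.mono (s := {ξ : ℝ | ξ ≠ 0}) ?_ ?_
    · intro ξ hξ
      show eval ξ _ = 0
      rw [← coe_evalRingHom, RingHom.map_det, RingHom.mapMatrix_apply, gram_map, lin_eval]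
      obtain ⟨f, hm, hd, hf⟩ := (h ξ hξ).ex
      refine exists_mulVec_eq_zero_iff.1 ⟨fun i : Fin (s+1) => f.coeff i, ?_, ?_⟩
      · intro h0
        have := congrFun h0 (Fin.last s)
        simp only [Fin.val_last, Pi.zero_apply] at this
        rw [← hd, hm.coeff_natDegree] at this
        exact one_ne_zero this
      · funext i
        rw [gram_mulVec]
        have : ∑ j : Fin (s+1), f.coeff j • (a + ξ • b) ^ (j:ℕ) = 0 := by
          rw [← sum_fin_poly, ← hf]
          congr 1
          conv_rhs => rw [f.as_sum_range_C_mul_X_pow, hd]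
          rw [Finset.sum_range]
        rw [this, ip_zero]; rfl
    · exact (Set.finite_singleton (0:ℝ)).infinite_compl
  obtain ⟨v, hv, hg⟩ := exists_mulVec_eq_zero_iff.2 h1
  set W := ∑ j, v j • (lin a b) ^ (j:ℕ) with hW
  have hW0 : W = 0 := by
    have hq := gram_quad (s+1) (lin a b) v hg
    rw [← hW] at hq
    ext1 u w
    apply Polynomial.funext
    intro ξ
    have : W.map (evalRingHom ξ) = 0 := by
      apply ip_self_zero
      have := congrArg (evalRingHom ξ) hq
      simpa [ip] using this
    have := congrFun (congrFun this u) w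
    simpa using this
  set K := FractionRing ℝ[X]
  set φ := algebraMap ℝ[X] K
  have hφ : Function.Injective φ := IsFractionRing.injective _ _
  set AK : Matrix n n K := (lin a b).map φ
  have hmap : ∀ g : ℝ[X][X], aeval AK (g.map φ) = (aeval (lin a b) g).map φ := by
    intro g
    exact map_aeval_mat φ g _
  set f : ℝ[X][X] := ∑ j : Fin (s+1), C (v j) * X ^ (j:ℕ)
  have hf0 : f ≠ 0 := by
    intro h0
    apply hv; funext i
    rw [← sum_fin_coeff (s+1) v i]
    show f.coeff i = 0
    rw [h0]; simp
  have hfA : aeval AK (f.map φ) = 0 := by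
    rw [hmap, sum_fin_poly, ← hW, hW0]; ext; simp
  have hfK : f.map φ ≠ 0 := (Polynomial.map_ne_zero_iff hφ).2 hf0
  have hint : IsIntegral K AK := Algebra.IsIntegral.isIntegral AK
  have hdeg : (minpoly K AK).natDegree ≤ s := by
    have h1 := minpoly.degree_le_of_ne_zero K AK hfK hfA
    have h2 : (f.map φ).degree ≤ s := by
      refine (Polynomial.degree_map_le).trans ?_
      have := sum_fin_degree (s+1) v
      exact Order.le_of_lt_succ (by exact_mod_cast this)
    exact natDegree_le_of_degree_le (h1.trans h2)
  have hdvd : minpoly K AK ∣ (lin a b).charpoly.map φ := by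
    rw [← Matrix.charpoly_map]
    exact minpoly.dvd K AK (Matrix.aeval_self_charpoly _)
  obtain ⟨g, hg'⟩ := IsIntegrallyClosed.eq_map_mul_C_of_dvd K (charpoly_monic (lin a b)) hdvd
  rw [(minpoly.monic hint).leadingCoeff, map_one, mul_one] at hg'
  have hgm : g.Monic := by
    have := minpoly.monic hint
    rw [← hg'] at this
    exact Polynomial.monic_of_injective hφ this
  have hgA : aeval (lin a b) g = 0 := by
    have h1 := hmap g
    rw [show g.map φ = minpoly K AK from hg', minpoly.aeval] at h1
    ext1 i j
    apply hφ
    have := congrFun (congrFun h1 i) j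
    simp only [Matrix.zero_apply, Matrix.map_apply] at this
    rw [← this]; simp
  refine ⟨g, hgm, le_antisymm ?_ ?_, hgA⟩
  · rw [← hg', natDegree_map_eq_of_injective hφ] at hdeg; exact hdeg
  · by_contra hlt
    push Not at hlt
    have h2 : aeval (a + (1:ℝ) • b) (g.map (evalRingHom 1)) = 0 := by
      have e := map_aeval_mat (evalRingHom (1:ℝ)) g (lin a b)
      rw [lin_eval] at e
      rw [e, hgA]; ext; simp
    have := (h 1 one_ne_zero).indep _ (by
      rw [degree_eq_natDegree (hgm.map _).ne_zero, hgm.natDegree_map]; exact_mod_cast hlt) h2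
    exact (hgm.map (evalRingHom (1:ℝ))).ne_zero this
end
section
variable {n : Type*} [Fintype n] [DecidableEq n]
section sm
variable {E : Type*} [NormedAddCommGroup E] [NormedSpace ℝ E] {𝔽 : Type*} [RCLike 𝔽]
variable {k l : Type*} [Fintype k] [Fintype l]
/-- entrywise smoothness at a point -/
def SmAt (f : E → Matrix k l 𝔽) (x : E) : Prop := ∀ i j, ContDiffAt ℝ ∞ (fun y => f y i j) x
variable {x : E}
lemma SmAt.const (M : Matrix k l 𝔽) : SmAt (fun _ : E => M) x := fun _ _ => contDiffAt_const
lemma SmAt.add {f g : E → Matrix k l 𝔽} (hf : SmAt f x) (hg : SmAt g x) : SmAt (fun y => f y + g y) x :=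
  fun i j => (hf i j).add (hg i j)
lemma SmAt.sub {f g : E → Matrix k l 𝔽} (hf : SmAt f x) (hg : SmAt g x) : SmAt (fun y => f y - g y) x :=
  fun i j => (hf i j).sub (hg i j)
lemma SmAt.neg {f : E → Matrix k l 𝔽} (hf : SmAt f x) : SmAt (fun y => - f y) x :=
  fun i j => (hf i j).neg
lemma SmAt.smul {c : E → 𝔽} {f : E → Matrix k l 𝔽} (hc : ContDiffAt ℝ ∞ c x) (hf : SmAt f x) :
    SmAt (fun y => c y • f y) x := fun i j => hc.mul (hf i j)
lemma SmAt.mul {p : Type*} [Fintype p] {f : E → Matrix k l 𝔽} {g : E → Matrix l p 𝔽} (hf : SmAt f x) (hg : SmAt g x) :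
    SmAt (fun y => f y * g y) x := by
  intro i j
  simp only [Matrix.mul_apply]
  exact ContDiffAt.sum fun u _ => (hf i u).mul (hg u j)
lemma SmAt.sum {ι : Type*} (t : Finset ι) {f : ι → E → Matrix k l 𝔽} (hf : ∀ i ∈ t, SmAt (f i) x) :
    SmAt (fun y => ∑ i ∈ t, f i y) x := by
  intro i j
  simp only [Matrix.sum_apply]
  exact ContDiffAt.sum fun u hu => hf u hu i j
lemma SmAt.ct {f : E → Matrix k l ℂ} (hf : SmAt f x) : SmAt (fun y => (f y)ᴴ) x := by
  intro i j
  simp only [Matrix.conjTranspose_apply]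
  exact (Complex.conjCLE.contDiff.contDiffAt).comp x (hf j i)
lemma SmAt.pow [DecidableEq k] {f : E → Matrix k k 𝔽} (hf : SmAt f x) (q : ℕ) : SmAt (fun y => (f y) ^ q) x := by
  induction q with
  | zero => simpa using SmAt.const (1 : Matrix k k 𝔽)
  | succ q ih => simp only [pow_succ]; exact ih.mul hf
lemma SmAt.det [DecidableEq k] {f : E → Matrix k k 𝔽} (hf : SmAt f x) : ContDiffAt ℝ ∞ (fun y => (f y).det) x := by
  simp only [Matrix.det_apply']
  exact ContDiffAt.sum fun σ _ => contDiffAt_const.mul (contDiffAt_prod fun i _ => hf _ _)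
lemma SmAt.inv [DecidableEq k] {f : E → Matrix k k 𝔽} (hf : SmAt f x) (hd : (f x).det ≠ 0) :
    SmAt (fun y => (f y)⁻¹) x := by
  intro i j
  simp only [Matrix.inv_def, Matrix.smul_apply, Matrix.adjugate_apply, Ring.inverse_eq_inv', smul_eq_mul]
  refine (hf.det.inv hd).mul (SmAt.det ?_)
  intro a b
  by_cases h : a = j
  · subst h; simpa using contDiffAt_const
  · simpa [Matrix.updateRow_ne h] using hf a b
lemma SmAt.cont {f : E → Matrix k l 𝔽} (hf : SmAt f x) (i j) : ContinuousAt (fun y => f y i j) x := (hf i j).continuousAt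
lemma SmAt.ofReal {f : E → Matrix k l ℝ} (hf : SmAt f x) : SmAt (fun y => (f y).map (fun t => (t:ℂ))) x := by
  intro i j
  exact (Complex.ofRealCLM.contDiff.contDiffAt).comp x (hf i j)
lemma SmAt.fromBlocks {p q : Type*} [Fintype p] [Fintype q] {a : E → Matrix k p 𝔽} {b : E → Matrix k q 𝔽} {c : E → Matrix l p 𝔽}
    {d : E → Matrix l q 𝔽} (ha : SmAt a x) (hb : SmAt b x) (hc : SmAt c x) (hd : SmAt d x) :
    SmAt (fun y => Matrix.fromBlocks (a y) (b y) (c y) (d y)) x := by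
  rintro (i | i) (j | j)
  · exact ha i j
  · exact hb i j
  · exact hc i j
  · exact hd i j
lemma contDiffAt_ip {f g : E → Matrix n n ℝ} (hf : SmAt f x) (hg : SmAt g x) :
    ContDiffAt ℝ ∞ (fun y => ip (f y) (g y)) x :=
  ContDiffAt.sum fun u _ => ContDiffAt.sum fun v _ => (hf u v).mul (hg u v)
lemma contDiffAt_gf {f : E → Matrix n n ℝ} {w : E → ℝ} (s : ℕ) (hf : SmAt f x) (hw : ContDiffAt ℝ ∞ w x)
    (hd : (gram s (f x)).det ≠ 0) : ContDiffAt ℝ ∞ (fun y => gf s (f y) (w y)) x := by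
  unfold gf cf
  refine (hw.pow s).sub (ContDiffAt.sum fun i _ => ContDiffAt.mul ?_ (hw.pow _))
  have hg : SmAt (fun y => gram s (f y)) x := fun i j => contDiffAt_ip (hf.pow _) (hf.pow _)
  simp only [Matrix.mulVec, dotProduct]
  exact ContDiffAt.sum fun j _ => ((hg.inv hd) i j).mul (contDiffAt_ip (hf.pow _) (hf.pow _))
end sm
open Polynomial
lemma gf_smul {s : ℕ} {M : Matrix n n ℝ} (h : RS s M) {t : ℝ} (ht : t ≠ 0) (h' : (gram s (t • M)).det ≠ 0) (y : ℝ) :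
    gf s (t • M) (t * y) = t ^ s * gf s M y := by
  obtain ⟨f, hm, hd, hf⟩ := h.ex
  have hti : t⁻¹ ≠ 0 := inv_ne_zero ht
  have hnd : (C t⁻¹ * X : ℝ[X]).natDegree = 1 := natDegree_C_mul_X _ hti
  have h1 : (f.comp (C t⁻¹ * X)).natDegree = s := by rw [natDegree_comp, hnd, hd, mul_one]
  have hts : t ^ s ≠ 0 := pow_ne_zero _ ht
  have h2 := cf_unique h' (C (t ^ s) * f.comp (C t⁻¹ * X)) (by
    rw [Monic, leadingCoeff_mul, leadingCoeff_comp (by rw [hnd]; norm_num), hm.leadingCoeff, hd]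
    simp [leadingCoeff_C_mul_X, ← mul_pow, ht]) (by rw [natDegree_C_mul hts, h1]) (by
    rw [map_mul, aeval_comp]
    have : aeval (t • M) (C t⁻¹ * X : ℝ[X]) = M := by
      simp [smul_smul, ht, Algebra.algebraMap_eq_smul_one]
    rw [this, hf, mul_zero]) (t * y)
  rw [← h2, ← cf_unique h.gram_det f hm hd hf]
  simp [eval_comp, ht]
lemma CHgen {T : Matrix n n ℝ} {f : ℝ[X]} {Q : Matrix n n ℝ[X]} (h : f • (1 : Matrix n n ℝ[X]) = Q * charmatrix T) :
    aeval T f = 0 := by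
  apply_fun matPolyEquiv at h
  simp only [map_mul, matPolyEquiv_charmatrix] at h
  apply_fun fun p => p.eval T at h
  rw [eval_mul_X_sub_C] at h
  rw [matPolyEquiv_smul_one, eval_map] at h
  exact h
lemma CHgen' {T D : Matrix n n ℝ} {f : ℝ[X]} {Q : Matrix n n ℝ[X]} (h : f • (1 : Matrix n n ℝ[X]) = D.map C + Q * charmatrix T) :
    aeval T f = D := by
  apply_fun matPolyEquiv at h
  simp only [map_add, map_mul, matPolyEquiv_charmatrix] at h
  apply_fun fun p => p.eval T at h
  rw [eval_add, eval_mul_X_sub_C] at h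
  rw [matPolyEquiv_smul_one, eval_map, add_zero] at h
  have : matPolyEquiv (D.map C) = C D := matPolyEquiv_map_C D
  rw [this, eval_C] at h
  exact h
lemma CHq {T : Matrix n n ℝ} {q : ℝ[X]} {ξ : ℝ} {Q : Matrix n n ℝ[X]}
    (h : ((X - C ξ) * q) • (1 : Matrix n n ℝ[X]) = Q * charmatrix T) :
    aeval T q = Q.map (eval ξ) := by
  set D := Q.map (eval ξ) with hD
  have hdiv : ∀ i j, ∃ e, Q i j - C (D i j) = (X - C ξ) * e := fun i j => by
    have : (X - C ξ) ∣ Q i j - C (D i j) := by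
      rw [dvd_iff_isRoot]; simp [hD]
    exact this
  choose e he using hdiv
  have hQ : Q = D.map C + (X - C ξ) • Matrix.of e := by
    ext1 i j
    have := he i j
    simp only [Matrix.add_apply, Matrix.map_apply, Matrix.smul_apply, Matrix.of_apply, smul_eq_mul]
    rw [← this]; ring
  have hDT : D * T = ξ • D := by
    have h1 := congrArg (fun Z : Matrix n n ℝ[X] => Z.map (evalRingHom ξ)) h
    simp only [Matrix.map_mul] at h1
    have e1 : (charmatrix T).map (evalRingHom ξ) = ξ • (1 : Matrix n n ℝ) - T := by
      ext i j
      by_cases hij : i = j <;> simp [charmatrix_apply, hij, Matrix.one_apply]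
    have e2 : (((X - C ξ) * q) • (1 : Matrix n n ℝ[X])).map (evalRingHom ξ) = 0 := by
      ext i j
      simp
    rw [e1, e2] at h1
    have e3 : Q.map (evalRingHom ξ) = D := rfl
    rw [e3, mul_sub, Matrix.mul_smul, mul_one] at h1
    exact (sub_eq_zero.1 h1.symm).symm
  refine CHgen' (Q := Matrix.of e) ?_
  have hne : (X - C ξ : ℝ[X]) ≠ 0 := X_sub_C_ne_zero ξ
  have h3 : (D.map C : Matrix n n ℝ[X]) * charmatrix T = (X - C ξ) • D.map C := by
    have hc : charmatrix T = (X : ℝ[X]) • (1 : Matrix n n ℝ[X]) - T.map C := by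
      ext1 i j
      by_cases hij : i = j <;> simp [charmatrix_apply, hij, Matrix.one_apply]
    rw [hc, mul_sub, Matrix.mul_smul, mul_one, ← Matrix.map_mul, hDT, sub_smul]
    congr 1
    ext1 i j
    simp
  have h4 : (X - C ξ) • (q • (1 : Matrix n n ℝ[X])) = (X - C ξ) • (D.map C + Matrix.of e * charmatrix T) := by
    rw [smul_smul, h]
    conv_lhs => rw [hQ]
    rw [add_mul, h3, smul_add, Matrix.smul_mul]
  ext1 i j
  have := congrFun (congrFun h4 i) j
  simp only [Matrix.smul_apply, smul_eq_mul] at this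
  exact mul_left_cancel₀ hne this
end
section
open Polynomial
variable {n : Type*} [Fintype n] [DecidableEq n]
lemma rad1 {a b T : Matrix n n ℝ} {τ : ℝ} (hT : b * T = -(a + τ • (1 : Matrix n n ℝ))) {μ : ℝ[X][X]}
    (hμ : aeval (lin a b) μ = 0) : ∃ ν : ℝ[X][X], μ = C (μ.eval (C (-τ))) + (X - C (C (-τ))) * ν ∧
    (μ.eval (C (-τ))) • (1 : Matrix n n ℝ[X]) = (-(aeval (lin a b) ν * b.map C)) * charmatrix T := by
  refine ⟨μ /ₘ (X - C (C (-τ))), ?_, ?_⟩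
  · rw [X_sub_C_mul_divByMonic_eq_sub_modByMonic, modByMonic_X_sub_C_eq_C_eval]; ring
  set ν := μ /ₘ (X - C (C (-τ)))
  have h1 : μ = C (μ.eval (C (-τ))) + ν * (X - C (C (-τ))) := by
    rw [mul_comm, X_sub_C_mul_divByMonic_eq_sub_modByMonic, modByMonic_X_sub_C_eq_C_eval]; ring
  have h2 := congrArg (aeval (lin a b)) h1
  rw [hμ, map_add, map_mul, map_sub, aeval_X, aeval_C, aeval_C] at h2
  have hc : charmatrix T = (X : ℝ[X]) • (1 : Matrix n n ℝ[X]) - T.map C := by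
    ext1 i j
    by_cases hij : i = j <;> simp [charmatrix_apply, hij, Matrix.one_apply]
  have h3 : lin a b - algebraMap ℝ[X] (Matrix n n ℝ[X]) (C (-τ)) = b.map C * charmatrix T := by
    rw [hc, mul_sub, Matrix.mul_smul, mul_one, ← Matrix.map_mul, hT]
    ext1 i j
    by_cases hij : i = j <;> simp [lin, Matrix.algebraMap_matrix_apply, hij, Matrix.one_apply] <;> ring
  rw [h3, Algebra.algebraMap_eq_smul_one, ← mul_assoc] at h2
  rw [neg_mul]
  exact eq_neg_of_add_eq_zero_left h2.symm
lemma rad_eval {s : ℕ} {a b : Matrix n n ℝ} {μ : ℝ[X][X]} (hm : μ.Monic) (hd : μ.natDegree = s) (hμ : aeval (lin a b) μ = 0)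
    {ξ : ℝ} (h : RS s (a + ξ • b)) (τ : ℝ) : (μ.eval (C (-τ))).eval ξ = gf s (a + ξ • b) (-τ) := by
  rw [← cf_unique h.gram_det (μ.map (evalRingHom ξ)) (hm.map _) (by rw [hm.natDegree_map, hd]) (by
    rw [← lin_eval, map_aeval_mat, hμ]; simp)]
  have e : (-τ) = evalRingHom ξ (C (-τ)) := by simp
  conv_rhs => rw [e, eval_map, eval₂_hom]
  rfl
lemma gf_zero_ne {s : ℕ} {b : Matrix n n ℝ} (h : RS s b) (hb : b.det ≠ 0) : gf s b 0 ≠ 0 := by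
  have hg := h.gram_det
  obtain ⟨L, hL, h0, he⟩ := h
  rw [← cf_unique hg _ (monic_prod_of_monic L (fun l => X - C l) fun l _ => monic_X_sub_C l) (by
    rw [natDegree_prod_of_monic _ _ fun l _ => monic_X_sub_C l]; simp [hL]) h0, eval_prod, Finset.prod_ne_zero_iff]
  intro l hl
  obtain ⟨v, hv, hbv⟩ := he l hl
  simp only [eval_sub, eval_X, eval_C, zero_sub, neg_ne_zero]
  rintro rfl
  rw [zero_smul] at hbv
  exact hb (exists_mulVec_eq_zero_iff.1 ⟨v, hv, hbv⟩)
lemma rad_deg {s : ℕ} {a b : Matrix n n ℝ} (h : ∀ ξ : ℝ, ξ ≠ 0 → RS s (a + ξ • b)) (h' : ∀ t : ℝ, RS s (b + t • a))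
    (τ : ℝ) {r : ℝ[X]} (hr : ∀ ξ : ℝ, ξ ≠ 0 → r.eval ξ = gf s (a + ξ • b) (-τ)) :
    (r - C (gf s b 0) * X ^ s).degree < (s : WithBot ℕ) := by
  have hX : (X ^ s : ℝ[X]) ≠ 0 := pow_ne_zero _ X_ne_zero
  have hdX : (X ^ s : ℝ[X]).degree = s := degree_X_pow s
  rw [← hdX, ← div_tendsto_atTop_zero_iff_degree_lt _ _ hX]
  have hc : ContinuousAt (fun t : ℝ => gf s (b + t • a) (-τ * t)) 0 := by
    refine ContDiffAt.continuousAt (𝕜 := ℝ) (n := ∞) (contDiffAt_gf s ?_ ?_ (h' 0).gram_det)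
    · exact SmAt.add (SmAt.const b) (SmAt.smul contDiffAt_id (SmAt.const a))
    · exact contDiffAt_const.mul contDiffAt_id
  have h1 : Filter.Tendsto (fun ξ : ℝ => gf s (b + ξ⁻¹ • a) (-τ * ξ⁻¹)) Filter.atTop (𝓝 (gf s b 0)) := by
    have := hc.tendsto.comp (tendsto_inv_atTop_zero (𝕜 := ℝ))
    simpa [Function.comp_def] using this
  have h2 := h1.sub_const (gf s b 0)
  rw [sub_self] at h2
  refine h2.congr' ?_
  filter_upwards [Filter.eventually_gt_atTop (0:ℝ)] with ξ hξ
  have hξ0 : ξ ≠ 0 := hξ.ne'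
  have e1 : a + ξ • b = ξ • (b + ξ⁻¹ • a) := by rw [smul_add, smul_smul, mul_inv_cancel₀ hξ0, one_smul, add_comm]
  have e2 : -τ = ξ * (-τ * ξ⁻¹) := by field_simp
  have e3 := gf_smul (h' ξ⁻¹) hξ0 (by rw [← e1]; exact (h ξ hξ0).gram_det) (-τ * ξ⁻¹)
  rw [← e1, ← e2, ← hr ξ hξ0] at e3
  have hp : ξ ^ s ≠ 0 := pow_ne_zero _ hξ0
  simp only [eval_sub, eval_mul, eval_C, eval_pow, eval_X, e3]
  field_simp
/-- the radical polynomial -/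
def rpol (s : ℕ) (a b : Matrix n n ℝ) (τ : ℝ) : ℝ[X] := C (gf s b 0)⁻¹ *
  Lagrange.interpolate (Finset.range (s+1)) (fun k : ℕ => (k:ℝ) + 1) (fun k => gf s (a + ((k:ℝ)+1) • b) (-τ))
theorem RAD {s : ℕ} {a b T : Matrix n n ℝ} {τ : ℝ} (h : ∀ ξ : ℝ, ξ ≠ 0 → RS s (a + ξ • b)) (h' : ∀ t : ℝ, RS s (b + t • a))
    (hb : b.det ≠ 0) (hT : b * T = -(a + τ • (1 : Matrix n n ℝ))) :
    (rpol s a b τ).Monic ∧ (rpol s a b τ).natDegree = s ∧ aeval T (rpol s a b τ) = 0 ∧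
    ∀ ξ : ℝ, RS s (a + ξ • b) → ∀ q, rpol s a b τ = (X - C ξ) * q → ∃ c : ℝ, c ≠ 0 ∧ ∃ π Z : Matrix n n ℝ,
      π * π = π ∧ π * (a + ξ • b) = (-τ) • π ∧ (a + ξ • b) * π = (-τ) • π ∧
      π = 1 + Z * (a + ξ • b + τ • (1 : Matrix n n ℝ)) ∧ aeval T q = c • (π * b) := by
  obtain ⟨μ, hm, hd, hμ⟩ := POLY s a b h
  obtain ⟨ν, hν, hD⟩ := rad1 hT hμ
  set r := μ.eval (C (-τ)) with hrdef
  have hg : gf s b 0 ≠ 0 := gf_zero_ne (by simpa using h' 0) hb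
  have hr : ∀ ξ : ℝ, ξ ≠ 0 → r.eval ξ = gf s (a + ξ • b) (-τ) := fun ξ hξ => rad_eval hm hd hμ (h ξ hξ) τ
  have hdeg := rad_deg h h' τ hr
  set g := gf s b 0 with hgdef
  have hdeg2 : (C g * X ^ s : ℝ[X]).degree = s := degree_C_mul_X_pow s hg
  have hrd : r.degree = s := by
    have : r = (r - C g * X ^ s) + C g * X ^ s := by ring
    rw [this, degree_add_eq_right_of_degree_lt (by rwa [hdeg2]), hdeg2]
  have hrl : r.leadingCoeff = g := by
    have : r = (r - C g * X ^ s) + C g * X ^ s := by ring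
    rw [this, leadingCoeff_add_of_degree_lt (by rwa [hdeg2]), leadingCoeff_C_mul_X_pow]
  have hrp : rpol s a b τ = C g⁻¹ * r := by
    rw [rpol]
    congr 1
    refine (Lagrange.eq_interpolate_of_eval_eq _ (fun i _ j _ hij => by simpa using hij) ?_ fun i _ => ?_).symm
    · rw [hrd, Finset.card_range]; exact_mod_cast Nat.lt_succ_self s
    · exact hr _ (by positivity)
  have hgi : g⁻¹ ≠ 0 := inv_ne_zero hg
  rw [hrp]
  refine ⟨?_, ?_, ?_, ?_⟩
  · rw [Monic, leadingCoeff_mul, leadingCoeff_C, hrl, inv_mul_cancel₀ hg]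
  · rw [natDegree_C_mul hgi]; exact natDegree_eq_of_degree_eq_some hrd
  · rw [map_mul, CHgen hD, mul_zero]
  intro ξ hRS q hq
  have hrq : r = (X - C ξ) * (C g * q) := by
    have : r = C g * (C g⁻¹ * r) := by rw [← mul_assoc, ← C_mul, mul_inv_cancel₀ hg, C_1, one_mul]
    rw [this, hq]; ring
  have hq2 : aeval T (C g * q) = _ := CHq (T := T) (ξ := ξ) (by rw [← hrq]; exact hD)
  set φ := evalRingHom ξ with hφ
  set A := a + ξ • b with hA
  set D := aeval A (ν.map φ) with hDdef
  have hDm : (-(aeval (lin a b) ν * b.map C)).map (eval ξ) = -(D * b) := by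
    have : (aeval (lin a b) ν).map φ = D := by rw [hDdef, hA, ← lin_eval, map_aeval_mat]
    rw [← this]
    have e1 : (b.map C).map φ = b := by ext i j; simp [hφ]
    have e2 : ((aeval (lin a b) ν) * b.map C).map φ = (aeval (lin a b) ν).map φ * b := by
      rw [Matrix.map_mul, e1]
    rw [← e2]
    ext i j; simp [hφ]
  have hμξ : μ.map φ = (X + C τ) * ν.map φ := by
    conv_lhs => rw [hν, hrq]
    simp [hφ, Polynomial.map_mul]
  have hAμ : aeval A (μ.map φ) = 0 := by rw [hA, ← lin_eval, map_aeval_mat, hμ]; simp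
  have hmm : (μ.map φ).Monic := hm.map _
  have hnd : (μ.map φ).natDegree = s := by rw [hm.natDegree_map, hd]
  have hνm : (ν.map φ).Monic := by
    have := hmm; rw [hμξ] at this
    exact (monic_X_add_C τ).of_mul_monic_left this
  have hνd : (ν.map φ).natDegree + 1 = s := by
    rw [← hnd, hμξ, (monic_X_add_C τ).natDegree_mul hνm, natDegree_X_add_C, add_comm]
  set d := (ν.map φ).eval (-τ) with hd'
  have hd0 : d ≠ 0 := by
    intro h0
    obtain ⟨L, hL, -, he⟩ := hRS
    refine hνm.ne_zero (Polynomial.eq_zero_of_degree_lt_of_eval_finset_eq_zero L ?_ fun l hl => ?_)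
    · rw [hL, degree_eq_natDegree hνm.ne_zero]; exact_mod_cast (by omega)
    · obtain ⟨v, hv, hav⟩ := he l hl
      have e1 := aeval_eigK A (μ.map φ) l v hav
      rw [hAμ, zero_mulVec, hμξ, eval_mul] at e1
      rcases smul_eq_zero.1 e1.symm with e2 | e2
      · rcases mul_eq_zero.1 e2 with e3 | e3
        · have : l = -τ := by simp at e3; linarith
          rw [this]; exact h0
        · exact e3
      · exact absurd e2 hv
  have hAD : aeval A (X + C τ : ℝ[X]) = A + τ • (1 : Matrix n n ℝ) := by
    rw [map_add, aeval_X, aeval_C, Algebra.algebraMap_eq_smul_one]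
  have hz1 : (A + τ • (1 : Matrix n n ℝ)) * D = 0 := by
    rw [← hAD, hDdef, ← map_mul, ← hμξ, hAμ]
  have hz2 : D * (A + τ • (1 : Matrix n n ℝ)) = 0 := by
    rw [← hAD, hDdef, ← map_mul, mul_comm, ← hμξ, hAμ]
  obtain ⟨e, he⟩ : (X - C (-τ)) ∣ ν.map φ - C d := by rw [dvd_iff_isRoot]; simp [hd']
  have hDe : D = d • (1 : Matrix n n ℝ) + aeval A e * (A + τ • (1 : Matrix n n ℝ)) := by
    have : ν.map φ = C d + e * (X + C τ) := by
      rw [← sub_eq_iff_eq_add'] ; rw [he]; simp [mul_comm]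
    rw [hDdef, this, map_add, map_mul, hAD, aeval_C, Algebra.algebraMap_eq_smul_one]
  have hcomm : aeval A e * (A + τ • (1 : Matrix n n ℝ)) = (A + τ • (1 : Matrix n n ℝ)) * aeval A e := by
    rw [← hAD, ← map_mul, ← map_mul, mul_comm]
  have hDD : D * D = d • D := by
    have : D * D = (d • (1 : Matrix n n ℝ) + aeval A e * (A + τ • (1 : Matrix n n ℝ))) * D := by rw [← hDe]
    rw [this, add_mul, mul_assoc, hz1, mul_zero, add_zero, Matrix.smul_mul, one_mul]
  refine ⟨-(g⁻¹ * d), neg_ne_zero.2 (mul_ne_zero hgi hd0), d⁻¹ • D, d⁻¹ • aeval A e, ?_, ?_, ?_, ?_, ?_⟩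
  · rw [Matrix.smul_mul, Matrix.mul_smul, hDD, smul_smul d⁻¹ d, inv_mul_cancel₀ hd0, one_smul]
  · rw [mul_add, Matrix.mul_smul, mul_one] at hz2
    rw [Matrix.smul_mul, eq_neg_of_add_eq_zero_left hz2, smul_comm, neg_smul]
  · rw [add_mul, Matrix.smul_mul, one_mul] at hz1
    rw [Matrix.mul_smul, eq_neg_of_add_eq_zero_left hz1, smul_comm, neg_smul]
  · conv_lhs => rw [hDe]
    rw [smul_add, smul_smul, inv_mul_cancel₀ hd0, one_smul, Matrix.smul_mul]
  · have e1 : q = C g⁻¹ * (C g * q) := by rw [← mul_assoc, ← C_mul, inv_mul_cancel₀ hg, C_1, one_mul]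
    rw [e1, map_mul, hq2, hDm, aeval_C, Algebra.algebraMap_eq_smul_one, Matrix.smul_mul, one_mul, Matrix.smul_mul, smul_smul, smul_neg, neg_mul, neg_smul]
    congr 2
    field_simp
end
section
open Polynomial
variable {n : Type*} [Fintype n] [DecidableEq n]
variable {E : Type*} [NormedAddCommGroup E] [NormedSpace ℝ E]
lemma rpol_smooth {s : ℕ} {a b : E → Matrix n n ℝ} {τ : E → ℝ} {x : E} (ha : SmAt a x) (hb : SmAt b x) (hτ : ContDiffAt ℝ ∞ τ x)
    (h : ∀ ξ : ℝ, ξ ≠ 0 → RS s (a x + ξ • b x)) (h' : RS s (b x)) (hd : (b x).det ≠ 0) (k : ℕ) :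
    ContDiffAt ℝ ∞ (fun y => (rpol s (a y) (b y) (τ y)).coeff k) x := by
  simp only [rpol, coeff_C_mul, Lagrange.interpolate_apply, finsetSum_coeff]
  refine ContDiffAt.mul (ContDiffAt.inv (contDiffAt_gf s hb contDiffAt_const h'.gram_det) (gf_zero_ne h' hd)) ?_
  refine ContDiffAt.sum fun i _ => ContDiffAt.mul ?_ contDiffAt_const
  exact contDiffAt_gf s (SmAt.add ha (SmAt.smul contDiffAt_const hb)) hτ.neg (h _ (by positivity)).gram_det
lemma RS_of {N : ℕ} {M : MR N} {mult : Multiset ℕ}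
    (h1 : ∀ μ ∈ spectrum ℂ (cmap M), μ.im = 0)
    (h2 : ∀ μ : ℂ, Module.End.eigenspace (toLin' (cmap M)) μ = Module.End.maxGenEigenspace (toLin' (cmap M)) μ)
    (h3 : ((cmap M).charpoly.roots.dedup.map fun μ => (cmap M).charpoly.roots.count μ) = mult) : RS (Multiset.card mult) M := by
  have hsp : ∀ μ, μ ∈ (cmap M).charpoly.roots ↔ μ ∈ spectrum ℂ (cmap M) := fun μ => by
    rw [Matrix.mem_spectrum_iff_isRoot_charpoly, mem_roots (charpoly_monic _).ne_zero]
  have hre : ∀ μ ∈ (cmap M).charpoly.roots.toFinset, ((μ.re : ℝ) : ℂ) = μ := fun μ hμ => by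
    rw [Multiset.mem_toFinset, hsp] at hμ
    exact Complex.ext rfl (by simp [h1 μ hμ])
  refine ⟨(cmap M).charpoly.roots.toFinset.image Complex.re, ?_, ?_, ?_⟩
  · rw [Finset.card_image_of_injOn, ← h3, Multiset.card_map]; rfl
    intro u hu v hv huv
    rw [← hre u hu, ← hre v hv]; exact congrArg _ huv
  · set g : ℝ[X] := ∏ l ∈ (cmap M).charpoly.roots.toFinset.image Complex.re, (X - C l) with hg
    have e1 : aeval (cmap M) (g.map Complex.ofRealHom) = (aeval M g).map Complex.ofRealHom := map_aeval_mat Complex.ofRealHom g M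
    have e2 : aeval (cmap M) (g.map Complex.ofRealHom) = 0 := by
      have e3 : aeval (toLin' (cmap M)) (g.map Complex.ofRealHom) = 0 := by
        have hker : (⊤ : Submodule ℂ (Fin N → ℂ)) ≤ LinearMap.ker (aeval (toLin' (cmap M)) (g.map Complex.ofRealHom)) := by
          rw [← Module.End.iSup_maxGenEigenspace_eq_top (toLin' (cmap M))]
          refine iSup_le fun μ => ?_
          rw [← h2]
          intro v hv
          by_cases hv0 : v = 0
          · rw [hv0]; exact Submodule.zero_mem _
          have hev : Module.End.HasEigenvector (toLin' (cmap M)) μ v := ⟨hv, hv0⟩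
          rw [LinearMap.mem_ker, Module.End.aeval_apply_of_hasEigenvector hev]
          have hm : μ ∈ (cmap M).charpoly.roots.toFinset := by
            rw [Multiset.mem_toFinset, hsp, ← Matrix.spectrum_toLin']
            exact (Module.End.hasEigenvalue_of_hasEigenvector hev).mem_spectrum
          have : (g.map Complex.ofRealHom).eval μ = 0 := by
            rw [← hre μ hm, hg, Polynomial.map_prod, eval_prod]
            refine Finset.prod_eq_zero (Finset.mem_image_of_mem _ hm) ?_
            simp
          rw [this, zero_smul]
        exact LinearMap.ext fun v => LinearMap.mem_ker.1 (hker trivial)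
      have e4 : aeval (toLin' (cmap M)) (g.map Complex.ofRealHom) = toLin' (aeval (cmap M) (g.map Complex.ofRealHom)) := by
        exact Polynomial.aeval_algHom_apply (Matrix.toLinAlgEquiv' : MC (Fin N) ≃ₐ[ℂ] _).toAlgHom (cmap M) _
      rw [e4] at e3
      exact toLin'.map_eq_zero_iff.1 e3
    rw [e2] at e1
    ext i j
    have := congrFun (congrFun e1 i) j
    simpa using this.symm
  · intro l hl
    obtain ⟨μ, hμ, rfl⟩ := Finset.mem_image.1 hl
    have e0 := hre μ hμ
    rw [Multiset.mem_toFinset, mem_roots (charpoly_monic _).ne_zero, IsRoot, ← e0, Matrix.eval_charpoly] at hμ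
    have e1 : (scalar (Fin N) ((μ.re:ℝ):ℂ) - cmap M) = (scalar (Fin N) μ.re - M).map Complex.ofRealHom := by
      ext i j; simp [cmap, Matrix.diagonal_apply]; split_ifs <;> simp
    rw [e1] at hμ
    have e2 : (scalar (Fin N) μ.re - M).det = 0 := by
      have := RingHom.map_det Complex.ofRealHom (scalar (Fin N) μ.re - M)
      rw [RingHom.mapMatrix_apply, hμ] at this
      simpa using this
    obtain ⟨v, hv, hv2⟩ := exists_mulVec_eq_zero_iff.2 e2
    refine ⟨v, hv, ?_⟩
    rw [sub_mulVec, sub_eq_zero] at hv2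
    rw [← hv2]; ext i; simp [Matrix.mulVec_diagonal]
end
section
lemma SQRT (R : Type*) [NormedRing R] [NormedAlgebra ℝ R] [CompleteSpace R] :
    ∃ F : R → R, F 1 = 1 ∧ (∀ᶠ z in 𝓝 (1:R), ContDiffAt ℝ ∞ F z ∧ F z * F z = z) ∧ ∀ᶠ w in 𝓝 (1:R), F (w * w) = w := by
  let sq : R → R := fun w => w * w
  let f' : R ≃L[ℝ] R := ContinuousLinearEquiv.smulLeft (Units.mk0 (2:ℝ) two_ne_zero)
  have hcd : ContDiff ℝ ω sq := contDiff_id.mul contDiff_id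
  have hf : HasFDerivAt sq (f' : R →L[ℝ] R) 1 := by
    have := (hasFDerivAt_id (𝕜 := ℝ) (1:R)).mul' (hasFDerivAt_id (𝕜 := ℝ) (1:R))
    convert! this using 1
    ext v
    simp [f', two_smul]
  have hs := hcd.contDiffAt.hasStrictFDerivAt' hf (by simp)
  refine ⟨hs.localInverse sq f' 1, ?_, ?_, ?_⟩
  · have := hs.localInverse_apply_image
    simpa [sq] using this
  · have h1 : ContDiffAt ℝ ω (hs.localInverse sq f' 1) (sq 1) := by
      have := hcd.contDiffAt.to_localInverse hf (by simp) (n := ω)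
      exact this
    have h2 := h1.eventually (by simp)
    have h3 := hs.eventually_right_inverse
    simp only [sq, mul_one] at h2 h3
    filter_upwards [h2, h3] with z hz hz3
    exact ⟨hz.of_le (by simp), hz3⟩
  · exact hs.eventually_left_inverse
lemma sq_comm {R : Type*} [NormedRing R] [NormedAlgebra ℝ R] [CompleteSpace R] {F : R → R} (h : ∀ᶠ w in 𝓝 (1:R), F (w * w) = w) :
    ∀ᶠ w in 𝓝 (1:R), ∀ t : R, t * (w * w) = (w * w) * t → t * w = w * t := by
  filter_upwards [h.eventually_nhds] with w hw t ht
  have hc : ContinuousAt (fun ε : ℝ => (1 + ε • t) * w * Ring.inverse (1 + ε • t)) 0 := by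
    have h1 : ContinuousAt (fun ε : ℝ => 1 + ε • t) 0 := by fun_prop
    have h2 : ContinuousAt (fun ε : ℝ => Ring.inverse (1 + ε • t)) 0 := by
      refine ContinuousAt.comp (g := Ring.inverse) ?_ h1
      have := NormedRing.inverse_continuousAt (1 : Rˣ)
      simpa using this
    exact (h1.mul continuousAt_const).mul h2
  have e1 : ∀ᶠ ε : ℝ in 𝓝 0, F (((1 + ε • t) * w * Ring.inverse (1 + ε • t)) * ((1 + ε • t) * w * Ring.inverse (1 + ε • t))) =
      ((1 + ε • t) * w * Ring.inverse (1 + ε • t)) := by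
    refine hc.tendsto.eventually (p := fun z => F (z * z) = z) ?_
    simpa using hw
  have e2 : ∀ᶠ ε : ℝ in 𝓝 0, IsUnit (1 + ε • t) := by
    have h1 : ContinuousAt (fun ε : ℝ => 1 + ε • t) 0 := by fun_prop
    refine h1.tendsto.eventually ?_
    have := Units.nhds (1 : Rˣ)
    simp only [Units.val_one] at this
    simpa using (show ∀ᶠ y in 𝓝 (1:R), IsUnit y from this)
  obtain ⟨ε, ⟨h1, h2⟩, hε⟩ := ((e1.and e2).filter_mono nhdsWithin_le_nhds |>.and (self_mem_nhdsWithin (s := {0}ᶜ) (a := (0:ℝ)))).exists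
  obtain ⟨u, hu⟩ := h2
  rw [← hu, Ring.inverse_unit] at h1
  have hcomm : (u:R) * (w * w) = (w * w) * u := by
    rw [hu, add_mul, mul_add, one_mul, mul_one, smul_mul_assoc, mul_smul_comm, ht]
  have h3 : (u:R) * w * ↑u⁻¹ * (u * w * ↑u⁻¹) = w * w := by
    calc (u:R) * w * ↑u⁻¹ * (u * w * ↑u⁻¹) = u * w * (↑u⁻¹ * u) * w * ↑u⁻¹ := by noncomm_ring
      _ = (u * (w * w)) * ↑u⁻¹ := by rw [Units.inv_mul, mul_one]; noncomm_ring
      _ = w * w := by rw [hcomm, mul_assoc, Units.mul_inv, mul_one]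
  rw [h3, hw.self_of_nhds] at h1
  have h4 : w * u = u * w := by
    conv_lhs => rw [h1]
    rw [mul_assoc, Units.inv_mul, mul_one]
  rw [hu, mul_add, add_mul, mul_one, one_mul, add_right_inj, mul_smul_comm, smul_mul_assoc] at h4
  exact (smul_right_injective R hε h4).symm
variable {n : Type*} [Fintype n] [DecidableEq n]
variable {E : Type*} [NormedAddCommGroup E] [NormedSpace ℝ E]
section
attribute [local instance] Matrix.linftyOpNormedRing Matrix.linftyOpNormedAlgebra
lemma SmAt_iff {f : E → MC n} {x : E} : SmAt f x ↔ ContDiffAt ℝ ∞ f x := by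
  constructor
  · intro h
    have : f = fun y => ∑ i, ∑ j, f y i j • Matrix.single i j (1:ℂ) := by
      funext y
      conv_lhs => rw [Matrix.matrix_eq_sum_single (f y)]
      simp
    rw [this]
    exact ContDiffAt.sum fun i _ => ContDiffAt.sum fun j _ => (h i j).smul contDiffAt_const
  · intro h i j
    let L : MC n →L[ℝ] ℂ := LinearMap.toContinuousLinearMap (Matrix.entryLinearMap ℝ ℂ i j)
    exact L.contDiff.contDiffAt.comp x h
open Polynomial in
lemma SmAt.aeval {f : E → MC n} {x : E} (h : SmAt f x) (e : ℂ[X]) : SmAt (fun y => Polynomial.aeval (f y) e) x := by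
  simp only [Polynomial.aeval_eq_sum_range]
  exact SmAt.sum _ fun i _ => SmAt.smul contDiffAt_const (h.pow i)
theorem PROJ {T : E → MC n} {x0 : E} (hT : ∀ᶠ y in 𝓝 x0, SmAt T y) (e : Polynomial ℂ)
    (he : Polynomial.aeval (T x0) e * Polynomial.aeval (T x0) e = Polynomial.aeval (T x0) e) :
    ∃ Q : E → MC n, Q x0 = Polynomial.aeval (T x0) e ∧ ∀ᶠ y in 𝓝 x0, SmAt Q y ∧ Q y * Q y = Q y ∧ Q y * T y = T y * Q y := by
  obtain ⟨F, hF1, hF2, hF3⟩ := SQRT (MC n)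
  let W0 : E → MC n := fun y => (2:ℂ) • Polynomial.aeval (T y) e - 1
  have hW0 : ∀ y, SmAt T y → SmAt W0 y := fun y hy =>
    SmAt.sub (SmAt.smul contDiffAt_const (hy.aeval e)) (SmAt.const 1)
  have hWx : W0 x0 * W0 x0 = 1 := by
    simp only [W0]
    rw [sub_mul, mul_sub, Matrix.smul_mul, Matrix.mul_smul, he, one_mul, mul_one]
    module
  have hZ : ContinuousAt (fun y => W0 y * W0 y) x0 := by
    have h1 := SmAt_iff.1 (hW0 x0 hT.self_of_nhds)
    exact h1.continuousAt.mul h1.continuousAt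
  have hZt : Filter.Tendsto (fun y => W0 y * W0 y) (𝓝 x0) (𝓝 1) := by
    have := hZ.tendsto; rwa [hWx] at this
  have hF1c : ContinuousAt F 1 := hF2.self_of_nhds.1.continuousAt
  have hRt : Filter.Tendsto (fun y => F (W0 y * W0 y)) (𝓝 x0) (𝓝 1) := by
    have := hF1c.tendsto.comp hZt; rwa [hF1] at this
  have hu : ∀ᶠ z in 𝓝 (1 : MC n), IsUnit z := by
    have := Units.nhds (1 : (MC n)ˣ)
    simp only [Units.val_one] at this
    exact this
  refine ⟨fun y => (2⁻¹:ℂ) • (1 + W0 y * (F (W0 y * W0 y))⁻¹), ?_, ?_⟩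
  · simp only [hWx, hF1, inv_one, mul_one, W0]
    module
  filter_upwards [hT, hZt.eventually hF2, hRt.eventually hu, hRt.eventually (sq_comm hF3)] with y hy h2 hun hcm
  obtain ⟨h2, hsq⟩ := h2
  set R := F (W0 y * W0 y) with hR
  have hdet : IsUnit R.det := (Matrix.isUnit_iff_isUnit_det R).1 hun
  have hcW : ∀ t : MC n, t * W0 y = W0 y * t → t * R = R * t := fun t ht => hcm t (by
    rw [hsq, ← mul_assoc, ht, mul_assoc, ht, mul_assoc])
  have hTW : T y * W0 y = W0 y * T y := by
    have : T y * Polynomial.aeval (T y) e = Polynomial.aeval (T y) e * T y := by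
      conv_lhs => rw [← Polynomial.aeval_X (R := ℂ) (T y), ← Polynomial.aeval_X (R := ℂ) (T y)]
      simp only [Polynomial.aeval_X]
      have h := congrArg (Polynomial.aeval (T y)) (Polynomial.X_mul (p := e))
      rwa [map_mul, map_mul, Polynomial.aeval_X] at h
    simp only [W0]
    rw [mul_sub, sub_mul, Matrix.mul_smul, Matrix.smul_mul, this, one_mul, mul_one]
  have hinv : ∀ t : MC n, t * R = R * t → t * R⁻¹ = R⁻¹ * t := fun t ht => by
    have h : R⁻¹ * (t * R) * R⁻¹ = R⁻¹ * (R * t) * R⁻¹ := by rw [ht]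
    rw [← mul_assoc R⁻¹ R, Matrix.nonsing_inv_mul R hdet, one_mul, mul_assoc, mul_assoc,
      mul_nonsing_inv R hdet, mul_one] at h
    exact h.symm
  have hWR := hinv _ (hcW (W0 y) rfl)
  have hTR := hinv _ (hcW (T y) hTW)
  have hsm : SmAt (fun y => F (W0 y * W0 y)) y := by
    have h1 := SmAt_iff.1 (hW0 y hy)
    exact SmAt_iff.2 (ContDiffAt.comp y h2 (h1.mul h1))
  have hVV : (W0 y * R⁻¹) * (W0 y * R⁻¹) = 1 := by
    rw [mul_assoc, ← mul_assoc R⁻¹, ← hWR, mul_assoc (W0 y) R⁻¹, ← mul_assoc (W0 y), ← hsq,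
      ← Matrix.mul_inv_rev, mul_nonsing_inv]
    rw [Matrix.det_mul]; exact hdet.mul hdet
  refine ⟨?_, ?_, ?_⟩
  · exact SmAt.smul contDiffAt_const (SmAt.add (SmAt.const 1) (SmAt.mul (hW0 y hy) (SmAt.inv hsm hdet.ne_zero)))
  · rw [Matrix.smul_mul, Matrix.mul_smul, mul_add, add_mul, add_mul, hVV, one_mul, mul_one, one_mul]
    module
  · rw [Matrix.smul_mul, Matrix.mul_smul, add_mul, mul_add, mul_assoc, ← hTR, ← mul_assoc, ← hTW, mul_assoc,
      one_mul, mul_one]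
end
end
section
open Polynomial
variable {n : Type*} [Fintype n] [DecidableEq n]
lemma aevalR_eig (T : MC n) (f : ℝ[X]) (ξ : ℝ) (u : n → ℂ) (h : T *ᵥ u = (ξ:ℂ) • u) :
    (aeval T f) *ᵥ u = ((f.eval ξ : ℝ) : ℂ) • u := by
  have h1 : aeval T (f.map (algebraMap ℝ ℂ)) = aeval T f := aeval_map_algebraMap ℂ T f
  rw [← h1, aeval_eig T _ _ u h]
  congr 1
  have := eval₂_at_apply (p := f) (algebraMap ℝ ℂ) ξ
  rw [← eval_map] at this
  exact this
lemma aevalR_ct (T : MC n) (f : ℝ[X]) : (aeval T f)ᴴ = aeval Tᴴ f := by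
  rw [aeval_eq_sum_range, aeval_eq_sum_range, conjTranspose_sum]
  refine Finset.sum_congr rfl fun i _ => ?_
  rw [conjTranspose_smul, conjTranspose_pow]; simp
lemma aevalR_sym {T S : MC n} (h : S * T = Tᴴ * S) (f : ℝ[X]) : S * aeval T f = (aeval T f)ᴴ * S := by
  rw [aevalR_ct, aeval_eq_sum_range, aeval_eq_sum_range, Finset.mul_sum, Finset.sum_mul]
  refine Finset.sum_congr rfl fun i hi => ?_
  rw [Matrix.mul_smul, Matrix.smul_mul]
  congr 1
  clear hi
  induction i with
  | zero => simp
  | succ i ih => rw [pow_succ, ← mul_assoc, ih, mul_assoc, h, ← mul_assoc, ← pow_succ]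
lemma aevalR_comm (T : MC n) (f g : ℝ[X]) : aeval T f * aeval T g = aeval T g * aeval T f := by
  rw [← map_mul, mul_comm, map_mul]
/-- Bezoutian form -/
def bez (s : ℕ) (r : ℝ[X]) (T w : MC n) : MC n :=
  ∑ k ∈ Finset.range (s+1), ((r.coeff k : ℝ) : ℂ) • ∑ i ∈ Finset.range k, Tᴴ ^ i * w * T ^ (k - 1 - i)
lemma bez_herm {s : ℕ} {r : ℝ[X]} {T w : MC n} (hw : wᴴ = w) : (bez s r T w)ᴴ = bez s r T w := by
  unfold bez
  rw [conjTranspose_sum]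
  refine Finset.sum_congr rfl fun k _ => ?_
  rw [conjTranspose_smul, conjTranspose_sum]
  have : star ((r.coeff k : ℝ) : ℂ) = ((r.coeff k : ℝ) : ℂ) := Complex.conj_ofReal _
  rw [this]; congr 1
  rw [← Finset.sum_range_reflect]
  refine Finset.sum_congr rfl fun i hi => ?_
  have hi := Finset.mem_range.1 hi
  rw [conjTranspose_mul, conjTranspose_mul, hw, conjTranspose_pow, conjTranspose_pow, conjTranspose_conjTranspose,
    show k - 1 - (k - 1 - i) = i by omega, mul_assoc]
lemma bez_sym {s : ℕ} {r : ℝ[X]} (hs : r.natDegree ≤ s) {T : MC n} (hT : aeval T r = 0) (w : MC n) :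
    bez s r T w * T = Tᴴ * bez s r T w := by
  rw [← sub_eq_zero, ← neg_eq_zero, neg_sub]
  have h1 : Tᴴ * bez s r T w - bez s r T w * T = (aeval Tᴴ r) * w - w * aeval T r := by
    rw [aeval_eq_sum_range' (n := s+1) (by omega), aeval_eq_sum_range' (n := s+1) (by omega)]
    unfold bez
    rw [Finset.mul_sum, Finset.sum_mul, Finset.sum_mul, Finset.mul_sum, ← Finset.sum_sub_distrib, ← Finset.sum_sub_distrib]
    refine Finset.sum_congr rfl fun k _ => ?_
    have e : ∀ M : MC n, (r.coeff k) • M = ((r.coeff k : ℝ) : ℂ) • M := fun M => (Complex.coe_smul _ M).symm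
    rw [e, e, Matrix.mul_smul, Matrix.smul_mul, Matrix.smul_mul, Matrix.mul_smul, ← smul_sub, ← smul_sub]
    congr 1
    have := Finset.sum_range_sub (fun i => Tᴴ ^ i * w * T ^ (k - i)) k
    simp only [Nat.sub_self, pow_zero, mul_one, Nat.sub_zero, one_mul] at this
    rw [← this, Finset.mul_sum, Finset.sum_mul, ← Finset.sum_sub_distrib]
    refine Finset.sum_congr rfl fun i hi => ?_
    have hi := Finset.mem_range.1 hi
    rw [pow_succ' Tᴴ, show k - (i+1) = k - 1 - i by omega, show k - i = (k - 1 - i) + 1 by omega, pow_succ T]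
    simp only [mul_assoc]
  rw [h1, hT, ← aevalR_ct, hT]; simp
lemma bez_mul_right {s : ℕ} {r : ℝ[X]} {T g : MC n} (hg : g * T = T * g) (w : MC n) :
    bez s r T (w * g) = bez s r T w * g := by
  unfold bez
  rw [Finset.sum_mul]
  refine Finset.sum_congr rfl fun k _ => ?_
  rw [Matrix.smul_mul, Finset.sum_mul]
  congr 1
  refine Finset.sum_congr rfl fun i hi => ?_
  have : g * T ^ (k - 1 - i) = T ^ (k - 1 - i) * g := (Commute.pow_right (show Commute g T from hg) _)
  simp only [mul_assoc, this]
lemma bez_mul_left {s : ℕ} {r : ℝ[X]} {T g : MC n} (hg : g * T = T * g) (w : MC n) :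
    bez s r T (gᴴ * w) = gᴴ * bez s r T w := by
  unfold bez
  rw [Finset.mul_sum]
  refine Finset.sum_congr rfl fun k _ => ?_
  rw [Matrix.mul_smul, Finset.mul_sum]
  congr 1
  refine Finset.sum_congr rfl fun i hi => ?_
  have h : gᴴ * Tᴴ = Tᴴ * gᴴ := by rw [← conjTranspose_mul, ← conjTranspose_mul, hg]
  have : gᴴ * Tᴴ ^ i = Tᴴ ^ i * gᴴ := (Commute.pow_right (show Commute gᴴ Tᴴ from h) _)
  simp only [← mul_assoc, this]
lemma bez_add {s : ℕ} {r : ℝ[X]} {T : MC n} (w w' : MC n) :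
    bez s r T (w + w') = bez s r T w + bez s r T w' := by
  simp only [bez, mul_add, add_mul, Finset.sum_add_distrib, smul_add]
lemma bez_smul {s : ℕ} {r : ℝ[X]} {T : MC n} (c : ℂ) (w : MC n) :
    bez s r T (c • w) = c • bez s r T w := by
  simp only [bez, Matrix.mul_smul, Matrix.smul_mul, ← Finset.smul_sum]
  rw [Finset.smul_sum]
  exact Finset.sum_congr rfl fun k _ => smul_comm _ _ _
lemma bez_vec {s : ℕ} {r q : ℝ[X]} (hs : r.natDegree ≤ s) {ξ : ℝ} (hr : r = (X - C ξ) * q) {T : MC n} (w : MC n)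
    {u : n → ℂ} (hu : T *ᵥ u = (ξ:ℂ) • u) : bez s r T w *ᵥ u = (aeval T q)ᴴ *ᵥ (w *ᵥ u) := by
  have hq : q = ∑ k ∈ Finset.range (s+1), C (r.coeff k) * ∑ i ∈ Finset.range k, X ^ i * C ξ ^ (k - 1 - i) := by
    refine mul_left_cancel₀ (X_sub_C_ne_zero ξ) ?_
    rw [← hr, mul_comm, Finset.sum_mul]
    have h1 : ∀ k ∈ Finset.range (s+1), C (r.coeff k) * (∑ i ∈ Finset.range k, X ^ i * C ξ ^ (k - 1 - i)) * (X - C ξ) =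
        C (r.coeff k) * X ^ k - C (r.coeff k * ξ ^ k) := fun k _ => by
      rw [mul_assoc, geom_sum₂_mul, C_mul, C_pow]; ring
    rw [Finset.sum_congr rfl h1, Finset.sum_sub_distrib, ← map_sum, ← eval_eq_sum_range' (by omega)]
    have : r.eval ξ = 0 := by rw [hr]; simp
    rw [this, C_0, sub_zero]
    conv_lhs => rw [r.as_sum_range' (s+1) (by omega)]
    simp [C_mul_X_pow_eq_monomial]
  rw [aevalR_ct]
  conv_rhs => rw [hq]
  have hpow : ∀ k : ℕ, T ^ k *ᵥ u = ((ξ ^ k : ℝ) : ℂ) • u := fun k => by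
    have := aevalR_eig T (X ^ k) ξ u hu
    simpa using this
  rw [map_sum, sum_mulVec]
  unfold bez
  rw [sum_mulVec]
  refine Finset.sum_congr rfl fun k _ => ?_
  rw [map_mul, aeval_C, map_sum, Algebra.algebraMap_eq_smul_one, Matrix.smul_mul, one_mul, ← Complex.coe_smul (r.coeff k),
    smul_mulVec, smul_mulVec, sum_mulVec, sum_mulVec]
  congr 1
  refine Finset.sum_congr rfl fun i _ => ?_
  rw [← mulVec_mulVec, hpow, mulVec_smul, ← mulVec_mulVec, ← C_pow, mul_comm, map_mul, aeval_C, map_pow (aeval Tᴴ), aeval_X,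
    Algebra.algebraMap_eq_smul_one, Matrix.smul_mul, one_mul, ← Complex.coe_smul (ξ ^ (k-1-i)), smul_mulVec]
variable {E : Type*} [NormedAddCommGroup E] [NormedSpace ℝ E]
lemma bez_smooth {s : ℕ} {r : E → ℝ[X]} {T : E → MC n} {x : E} (w : MC n) (hr : ∀ k, ContDiffAt ℝ ∞ (fun y => (r y).coeff k) x)
    (hT : SmAt T x) : SmAt (fun y => bez s (r y) (T y) w) x := by
  unfold bez
  refine SmAt.sum _ fun k _ => SmAt.smul ?_ (SmAt.sum _ fun i _ => ((hT.ct.pow i).mul (SmAt.const w)).mul (hT.pow _))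
  exact (Complex.ofRealCLM.contDiff.contDiffAt).comp x (hr k)
end
section
open Polynomial
variable {n : Type*} [Fintype n] [DecidableEq n]
structure RD (r : ℝ[X]) (ξ : ℝ) (ν : ℕ) (q e : ℝ[X]) : Prop where
  pos : 1 ≤ ν
  fac : r = (X - C ξ) ^ ν * q
  qne : q.eval ξ ≠ 0
  dq : q ∣ e
  d1 : (X - C ξ) ^ ν ∣ 1 - e
lemma RD.ex {r : ℝ[X]} (hr : r ≠ 0) {ξ : ℝ} (h : r.eval ξ = 0) : ∃ ν q e, RD r ξ ν q e := by
  obtain ⟨q, hq, hnd⟩ := exists_eq_pow_rootMultiplicity_mul_and_not_dvd r hr ξ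
  have hq0 : q.eval ξ ≠ 0 := fun h0 => hnd (dvd_iff_isRoot.2 h0)
  have hcop : IsCoprime ((X - C ξ) ^ (rootMultiplicity ξ r)) q := by
    refine IsCoprime.pow_left ?_
    exact (irreducible_X_sub_C ξ).coprime_iff_not_dvd.2 hnd
  obtain ⟨a, b, hab⟩ := hcop
  refine ⟨_, q, b * q, ?_, hq, hq0, Dvd.intro_left _ rfl, ⟨a, by rw [← hab]; ring⟩⟩
  exact (rootMultiplicity_pos hr).2 h
section
variable {r : ℝ[X]} {ξ ξ' : ℝ} {ν ν' : ℕ} {q e q' e' : ℝ[X]} {T : MC n}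
lemma aeval_dvd (hT : aeval T r = 0) {f : ℝ[X]} (h : r ∣ f) : aeval T f = 0 := by
  obtain ⟨g, rfl⟩ := h
  rw [map_mul, hT, zero_mul]
lemma RD.e1 (h : RD r ξ ν q e) : e.eval ξ = 1 := by
  obtain ⟨g, hg⟩ := h.d1
  have h1 := congrArg (eval ξ) hg
  have hν : ν ≠ 0 := by have := h.pos; omega
  simp [hν] at h1
  linarith
lemma RD.root (h : RD r ξ ν q e) : r.eval ξ = 0 := by
  have hν : ν ≠ 0 := by have := h.pos; omega
  rw [h.fac]; simp [hν]
lemma RD.e0 (h : RD r ξ ν q e) (hne : ξ' ≠ ξ) (h' : r.eval ξ' = 0) : e.eval ξ' = 0 := by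
  obtain ⟨g, hg⟩ := h.dq
  rw [h.fac, eval_mul] at h'
  rcases mul_eq_zero.1 h' with h1 | h1
  · exfalso
    rw [eval_pow] at h1
    have := eq_zero_of_pow_eq_zero h1
    simp at this
    exact hne (by linarith)
  · rw [hg, eval_mul, h1, zero_mul]
lemma RD.idem (h : RD r ξ ν q e) (hT : aeval T r = 0) : aeval T e * aeval T e = aeval T e := by
  have : aeval T (e * (1 - e)) = 0 := by
    refine aeval_dvd hT ?_
    rw [h.fac, mul_comm]
    exact mul_dvd_mul h.dq h.d1
  rw [map_mul, map_sub, map_one, mul_sub, mul_one, sub_eq_zero] at this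
  exact this.symm
lemma RD.nil (h : RD r ξ ν q e) (hT : aeval T r = 0) : aeval T ((X - C ξ) ^ ν) * aeval T e = 0 := by
  rw [← map_mul]
  refine aeval_dvd hT ?_
  conv_lhs => rw [h.fac]
  exact mul_dvd_mul_left _ h.dq
lemma RD.orth (h : RD r ξ ν q e) (h' : RD r ξ' ν' q' e') (hne : ξ ≠ ξ') (hT : aeval T r = 0) : aeval T e * aeval T e' = 0 := by
  rw [← map_mul]
  refine aeval_dvd hT ?_
  have h1 : (X - C ξ) ^ ν ∣ q' := by
    have hc : IsCoprime ((X - C ξ) ^ ν) ((X - C ξ') ^ ν') := (isCoprime_X_sub_C_of_isUnit_sub (by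
      rw [isUnit_iff_ne_zero]; exact sub_ne_zero.2 hne)).pow
    refine hc.dvd_of_dvd_mul_left ?_
    rw [← h'.fac, h.fac]; exact Dvd.intro _ rfl
  conv_lhs => rw [h.fac, mul_comm]
  exact mul_dvd_mul h.dq (h1.trans h'.dq)
lemma eigN {u : n → ℂ} : aeval T (X - C ξ : ℝ[X]) *ᵥ u = 0 ↔ T *ᵥ u = (ξ:ℂ) • u := by
  rw [map_sub, aeval_X, aeval_C, Algebra.algebraMap_eq_smul_one, sub_mulVec, sub_eq_zero, ← Complex.coe_smul, smul_mulVec, one_mulVec]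
lemma RD.ker (h : RD r ξ ν q e) (hT : aeval T r = 0)
    (hF : ∀ u, T *ᵥ u = (ξ:ℂ) • u → ∃ v, u = aeval T ((X - C ξ) ^ (ν - 1) * q) *ᵥ v) :
    ∀ j, j ≤ ν → ∀ u, aeval T e *ᵥ u = u → aeval T ((X - C ξ) ^ j) *ᵥ u = 0 →
      ∃ y, aeval T e *ᵥ y = y ∧ u = aeval T ((X - C ξ) ^ (ν - j)) *ᵥ y := by
  intro j
  induction j with
  | zero =>
    intro _ u _ hu
    refine ⟨0, by simp, ?_⟩
    simpa using hu
  | succ j ih =>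
    intro hj u hu hN
    have h1 : aeval T (X - C ξ : ℝ[X]) *ᵥ (aeval T ((X - C ξ) ^ j) *ᵥ u) = 0 := by
      rw [mulVec_mulVec, ← map_mul, ← pow_succ', hN]
    obtain ⟨v, hv⟩ := hF _ (eigN.1 h1)
    set y := aeval T (e * q) *ᵥ v with hy
    have hey : aeval T e *ᵥ y = y := by
      rw [hy, mulVec_mulVec, map_mul, ← mul_assoc, h.idem hT]
    have h2 : aeval T ((X - C ξ) ^ j) *ᵥ u = aeval T ((X - C ξ) ^ (ν - 1)) *ᵥ y := by
      rw [hy, mulVec_mulVec, ← map_mul, show (X - C ξ) ^ (ν - 1) * (e * q) = e * ((X - C ξ) ^ (ν - 1) * q) by ring, map_mul,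
        ← mulVec_mulVec, ← hv, mulVec_mulVec, aevalR_comm, ← mulVec_mulVec, hu]
    clear_value y
    set u' := u - aeval T ((X - C ξ) ^ (ν - 1 - j)) *ᵥ y with hu'
    have h3 : aeval T e *ᵥ u' = u' := by
      rw [hu', mulVec_sub, hu, mulVec_mulVec, aevalR_comm, ← mulVec_mulVec, hey]
    have h4 : aeval T ((X - C ξ) ^ j) *ᵥ u' = 0 := by
      rw [hu', mulVec_sub, h2, mulVec_mulVec, ← map_mul, ← pow_add, show j + (ν - 1 - j) = ν - 1 by omega, sub_self]
    obtain ⟨y', hy', hy'2⟩ := ih (by omega) u' h3 h4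
    refine ⟨y + aeval T (X - C ξ : ℝ[X]) *ᵥ y', ?_, ?_⟩
    · rw [mulVec_add, hey, mulVec_mulVec, aevalR_comm, ← mulVec_mulVec, hy']
    · rw [mulVec_add, mulVec_mulVec, ← map_mul, ← pow_succ, show ν - (j+1) + 1 = ν - j by omega, ← hy'2, hu',
        show ν - (j+1) = ν - 1 - j by omega]
      abel
end
structure LAD (T : MC n) (r : ℝ[X]) (R : Finset ℝ) (ν : ℝ → ℕ) (q e : ℝ → ℝ[X]) (K : ℝ → MC n) : Prop where
  ann : aeval T r = 0
  rd : ∀ ξ ∈ R, RD r ξ (ν ξ) (q ξ) (e ξ)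
  root : ∀ ξ : ℝ, r.eval ξ = 0 → ξ ∈ R
  Kh : ∀ ξ ∈ R, (K ξ)ᴴ = K ξ
  Kd : ∀ ξ ∈ R, PD (K ξ) ∨ PD (-(K ξ))
  F : ∀ ξ ∈ R, ∀ u, T *ᵥ u = (ξ:ℂ) • u → ∃ v, u = aeval T ((X - C ξ) ^ (ν ξ - 1) * q ξ) *ᵥ v
/-- weight -/
def wmat (T : MC n) (R : Finset ℝ) (e : ℝ → ℝ[X]) (K : ℝ → MC n) : MC n :=
  ∑ ξ ∈ R, (aeval T (e ξ))ᴴ * K ξ * aeval T (e ξ)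
/-- nonreal projector polynomial -/
def epol (R : Finset ℝ) (e : ℝ → ℝ[X]) : ℝ[X] := 1 - ∑ ξ ∈ R, e ξ
section
variable {T : MC n} {r : ℝ[X]} {R : Finset ℝ} {ν : ℝ → ℕ} {q e : ℝ → ℝ[X]} {K : ℝ → MC n}
lemma LAD.wherm (h : LAD T r R ν q e K) : (wmat T R e K)ᴴ = wmat T R e K := by
  unfold wmat
  rw [conjTranspose_sum]
  refine Finset.sum_congr rfl fun ξ hξ => ?_
  simp [conjTranspose_mul, h.Kh ξ hξ, mul_assoc]
lemma LAD.eig (h : LAD T r R ν q e K) {ξ : ℝ} (hξ : ξ ∈ R) {u : n → ℂ} (hu : T *ᵥ u = (ξ:ℂ) • u) {η : ℝ} (hη : η ∈ R) :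
    aeval T (e η) *ᵥ u = if η = ξ then u else 0 := by
  rw [aevalR_eig T _ ξ u hu]
  split_ifs with hc
  · subst hc; rw [(h.rd η hη).e1]; simp
  · rw [(h.rd η hη).e0 (Ne.symm hc) (h.rd ξ hξ).root]; simp
lemma LAD.wvec (h : LAD T r R ν q e K) {ξ : ℝ} (hξ : ξ ∈ R) {u u' : n → ℂ} (hu : T *ᵥ u = (ξ:ℂ) • u) (hu' : T *ᵥ u' = (ξ:ℂ) • u') :
    star u' ⬝ᵥ (wmat T R e K *ᵥ u) = star u' ⬝ᵥ (K ξ *ᵥ u) := by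
  unfold wmat
  rw [sum_mulVec, dotProduct_sum, Finset.sum_eq_single ξ]
  · rw [← mulVec_mulVec, h.eig hξ hu hξ, ← mulVec_mulVec, star_dot_mulVec, conjTranspose_conjTranspose, h.eig hξ hu' hξ]; simp
  · intro η hη hne
    rw [← mulVec_mulVec, h.eig hξ hu hη, if_neg hne]; simp
  · intro h'; exact absurd hξ h'
lemma LAD.es_idem (h : LAD T r R ν q e K) : aeval T (epol R e) * aeval T (epol R e) = aeval T (epol R e) := by
  have h1 : (∑ ξ ∈ R, aeval T (e ξ)) * (∑ ξ ∈ R, aeval T (e ξ)) = ∑ ξ ∈ R, aeval T (e ξ) := by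
    rw [Finset.sum_mul]
    refine Finset.sum_congr rfl fun ξ hξ => ?_
    rw [Finset.mul_sum, Finset.sum_eq_single ξ]
    · exact (h.rd ξ hξ).idem h.ann
    · intro η hη hne
      exact (h.rd ξ hξ).orth (h.rd η hη) hne.symm h.ann
    · intro h'; exact absurd hξ h'
  rw [epol, map_sub, map_one, map_sum, mul_sub, sub_mul, sub_mul, h1]; simp
lemma LAD.es_orth (h : LAD T r R ν q e K) {ξ : ℝ} (hξ : ξ ∈ R) : aeval T (e ξ) * aeval T (epol R e) = 0 := by
  rw [epol, map_sub, map_one, map_sum, mul_sub, mul_one, Finset.mul_sum, Finset.sum_eq_single ξ, (h.rd ξ hξ).idem h.ann, sub_self]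
  · intro η hη hne
    exact (h.rd ξ hξ).orth (h.rd η hη) hne.symm h.ann
  · intro h'; exact absurd hξ h'
lemma LAD.es_noimag (h : LAD T r R ν q e K) (μ : ℂ) (v : n → ℂ) (hv : v ≠ 0)
    (hμ : (I • (T * aeval T (epol R e)) + (1 - aeval T (epol R e))) *ᵥ v = μ • v) : μ.re ≠ 0 := by
  intro h0
  set Q := aeval T (epol R e) with hQ
  have hQQ : Q * Q = Q := h.es_idem
  have hQT : Q * T = T * Q := by
    have := aevalR_comm T (epol R e) X
    simpa using this
  have h1 : (1 - Q) *ᵥ v = μ • ((1 - Q) *ᵥ v) := by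
    rw [← mulVec_smul, ← hμ, mulVec_mulVec]
    congr 1
    rw [mul_add, Matrix.mul_smul, ← hQT, ← mul_assoc, sub_mul, sub_mul, mul_sub, hQQ]; simp [sub_mul, hQQ]
  have hμ1 : μ ≠ 1 := by rintro rfl; simp at h0
  have h2 : (1 - Q) *ᵥ v = 0 := by
    have : (1 - μ) • ((1 - Q) *ᵥ v) = 0 := by rw [sub_smul, one_smul, ← h1, sub_self]
    rcases smul_eq_zero.1 this with h3 | h3
    · exact absurd (sub_eq_zero.1 h3).symm hμ1
    · exact h3
  have hQv : Q *ᵥ v = v := by rw [sub_mulVec, one_mulVec, sub_eq_zero] at h2; exact h2.symm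
  have hTv : T *ᵥ v = ((μ.im : ℝ) : ℂ) • v := by
    rw [add_mulVec, h2, add_zero, smul_mulVec, ← mulVec_mulVec, hQv] at hμ
    have h3 : μ = I * (μ.im : ℂ) := by apply Complex.ext <;> simp [h0]
    have h4 := congrArg (fun z => (-I) • z) hμ
    simp only [smul_smul] at h4
    rw [show -I * I = 1 by simp, one_smul, h3] at h4
    rw [h4]; congr 1
    rw [← mul_assoc]; simp
  have h5 : r.eval μ.im = 0 := by
    have := aevalR_eig T r _ v hTv
    rw [h.ann, zero_mulVec] at this
    rcases smul_eq_zero.1 this.symm with h6 | h6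
    · exact_mod_cast h6
    · exact absurd h6 hv
  have hm := h.root _ h5
  have h6 := h.eig hm hTv hm
  rw [if_pos rfl] at h6
  apply hv
  rw [← h6, ← hQv, mulVec_mulVec, h.es_orth hm, zero_mulVec]
lemma LAD.form (h : LAD T r R ν q e K) {s : ℕ} (hs : r.natDegree ≤ s) {ξ : ℝ} (hξ : ξ ∈ R) {y : n → ℂ} (hy : aeval T (e ξ) *ᵥ y = y) :
    rq (bez s r T (wmat T R e K) * aeval T ((X - C ξ) ^ (ν ξ - 1))) y =
      (q ξ).eval ξ * rq (K ξ) (aeval T ((X - C ξ) ^ (ν ξ - 1)) *ᵥ y) := by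
  have hd := h.rd ξ hξ
  have hp := hd.pos
  set u := aeval T ((X - C ξ) ^ (ν ξ - 1)) *ᵥ y with hu
  have hTu : T *ᵥ u = (ξ:ℂ) • u := by
    rw [← eigN, hu, mulVec_mulVec, ← map_mul, ← pow_succ', show ν ξ - 1 + 1 = ν ξ by omega, ← hy, mulVec_mulVec, hd.nil h.ann,
      zero_mulVec]
  have hr : r = (X - C ξ) * ((X - C ξ) ^ (ν ξ - 1) * q ξ) := by
    rw [← mul_assoc, ← pow_succ', show ν ξ - 1 + 1 = ν ξ by omega]; exact hd.fac
  unfold rq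
  rw [← mulVec_mulVec, ← hu, bez_vec hs hr _ hTu, star_dot_mulVec, conjTranspose_conjTranspose, mul_comm _ (q ξ), map_mul,
    ← mulVec_mulVec, ← hu, aevalR_eig T _ ξ u hTu, star_smul, smul_dotProduct, h.wvec hξ hTu hTu]
  simp
end
end
section
open Polynomial
variable {n : Type*} [Fintype n] [DecidableEq n]
lemma GDLv (C : Set (MC n)) (hC : Convex ℝ C) (hn : C.Nonempty) :
    (∃ X ∈ C, PD X) ∨ ∃ z : n → n → ℂ, (∃ k, z k ≠ 0) ∧ ∀ X ∈ C, ∑ k, rq X (z k) ≤ 0 := by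
  rcases GDL C hC hn with h | ⟨Z, hZ0, hZ, hpsd, hle⟩
  · exact Or.inl h
  right
  obtain ⟨U, d, hU1, hU2, hd, hZd⟩ := herm_psd_spec Z hZ hpsd
  set V := U * diagonal (fun i => ((Real.sqrt (d i) : ℝ) : ℂ)) with hV
  have hVZ : V * Vᴴ = Z := by
    rw [hV, hZd, conjTranspose_mul, diagonal_conjTranspose, ← mul_assoc, mul_assoc U, diagonal_mul_diagonal]
    congr 3
    ext i
    simp only [Pi.star_apply, RCLike.star_def, Complex.conj_ofReal]
    rw [← Complex.ofReal_mul, Real.mul_self_sqrt (hd i)]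
  refine ⟨fun k i => V i k, ?_, fun X hX => ?_⟩
  · by_contra hcon
    push Not at hcon
    apply hZ0
    rw [← hVZ, show V = 0 from by ext i k; exact congrFun (hcon k) i]; simp
  · rw [← tr_factor, hVZ]; exact hle X hX
lemma lin_le {α β : ℝ} (h : ∀ t : ℝ, 0 ≤ t → t * α + β ≤ 0) : α ≤ 0 := by
  by_contra hc
  push Not at hc
  have := h ((|β| + 1) / α) (by positivity)
  rw [div_mul_cancel₀ _ hc.ne'] at this
  linarith [neg_abs_le β]
lemma PD_sum_zero {K : MC n} (hK : PD K) {z : n → n → ℂ} (h : ∑ k, rq K (z k) ≤ 0) (k : n) : z k = 0 := by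
  by_contra hc
  have h1 : ∀ k, 0 ≤ rq K (z k) := fun k => hK.nonneg _
  have := Finset.single_le_sum (fun k _ => h1 k) (Finset.mem_univ k)
  linarith [hK _ hc]
section
variable {T : MC n} {r : ℝ[X]} {R : Finset ℝ} {ν : ℝ → ℕ} {q e : ℝ → ℝ[X]} {K : ℝ → MC n}
/-- weight matrix -/
def mm (T : MC n) (R : Finset ℝ) (e : ℝ → ℝ[X]) (ex : ℝ → ℕ) (D : MC n) : MC n :=
  ∑ ξ ∈ R, aeval T ((X - C ξ) ^ ex ξ) * aeval T (e ξ) + D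
lemma LAD.formz (h : LAD T r R ν q e K) {s : ℕ} (hs : r.natDegree ≤ s) {ξ : ℝ} (hξ : ξ ∈ R) {j : ℕ} (hj : 2 * j + 1 ≤ ν ξ) {z : n → ℂ}
    (hz : aeval T ((X - C ξ) ^ (ν ξ - j)) *ᵥ (aeval T (e ξ) *ᵥ z) = 0) :
    rq (bez s r T (wmat T R e K) * aeval T (e ξ * (X - C ξ) ^ (ν ξ - 1 - 2 * j))) z =
      (q ξ).eval ξ * rq (K ξ) (aeval T ((X - C ξ) ^ (ν ξ - 1 - j)) *ᵥ (aeval T (e ξ) *ᵥ z)) := by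
  have hd := h.rd ξ hξ
  set S := bez s r T (wmat T R e K) with hS
  have hsym := aevalR_sym (bez_sym hs h.ann (wmat T R e K))
  rw [← hS] at hsym
  have hid := hd.idem h.ann
  have e1 : S * aeval T (e ξ * (X - C ξ) ^ (ν ξ - 1 - 2 * j)) =
      (aeval T (e ξ))ᴴ * (S * aeval T ((X - C ξ) ^ (ν ξ - 1 - 2 * j))) * aeval T (e ξ) := by
    rw [← mul_assoc, ← hsym, map_mul]
    conv_lhs => rw [← hid]
    simp only [mul_assoc]
    rw [aevalR_comm T _ (e ξ)]
  rw [e1, rq_conj]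
  obtain ⟨y, hy, hu⟩ := hd.ker h.ann (h.F ξ hξ) (ν ξ - j) (by omega) (aeval T (e ξ) *ᵥ z) (by rw [mulVec_mulVec, hid]) hz
  rw [hu, ← rq_conj, ← mul_assoc, ← hsym, mul_assoc, mul_assoc, ← map_mul, ← map_mul, ← pow_add, ← pow_add, mulVec_mulVec, ← map_mul,
    ← pow_add, show ν ξ - (ν ξ - j) + (ν ξ - 1 - 2 * j + (ν ξ - (ν ξ - j))) = ν ξ - 1 by omega,
    show ν ξ - 1 - j + (ν ξ - (ν ξ - j)) = ν ξ - 1 by omega]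
  exact h.form hs hξ hy
theorem LAD.dual (h : LAD T r R ν q e K) {s : ℕ} (hs : r.natDegree ≤ s) {σ : ℝ} (hσ : σ ≠ 0) {D K' : MC n} (hK' : PD K') {ex : ℝ → ℕ}
    (hex : ∀ ξ ∈ R, ex ξ ≤ ν ξ ∧ ∀ j < ν ξ - ex ξ, 2 * j + 1 ≤ ν ξ ∧ (2 * j + 1 = ν ξ → PD (((σ * (q ξ).eval ξ : ℝ) : ℂ) • K ξ)))
    (L : ℝ) {ε : ℝ} (hε : 0 < ε) :
    ∃ g : ℝ[X], (∀ ξ ∈ R, 0 < g.eval ξ) ∧ ∃ a : ℝ, 0 < a ∧ PD ((σ:ℂ) • (bez s r T (wmat T R e K) * aeval T g) + (a:ℂ) • (Dᴴ * K' * D)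
      - (L:ℂ) • ((mm T R e ex D)ᴴ * mm T R e ex D) + (ε:ℂ) • 1) := by
  set S := bez s r T (wmat T R e K) with hS
  set W := mm T R e ex D with hW
  let fX : ℝ[X] → ℝ → MC n := fun p a => (σ:ℂ) • (S * aeval T p) + (a:ℂ) • (Dᴴ * K' * D) - (L:ℂ) • (Wᴴ * W) + (ε:ℂ) • 1
  have hfX : ∀ p a v, rq (fX p a) v = σ * rq (S * aeval T p) v + a * rq K' (D *ᵥ v) - L * nq (W *ᵥ v) + ε * nq v := by
    intro p a v
    simp only [fX, rq_add, rq_sub, rq_smul, rq_conj, rq_ctmul, rq_one]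
  set CC : Set (MC n) := {Y | ∃ p : ℝ[X], (∀ ξ ∈ R, 0 ≤ p.eval ξ) ∧ ∃ a : ℝ, 0 ≤ a ∧ Y = fX p a} with hCC
  have hconv : Convex ℝ CC := by
    rintro _ ⟨p, hp, a, ha, rfl⟩ _ ⟨p', hp', a', ha', rfl⟩ x y hx hy hxy
    refine ⟨C x * p + C y * p', fun ξ hξ => ?_, x * a + y * a', by positivity, ?_⟩
    · have := hp ξ hξ; have := hp' ξ hξ
      simp; positivity
    · have hy' : y = 1 - x := by linarith
      subst hy'
      simp only [fX, map_add, map_mul, aeval_C, Algebra.algebraMap_eq_smul_one, mul_add, Matrix.smul_mul, one_mul, Matrix.mul_smul, ← Complex.coe_smul]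
      push_cast
      module
  rcases GDLv CC hconv ⟨_, 0, by simp, 0, le_rfl, rfl⟩ with ⟨_, ⟨p, hp, a, ha, rfl⟩, hPD⟩ | ⟨z, ⟨k0, hk0⟩, hz⟩
  · obtain ⟨δ, hδ, hh⟩ := hPD.sub_small ((σ:ℂ) • S + Dᴴ * K' * D)
    refine ⟨p + C δ, fun ξ hξ => ?_, a + δ, by positivity, ?_⟩
    · have := hp ξ hξ
      simp; positivity
    · have := hh δ (by rw [abs_of_pos hδ])
      convert this using 1
      simp only [fX, map_add, aeval_C, Algebra.algebraMap_eq_smul_one, mul_add, Matrix.mul_smul, mul_one, ← Complex.coe_smul]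
      push_cast
      module
  exfalso
  have key : ∀ p : ℝ[X], (∀ ξ ∈ R, 0 ≤ p.eval ξ) → ∀ a : ℝ, 0 ≤ a →
      σ * ∑ k, rq (S * aeval T p) (z k) + a * ∑ k, rq K' (D *ᵥ z k) + (- L * ∑ k, nq (W *ᵥ z k) + ε * ∑ k, nq (z k)) ≤ 0 := by
    intro p hp a ha
    have := hz _ ⟨p, hp, a, ha, rfl⟩
    simp only [hfX, Finset.sum_add_distrib, Finset.sum_sub_distrib, ← Finset.mul_sum] at this
    linarith
  have k1 : ∀ p : ℝ[X], (∀ ξ ∈ R, 0 ≤ p.eval ξ) → σ * ∑ k, rq (S * aeval T p) (z k) ≤ 0 := by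
    intro p hp
    refine lin_le (β := - L * ∑ k, nq (W *ᵥ z k) + ε * ∑ k, nq (z k)) fun t ht => ?_
    have := key (C t * p) (fun ξ hξ => by have := hp ξ hξ; simp; positivity) 0 le_rfl
    simp only [map_mul, aeval_C, Algebra.algebraMap_eq_smul_one, Matrix.smul_mul, one_mul, Matrix.mul_smul, rq_rsmul, ← Finset.mul_sum] at this
    linarith
  have k2 : ∀ k, D *ᵥ z k = 0 := by
    refine fun k => PD_sum_zero (z := fun k => D *ᵥ z k) hK' ?_ k
    refine lin_le (β := - L * ∑ k, nq (W *ᵥ z k) + ε * ∑ k, nq (z k)) fun t ht => ?_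
    have := key 0 (by simp) t ht
    simpa [rq_zero] using this
  have chain : ∀ ξ ∈ R, ∀ j, j ≤ ν ξ - ex ξ → ∀ k, aeval T ((X - C ξ) ^ (ν ξ - j)) *ᵥ (aeval T (e ξ) *ᵥ z k) = 0 := by
    intro ξ hξ j
    have hd := h.rd ξ hξ
    induction j with
    | zero =>
      intro _ k
      rw [Nat.sub_zero, mulVec_mulVec, hd.nil h.ann, zero_mulVec]
    | succ j ih =>
      intro hj
      have ih := ih (by omega)
      obtain ⟨h1, h2⟩ := (hex ξ hξ).2 j (by omega)
      have hf : ∀ k, _ := fun k => h.formz hs hξ h1 (ih k)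
      rw [← hS] at hf
      set u : n → n → ℂ := fun k => aeval T ((X - C ξ) ^ (ν ξ - 1 - j)) *ᵥ (aeval T (e ξ) *ᵥ z k) with hu
      have hsum : σ * ∑ k, rq (S * aeval T (e ξ * (X - C ξ) ^ (ν ξ - 1 - 2 * j))) (z k) = ∑ k, rq (((σ * (q ξ).eval ξ : ℝ) : ℂ) • K ξ) (u k) := by
        simp only [hf, rq_smul, ← Finset.mul_sum]
        simp only [hu, mul_assoc]
      have hev : ∀ η ∈ R, 0 ≤ (e ξ * (X - C ξ) ^ (ν ξ - 1 - 2 * j)).eval η := by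
        intro η hη
        by_cases hc : η = ξ
        · subst hc
          simp only [eval_mul, eval_pow, eval_sub, eval_X, eval_C, sub_self, hd.e1, one_mul]
          positivity
        · rw [eval_mul, hd.e0 hc (h.rd η hη).root, zero_mul]
      have hle := k1 _ hev
      rw [hsum] at hle
      have hgoal : ∀ k, u k = 0 := by
        by_cases hp : PD (((σ * (q ξ).eval ξ : ℝ) : ℂ) • K ξ)
        · exact PD_sum_zero hp hle
        · have ht : ν ξ - 1 - 2 * j ≠ 0 := fun h0 => hp (h2 (by omega))
          have hev' : ∀ η ∈ R, 0 ≤ (-(e ξ * (X - C ξ) ^ (ν ξ - 1 - 2 * j))).eval η := by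
            intro η hη
            by_cases hc : η = ξ
            · subst hc; simp [ht]
            · rw [eval_neg, eval_mul, hd.e0 hc (h.rd η hη).root, zero_mul, neg_zero]
          have hle' := k1 _ hev'
          have e5 : ∑ k, rq (S * aeval T (-(e ξ * (X - C ξ) ^ (ν ξ - 1 - 2 * j)))) (z k) = - ∑ k, rq (S * aeval T (e ξ * (X - C ξ) ^ (ν ξ - 1 - 2 * j))) (z k) := by
            rw [map_neg, mul_neg]; simp only [rq_neg, Finset.sum_neg_distrib]
          rw [e5, mul_neg, hsum] at hle'
          have hc0 : σ * (q ξ).eval ξ ≠ 0 := mul_ne_zero hσ hd.qne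
          have hp' : PD (-(((σ * (q ξ).eval ξ : ℝ) : ℂ) • K ξ)) := by
            rcases h.Kd ξ hξ with hK | hK <;> rcases lt_or_gt_of_ne hc0 with hl | hl
            · intro v hv
              rw [rq_neg, rq_smul]; nlinarith [hK v hv]
            · exact absurd (fun v hv => by rw [rq_smul]; exact mul_pos hl (hK v hv)) hp
            · refine absurd (fun v hv => ?_) hp
              have := hK v hv
              rw [rq_neg] at this
              rw [rq_smul]; nlinarith
            · intro v hv
              have := hK v hv
              rw [rq_neg] at this
              rw [rq_neg, rq_smul]; nlinarith
          refine PD_sum_zero hp' ?_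
          simp only [rq_neg, Finset.sum_neg_distrib]
          exact hle'
      intro k
      rw [show ν ξ - (j + 1) = ν ξ - 1 - j by omega]
      exact hgoal k
  have hWz : ∀ k, W *ᵥ z k = 0 := by
    intro k
    rw [hW, mm, add_mulVec, k2, add_zero, sum_mulVec]
    refine Finset.sum_eq_zero fun ξ hξ => ?_
    have := chain ξ hξ _ le_rfl k
    rw [show ν ξ - (ν ξ - ex ξ) = ex ξ by have := (hex ξ hξ).1; omega] at this
    rw [← mulVec_mulVec, this]
  have := key 0 (by simp) 0 le_rfl
  have h8 : ∑ k, nq (W *ᵥ z k) = 0 := Finset.sum_eq_zero fun k _ => by rw [hWz, nq_eq_zero]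
  rw [h8] at this
  have h9 : 0 < ∑ k, nq (z k) := Finset.sum_pos' (fun k _ => nq_nonneg _) ⟨k0, Finset.mem_univ _, nq_pos hk0⟩
  simp [rq_zero] at this
  nlinarith
end
end
section
open Polynomial
variable {n : Type*} [Fintype n] [DecidableEq n]
section
variable {T : MC n} {r : ℝ[X]} {R : Finset ℝ} {ν : ℝ → ℕ} {q e : ℝ → ℝ[X]} {K : ℝ → MC n}
lemma mm_pi (h : LAD T r R ν q e K) {ex : ℝ → ℕ} {P : MC n} (hP : ∀ f : ℝ[X], P * aeval T f = aeval T f * P) {ξ : ℝ} (hξ : ξ ∈ R) :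
    aeval T (e ξ) * mm T R e ex (P * aeval T (epol R e)) = aeval T ((X - C ξ) ^ ex ξ) * aeval T (e ξ) := by
  rw [mm, mul_add, hP, ← mul_assoc, h.es_orth hξ, zero_mul, add_zero, Finset.mul_sum, Finset.sum_eq_single ξ]
  · rw [← mul_assoc, aevalR_comm, mul_assoc, (h.rd ξ hξ).idem h.ann]
  · intro η hη hne
    rw [← mul_assoc, aevalR_comm, mul_assoc, (h.rd ξ hξ).orth (h.rd η hη) hne.symm h.ann, mul_zero]
  · intro h'; exact absurd hξ h'
lemma mm_s (h : LAD T r R ν q e K) {ex : ℝ → ℕ} {P : MC n} (hP : ∀ f : ℝ[X], P * aeval T f = aeval T f * P) :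
    aeval T (epol R e) * mm T R e ex (P * aeval T (epol R e)) = P * aeval T (epol R e) := by
  rw [mm, mul_add, hP, ← mul_assoc, h.es_idem, Finset.mul_sum, Finset.sum_eq_zero, zero_add]
  intro ξ hξ
  rw [aevalR_comm T ((X - C ξ) ^ ex ξ), ← mul_assoc, aevalR_comm T (epol R e), h.es_orth hξ, zero_mul]
lemma mm_comm (h : LAD T r R ν q e K) {ex : ℝ → ℕ} {P : MC n} (hP : ∀ f : ℝ[X], P * aeval T f = aeval T f * P) (f : ℝ[X]) :
    mm T R e ex (P * aeval T (epol R e)) * aeval T f = aeval T f * mm T R e ex (P * aeval T (epol R e)) := by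
  rw [mm, mul_add, add_mul, Finset.sum_mul, Finset.mul_sum, mul_assoc P, aevalR_comm T _ f, ← mul_assoc, hP, mul_assoc _ P]
  congr 1
  refine Finset.sum_congr rfl fun ξ _ => ?_
  rw [← map_mul, aevalR_comm]
lemma LAD.kercont (h : LAD T r R ν q e K) {ex ex' : ℝ → ℕ} (hex : ∀ ξ ∈ R, ex ξ + ex' ξ = ν ξ) {P : MC n}
    (hP : ∀ f : ℝ[X], P * aeval T f = aeval T f * P) {z : n → ℂ} (hz : mm T R e ex (P * aeval T (epol R e)) *ᵥ z = 0) :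
    ∃ y, z = mm T R e ex' ((1 - P) * aeval T (epol R e)) *ᵥ y := by
  have hP' : ∀ f : ℝ[X], (1 - P) * aeval T f = aeval T f * (1 - P) := fun f => by rw [sub_mul, mul_sub, hP]; simp
  have h1 : ∀ ξ ∈ R, ∃ y, aeval T (e ξ) *ᵥ y = y ∧ aeval T (e ξ) *ᵥ z = aeval T ((X - C ξ) ^ ex' ξ) *ᵥ y := by
    intro ξ hξ
    have hd := h.rd ξ hξ
    have he := hex ξ hξ
    have := hd.ker h.ann (h.F ξ hξ) (ex ξ) (by omega) (aeval T (e ξ) *ᵥ z) (by rw [mulVec_mulVec, hd.idem h.ann])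
      (by rw [mulVec_mulVec, ← mm_pi h hP hξ, ← mulVec_mulVec, hz, Matrix.mulVec_zero])
    rwa [show ν ξ - ex ξ = ex' ξ by omega] at this
  choose! y hy1 hy2 using h1
  have hs : P *ᵥ (aeval T (epol R e) *ᵥ z) = 0 := by
    rw [mulVec_mulVec, ← mm_s (ex := ex) h hP, ← mulVec_mulVec, hz, Matrix.mulVec_zero]
  refine ⟨∑ ξ ∈ R, y ξ + aeval T (epol R e) *ᵥ z, ?_⟩
  rw [mulVec_add, Matrix.mulVec_sum]
  have e1 : ∀ ξ ∈ R, mm T R e ex' ((1 - P) * aeval T (epol R e)) *ᵥ y ξ = aeval T (e ξ) *ᵥ z := by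
    intro ξ hξ
    rw [← hy1 ξ hξ, mulVec_mulVec, mm_comm h hP', mm_pi h hP' hξ, ← mulVec_mulVec, hy1 ξ hξ, hy2 ξ hξ]
  have e2 : mm T R e ex' ((1 - P) * aeval T (epol R e)) *ᵥ (aeval T (epol R e) *ᵥ z) = aeval T (epol R e) *ᵥ z := by
    rw [mulVec_mulVec, mm_comm h hP', mm_s h hP', ← mulVec_mulVec, sub_mulVec, hs, sub_zero, one_mulVec]
  rw [e2, Finset.sum_congr rfl e1, ← sum_mulVec, ← add_mulVec, epol, map_sub, map_one, map_sum]
  simp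
end
end
section
variable {n : Type*} [Fintype n] [DecidableEq n]
variable {E : Type*} [NormedAddCommGroup E] [NormedSpace ℝ E]
lemma contDiffAt_ofReal {f : E → ℝ} {x : E} (h : ContDiffAt ℝ ∞ f x) : ContDiffAt ℝ ∞ (fun y => ((f y : ℝ) : ℂ)) x :=
  Complex.ofRealCLM.contDiff.contDiffAt.comp x h
lemma HYP {x0 : E} {S0 T Γ J : E → MC n} {γ ρ : E → ℝ} (hS : SmAt S0 x0) (hT : SmAt T x0) (hΓ : SmAt Γ x0) (hJ : SmAt J x0)
    (hγ : ContDiffAt ℝ ∞ γ x0) (hρ : ContDiffAt ℝ ∞ ρ x0) (γ0 : γ x0 = 0) (ρ0 : ρ x0 = 0)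
    (hpos : ∀ᶠ x in 𝓝 x0, ∀ v, 0 ≤ rq (S0 x * (I • T x)) v)
    (h1 : ∀ (ξ : ℝ) u, u ≠ 0 → T x0 *ᵥ u = (ξ:ℂ) • u → 0 < rq (S0 x0 * Γ x0) u)
    (h2 : ∀ (ξ : ℝ) u, u ≠ 0 → T x0 *ᵥ u = (ξ:ℂ) • u → 0 < rq (S0 x0 * J x0) u) :
    ∃ K1 K2 : MC n, K1ᴴ = K1 ∧ K2ᴴ = K2 ∧ ∃ c > 0, ∀ᶠ x in 𝓝 x0, 0 ≤ γ x → 0 ≤ ρ x → ∀ v,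
      c * (γ x + ρ x) * nq v ≤ rq ((S0 x + (γ x : ℂ) • K1 + (ρ x : ℂ) • K2) * (I • T x + (γ x : ℂ) • Γ x + (ρ x : ℂ) • J x)) v := by
  obtain ⟨K1, hK1, hp1⟩ := DL _ _ h1
  obtain ⟨K2, hK2, hp2⟩ := DL _ _ h2
  refine ⟨K1, K2, hK1, hK2, ?_⟩
  have hH : SmAt (fun x => I • T x + (γ x : ℂ) • Γ x + (ρ x : ℂ) • J x) x0 :=
    ((SmAt.smul contDiffAt_const hT).add (SmAt.smul (contDiffAt_ofReal hγ) hΓ)).add (SmAt.smul (contDiffAt_ofReal hρ) hJ)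
  have hM1 := (hS.mul hΓ).add ((SmAt.const K1).mul hH)
  have hM2 := (hS.mul hJ).add ((SmAt.const K2).mul hH)
  obtain ⟨c1, hc1, b1⟩ := PD.near' hM1.cont (by simpa [γ0, ρ0] using hp1)
  obtain ⟨c2, hc2, b2⟩ := PD.near' hM2.cont (by simpa [γ0, ρ0] using hp2)
  refine ⟨min c1 c2, lt_min hc1 hc2, ?_⟩
  filter_upwards [b1, b2, hpos] with x b1 b2 hpos hg hr v
  have e : (S0 x + (γ x : ℂ) • K1 + (ρ x : ℂ) • K2) * (I • T x + (γ x : ℂ) • Γ x + (ρ x : ℂ) • J x)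
    = S0 x * (I • T x) + (γ x : ℂ) • (S0 x * Γ x + K1 * (I • T x + (γ x : ℂ) • Γ x + (ρ x : ℂ) • J x))
      + (ρ x : ℂ) • (S0 x * J x + K2 * (I • T x + (γ x : ℂ) • Γ x + (ρ x : ℂ) • J x)) := by
    simp only [add_mul, mul_add, Matrix.smul_mul, Matrix.mul_smul, smul_add]
    module
  rw [e, rq_add, rq_add, rq_smul, rq_smul]
  have i1 := mul_le_mul_of_nonneg_left (b1 v) hg
  have i2 := mul_le_mul_of_nonneg_left (b2 v) hr
  have i3 := hpos v
  have i4 : γ x * (min c1 c2 * nq v) ≤ γ x * (c1 * nq v) := by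
    gcongr
    · exact nq_nonneg v
    · exact min_le_left _ _
  have i5 : ρ x * (min c1 c2 * nq v) ≤ ρ x * (c2 * nq v) := by
    gcongr
    · exact nq_nonneg v
    · exact min_le_right _ _
  linarith
lemma nq_elim (v w : n → ℂ) : nq (Sum.elim v w) = nq v + nq w := by
  simp [nq, Fintype.sum_sum_type]
lemma rq_blocks (a b c d : MC n) (ρ : ℝ) (v w : n → ℂ) :
    rq (fromBlocks ((ρ:ℂ) • a) ((ρ^2 : ℝ) • b) ((ρ^2 : ℝ) • c) d) (Sum.elim v w) =
      ρ * rq a v + rq d w + ρ * rq (fromBlocks 0 b c 0) (Sum.elim ((ρ:ℂ) • v) w) := by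
  have hst : ∀ v w : n → ℂ, star (Sum.elim v w) = Sum.elim (star v) (star w) := by
    intro v w; ext i; cases i <;> rfl
  simp only [rq, fromBlocks_mulVec, Sum.elim_comp_inl, Sum.elim_comp_inr, hst, sumElim_dotProduct_sumElim, dotProduct_add, smul_mulVec,
    dotProduct_smul, zero_mulVec, mulVec_smul, star_smul, smul_dotProduct, Complex.add_re, dotProduct_zero, smul_eq_mul,
    Complex.smul_re, Complex.re_ofReal_mul, RCLike.star_def, Complex.conj_ofReal, Complex.zero_re, add_zero, zero_add]
  ring
lemma rq_diag (a d : MC n) (v w : n → ℂ) : rq (fromBlocks a 0 0 d) (Sum.elim v w) = rq a v + rq d w := by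
  have := rq_blocks a 0 0 d 1 v w
  simpa [rq_zero] using this
lemma PD_ctmul {X : MC n} (h : X.det ≠ 0) : PD (Xᴴ * X) := by
  intro v hv
  rw [rq_ctmul]
  exact nq_pos fun h0 => hv (Matrix.eq_zero_of_mulVec_eq_zero h h0)
lemma BLK {x0 : E} {SH H F12 F21 F22 : E → MC n} {X G : E → Matrix (n ⊕ n) (n ⊕ n) ℂ} {SP : MC n} {γ ρ : E → ℝ}
    (hSH : SmAt SH x0) (h12 : SmAt F12 x0) (h21 : SmAt F21 x0) (h22 : SmAt F22 x0) (hX : SmAt X x0)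
    (hγ : ContDiffAt ℝ ∞ γ x0) (hρ : ContDiffAt ℝ ∞ ρ x0) (γ0 : γ x0 = 0) (ρ0 : ρ x0 = 0)
    (hH : ∃ c > 0, ∀ᶠ x in 𝓝 x0, 0 ≤ γ x → 0 ≤ ρ x → ∀ v, c * (γ x + ρ x) * nq v ≤ rq (SH x * H x) v)
    (hSP : PD (SP * F22 x0)) (hdet : (X x0).det ≠ 0)
    (hG : ∀ᶠ x in 𝓝 x0, X x * G x = fromBlocks ((ρ x : ℂ) • H x) ((ρ x ^ 2 : ℝ) • F12 x) ((ρ x ^ 2 : ℝ) • F21 x) (F22 x) * X x) :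
    ∃ c > 0, ∀ᶠ x in 𝓝 x0, 0 ≤ γ x → 0 ≤ ρ x → ∀ U,
      c * ρ x * (γ x + ρ x) * nq U ≤ rq ((X x)ᴴ * fromBlocks (SH x) 0 0 SP * X x * G x) U := by
  obtain ⟨c, hc, hH⟩ := hH
  obtain ⟨c', hc', h22'⟩ := PD.near' ((SmAt.const SP).mul h22).cont hSP
  obtain ⟨c3, hc3, hX3⟩ := PD.near' (hX.ct.mul hX).cont (PD_ctmul hdet)
  set δ := min c c' / 2 with hδ
  have hδ0 : 0 < δ := by positivity
  have hN : SmAt (fun x => fromBlocks 0 (SH x * F12 x) (SP * F21 x) 0) x0 :=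
    SmAt.fromBlocks (SmAt.const 0) (hSH.mul h12) ((SmAt.const SP).mul h21) (SmAt.const 0)
  have hcont : ContinuousAt (fun x => ρ x * ∑ i, ∑ j, ‖(fromBlocks 0 (SH x * F12 x) (SP * F21 x) 0) i j‖) x0 :=
    hρ.continuousAt.mul (tendsto_finsetSum _ fun i _ => tendsto_finsetSum _ fun j _ => (hN.cont i j).norm)
  have ev1 : ∀ᶠ x in 𝓝 x0, ρ x * ∑ i, ∑ j, ‖(fromBlocks 0 (SH x * F12 x) (SP * F21 x) 0) i j‖ < δ := by
    refine hcont.eventually_lt continuousAt_const ?_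
    simp only [ρ0, zero_mul]; exact hδ0
  have ev2 : ∀ᶠ x in 𝓝 x0, ρ x * (γ x + ρ x) < 1 := by
    refine ContinuousAt.eventually_lt (hρ.continuousAt.mul (hγ.continuousAt.add hρ.continuousAt)) continuousAt_const ?_
    simp [ρ0]
  refine ⟨δ * c3, by positivity, ?_⟩
  filter_upwards [hH, h22', hX3, ev1, ev2, hG] with x hH h22' hX3 ev1 ev2 hG hg hr U
  rw [Matrix.mul_assoc, hG, Matrix.mul_assoc, ← Matrix.mul_assoc (fromBlocks (SH x) 0 0 SP), ← Matrix.mul_assoc, rq_conj, fromBlocks_multiply]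
  set V := X x *ᵥ U with hV
  have hVe : V = Sum.elim (V ∘ Sum.inl) (V ∘ Sum.inr) := (Sum.elim_comp_inl_inr V).symm
  have hnV : c3 * nq U ≤ nq V := by rw [hV, ← rq_ctmul]; exact hX3 U
  clear_value V
  set v := V ∘ Sum.inl
  set w := V ∘ Sum.inr
  have e1 : fromBlocks (SH x * ((ρ x : ℂ) • H x) + 0 * ((ρ x ^ 2 : ℝ) • F21 x)) (SH x * ((ρ x ^ 2 : ℝ) • F12 x) + 0 * F22 x)
      (0 * ((ρ x : ℂ) • H x) + SP * ((ρ x ^ 2 : ℝ) • F21 x)) (0 * ((ρ x ^ 2 : ℝ) • F12 x) + SP * F22 x) =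
      fromBlocks ((ρ x : ℂ) • (SH x * H x)) ((ρ x ^ 2 : ℝ) • (SH x * F12 x)) ((ρ x ^ 2 : ℝ) • (SP * F21 x)) (SP * F22 x) := by
    simp
  rw [e1]
  rw [hVe, nq_elim] at hnV
  rw [hVe, rq_blocks]
  have hv := nq_nonneg v
  have hw := nq_nonneg w
  have hb := abs_rq_le (fromBlocks 0 (SH x * F12 x) (SP * F21 x) 0) (Sum.elim ((ρ x:ℂ) • v) w)
  have hns : nq ((ρ x:ℂ) • v) = ρ x ^ 2 * nq v := by rw [nq_smul]; simp
  rw [nq_elim, hns] at hb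
  have i1 : ρ x * |rq (fromBlocks 0 (SH x * F12 x) (SP * F21 x) 0) (Sum.elim ((ρ x:ℂ) • v) w)| ≤ δ * (ρ x ^ 2 * nq v + nq w) := by
    refine (mul_le_mul_of_nonneg_left hb hr).trans ?_
    rw [← mul_assoc]
    exact mul_le_mul_of_nonneg_right ev1.le (by positivity)
  have i2 := mul_le_mul_of_nonneg_left (neg_abs_le (rq (fromBlocks 0 (SH x * F12 x) (SP * F21 x) 0) (Sum.elim ((ρ x:ℂ) • v) w))) hr
  have i3 := mul_le_mul_of_nonneg_left (hH hg hr v) hr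
  have i4 := h22' w
  have d1 : 2 * δ ≤ c := by rw [hδ]; linarith [min_le_left c c']
  have d2 : 2 * δ ≤ c' := by rw [hδ]; linarith [min_le_right c c']
  have i5 : δ * ρ x * (γ x + ρ x) * (c3 * nq U) ≤ δ * ρ x * (γ x + ρ x) * (nq v + nq w) := mul_le_mul_of_nonneg_left hnV (by positivity)
  have i6 : δ * (ρ x * (γ x + ρ x)) * nq w ≤ δ * 1 * nq w := by gcongr
  have i7 : 2 * δ * nq w ≤ c' * nq w := by gcongr
  have i8 : 2 * δ * (ρ x * (γ x + ρ x) * nq v) ≤ c * (ρ x * (γ x + ρ x) * nq v) := by gcongr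
  have i9 : 0 ≤ δ * (ρ x * γ x * nq v) := by positivity
  linarith
end
section
variable {n : Type*} [Fintype n] [DecidableEq n]
/-- corrector -/
def Ym (ρ : ℝ) (P H : MC n) : MC n := P⁻¹ + (ρ:ℂ) • (H * (P⁻¹ * P⁻¹))
/-- conjugator -/
def Xm (ρ : ℝ) (P H : MC n) : Matrix (n ⊕ n) (n ⊕ n) ℂ :=
  fromBlocks (1 + (ρ:ℂ) • (Ym ρ P H * H)) (-Ym ρ P H) (-((ρ:ℂ) • H)) 1
lemma conjX {ρ : ℝ} {M A P H R : MC n} (hP : P.det ≠ 0) (hA : A = P + (ρ:ℂ) • H)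
    (hM : M + (ρ:ℂ) • (A * H) - ((ρ:ℂ) ^ 2) • (H * H) = ((ρ:ℂ) ^ 2) • R) :
    Xm ρ P H * fromBlocks 0 1 M A = fromBlocks ((ρ:ℂ) • (H + (ρ:ℂ) • (-(Ym ρ P H * R)))) ((ρ ^ 2 : ℝ) • (H * (H * (P⁻¹ * P⁻¹)) - Ym ρ P H * (R * Ym ρ P H)))
      ((ρ ^ 2 : ℝ) • R) (P + (ρ:ℂ) ^ 2 • (R * Ym ρ P H)) * Xm ρ P H := by
  have h1 : P * P⁻¹ = 1 := mul_nonsing_inv _ hP.isUnit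
  have h2 : P⁻¹ * P = 1 := Matrix.nonsing_inv_mul _ hP.isUnit
  have hM' : M = ((ρ:ℂ) ^ 2) • R - (ρ:ℂ) • (P * H) := by
    rw [← hM, hA]
    simp only [add_mul, Matrix.smul_mul]
    module
  subst hA hM'
  simp only [← Complex.coe_smul, Xm, Ym]
  generalize P⁻¹ = Q at *
  have h2' : ∀ x, Q * (P * x) = x := fun x => by rw [← mul_assoc, h2, one_mul]
  rw [fromBlocks_multiply, fromBlocks_multiply]
  push_cast
  congr 1
  · simp only [add_mul, mul_add, sub_mul, mul_sub, Matrix.smul_mul, Matrix.mul_smul, neg_mul, mul_neg, mul_assoc,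
      h2', mul_one, mul_zero, one_mul]
    module
  · simp only [add_mul, mul_add, sub_mul, mul_sub, Matrix.smul_mul, Matrix.mul_smul, neg_mul, mul_neg, mul_assoc,
      h2', h2, mul_one, mul_zero, one_mul]
    module
  · simp only [add_mul, mul_add, sub_mul, mul_sub, Matrix.smul_mul, Matrix.mul_smul, neg_mul, mul_neg, mul_assoc,
      h2', mul_one, mul_zero, one_mul]
    module
  · simp only [add_mul, mul_add, sub_mul, mul_sub, Matrix.smul_mul, Matrix.mul_smul, neg_mul, mul_neg, mul_assoc,
      h2', mul_one, mul_zero, one_mul]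
    module
lemma Xm_det (P H : MC n) : (Xm 0 P H).det ≠ 0 := by
  simp [Xm, Matrix.det_fromBlocks_zero₂₁]
end
section
open Polynomial
variable {n : Type*} [Fintype n] [DecidableEq n]
variable {E : Type*} [NormedAddCommGroup E] [NormedSpace ℝ E]
structure HD (x0 : E) (T : E → MC n) (r : E → ℝ[X]) (s : ℕ) (R : Finset ℝ) (ν : ℝ → ℕ) (q e : ℝ → ℝ[X]) (K : ℝ → MC n) : Prop where
  hT : ∀ᶠ x in 𝓝 x0, SmAt T x
  hr : ∀ᶠ x in 𝓝 x0, (∀ k, ContDiffAt ℝ ∞ (fun y => (r y).coeff k) x) ∧ (r x).natDegree ≤ s ∧ aeval (T x) (r x) = 0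
  lad : LAD (T x0) (r x0) R ν q e K
section
variable {x0 : E} {T : E → MC n} {r : E → ℝ[X]} {s : ℕ} {R : Finset ℝ} {ν : ℝ → ℕ} {q e : ℝ → ℝ[X]} {K : ℝ → MC n}
lemma HD.Se (h : HD x0 T r s R ν q e K) : ∃ P Kl : MC n, (∀ f : ℝ[X], P * aeval (T x0) f = aeval (T x0) f * P) ∧ PD Kl ∧
    ∀ a b : ℝ, 0 < a → 0 < b → ∃ S : E → MC n, S x0 = (aeval (T x0) (epol R e))ᴴ * lyap Kl P a b * aeval (T x0) (epol R e) ∧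
      ∀ᶠ x in 𝓝 x0, SmAt S x ∧ (S x)ᴴ = S x ∧ ∀ v, 0 ≤ rq (S x * (I • T x)) v := by
  set Q0 := aeval (T x0) (epol R e) with hQ0
  obtain ⟨f, hf⟩ := SSLp _ h.lad.es_noimag
  rw [← hQ0] at hf
  obtain ⟨Kl, hKh, hKp, hly⟩ := hf.exists_lyap
  set G0 := I • (T x0 * Q0) + (1 - Q0) with hG0
  set P := aeval G0 f with hP
  have hmap : aeval (T x0) ((epol R e).map (algebraMap ℝ ℂ)) = Q0 := by rw [aeval_map_algebraMap]
  obtain ⟨Q, hQx0, hQ⟩ := PROJ h.hT ((epol R e).map (algebraMap ℝ ℂ)) (by rw [hmap]; exact h.lad.es_idem)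
  rw [hmap] at hQx0
  refine ⟨P, Kl, ?_, hKp, fun a b ha hb => ⟨fun x => (Q x)ᴴ * lyap Kl P a b * Q x, by simp only [hQx0], ?_⟩⟩
  · intro g
    have hc : Commute G0 (aeval (T x0) g) := by
      have c1 : Commute (T x0) (aeval (T x0) g) := by
        have := aevalR_comm (T x0) X g
        rwa [aeval_X] at this
      have c2 : Commute Q0 (aeval (T x0) g) := aevalR_comm (T x0) _ g
      exact ((c1.mul_left c2).smul_left _).add_left ((Commute.one_left _).sub_left c2)
    exact (show Commute P (aeval (T x0) g) from by
      rw [hP, aeval_eq_sum_range]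
      exact Commute.sum_left _ _ _ fun i _ => (hc.pow_left i).smul_left _)
  · have hTs := h.hT.self_of_nhds
    have hQs := hQ.self_of_nhds.1
    have hM : SmAt (fun x => lyap Kl P a b * (I • (T x * Q x) + (1 - Q x))) x0 :=
      (SmAt.const _).mul ((SmAt.smul contDiffAt_const (hTs.mul hQs)).add ((SmAt.const 1).sub hQs))
    obtain ⟨c, hc, hb⟩ := PD.near' hM.cont (by rw [hQx0]; exact hly a b ha hb)
    filter_upwards [hQ, hb] with x ⟨hq1, hq2, hq3⟩ hb
    refine ⟨(hq1.ct.mul (SmAt.const _)).mul hq1, ?_, fun v => ?_⟩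
    · simp [conjTranspose_mul, lyap_herm hKh, mul_assoc]
    · have e1 : (Q x)ᴴ * lyap Kl P a b * Q x * (I • T x) = (Q x)ᴴ * (lyap Kl P a b * (I • (T x * Q x) + (1 - Q x))) * Q x := by
        simp only [mul_assoc, Matrix.mul_smul, add_mul, sub_mul, Matrix.smul_mul, hq2, hq3, one_mul, sub_self, add_zero]
      rw [e1, rq_conj]
      exact le_trans (mul_nonneg hc.le (nq_nonneg _)) (hb _)
lemma HD.S0 (h : HD x0 T r s R ν q e K) {w : MC n} (hw : wᴴ = w) :
    ∀ᶠ x in 𝓝 x0, SmAt (fun y => bez s (r y) (T y) w) x ∧ (bez s (r x) (T x) w)ᴴ = bez s (r x) (T x) w ∧ ∀ v, rq (bez s (r x) (T x) w * (I • T x)) v = 0 := by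
  filter_upwards [h.hT, h.hr] with x hT ⟨h1, h2, h3⟩
  have hh := bez_herm (s := s) (r := r x) (T := T x) hw
  refine ⟨bez_smooth w h1 hT, hh, fun v => ?_⟩
  have hs := bez_sym h2 h3 w
  have e1 : (bez s (r x) (T x) w * (I • T x))ᴴ = -(bez s (r x) (T x) w * (I • T x)) := by
    rw [Matrix.mul_smul, conjTranspose_smul, conjTranspose_mul, hh, ← hs]; simp
  have := rq_ct (bez s (r x) (T x) w * (I • T x)) v
  rw [e1, rq_neg] at this
  linarith
end
end
section
open Polynomial
variable {n : Type*} [Fintype n] [DecidableEq n]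
variable {E : Type*} [NormedAddCommGroup E] [NormedSpace ℝ E]
section
variable {T : MC n} {r : ℝ[X]} {R : Finset ℝ} {ν : ℝ → ℕ} {q e : ℝ → ℝ[X]} {K : ℝ → MC n}
lemma LAD.mem (h : LAD T r R ν q e K) {ξ : ℝ} {u : n → ℂ} (hu0 : u ≠ 0) (hu : T *ᵥ u = (ξ:ℂ) • u) : ξ ∈ R := by
  refine h.root _ ?_
  have := aevalR_eig T r _ u hu
  rw [h.ann, zero_mulVec] at this
  rcases smul_eq_zero.1 this.symm with h6 | h6
  · exact_mod_cast h6
  · exact absurd h6 hu0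
lemma LAD.es_eig (h : LAD T r R ν q e K) {ξ : ℝ} (hξ : ξ ∈ R) {u : n → ℂ} (hu : T *ᵥ u = (ξ:ℂ) • u) : aeval T (epol R e) *ᵥ u = 0 := by
  rw [epol, map_sub, map_one, map_sum, sub_mulVec, sum_mulVec, one_mulVec, Finset.sum_eq_single ξ, h.eig hξ hu hξ, if_pos rfl, sub_self]
  · intro η hη hne
    rw [h.eig hξ hu hη, if_neg hne]
  · intro h'; exact absurd hξ h'
lemma rq_ct_mul (X Y : MC n) (u : n → ℂ) : rq (Xᴴ * Y) u = (star (X *ᵥ u) ⬝ᵥ (Y *ᵥ u)).re := by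
  unfold rq
  rw [← mulVec_mulVec, star_dot_mulVec, conjTranspose_conjTranspose]
lemma LAD.eigpos (h : LAD T r R ν q e K) {s : ℕ} (hs : r.natDegree ≤ s) {ξ : ℝ} (hξ : ξ ∈ R) {u : n → ℂ} (hu : T *ᵥ u = (ξ:ℂ) • u) (g : ℝ[X]) (L Γ : MC n) :
    rq ((bez s r T (wmat T R e K) * aeval T g + (aeval T (epol R e))ᴴ * L * aeval T (epol R e)) * Γ) u =
      g.eval ξ * rq (K ξ * aeval T ((X - C ξ) ^ (ν ξ - 1) * q ξ) * Γ) u := by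
  have hd := h.rd ξ hξ
  have hp := hd.pos
  rw [add_mul, rq_add, mul_assoc (_ * L), mul_assoc _ L, rq_ct_mul, h.es_eig hξ hu]
  have hr : r = (X - C ξ) * ((X - C ξ) ^ (ν ξ - 1) * q ξ) := by
    rw [← mul_assoc, ← pow_succ', show ν ξ - 1 + 1 = ν ξ by omega]; exact hd.fac
  have hsym := aevalR_sym (bez_sym hs h.ann (wmat T R e K)) g
  have hh := bez_herm (s := s) (r := r) (T := T) h.wherm
  set Pf := aeval T ((X - C ξ) ^ (ν ξ - 1) * q ξ) with hPf
  have hP1 : T *ᵥ (Pf *ᵥ (Γ *ᵥ u)) = (ξ:ℂ) • (Pf *ᵥ (Γ *ᵥ u)) := by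
    rw [← eigN, mulVec_mulVec, hPf, ← map_mul, ← hr, h.ann, zero_mulVec]
  rw [hsym, mul_assoc, rq_ct_mul, aevalR_eig T g ξ u hu, star_smul, smul_dotProduct]
  conv_lhs => rw [← hh]
  rw [← mulVec_mulVec, star_dot_mulVec, conjTranspose_conjTranspose, bez_vec hs hr _ hu]
  have e2 : star ((Pf)ᴴ *ᵥ (wmat T R e K *ᵥ u)) ⬝ᵥ (Γ *ᵥ u) = star u ⬝ᵥ (K ξ *ᵥ (Pf *ᵥ (Γ *ᵥ u))) := by
    rw [← star_dot_mulVec, ← h.wvec hξ hP1 hu, star_dot_mulVec (wmat T R e K) u, h.wherm]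
  rw [e2]
  simp [rq, mulVec_mulVec, mul_assoc]
end
section
variable {x0 : E} {T : E → MC n} {r : E → ℝ[X]} {s : ℕ} {R : Finset ℝ} {ν : ℝ → ℕ} {q e : ℝ → ℝ[X]} {K : ℝ → MC n}
/-- good hyperbolic block -/
def GH (x0 : E) (H SH : E → MC n) (γ ρ : E → ℝ) : Prop := (∀ᶠ x in 𝓝 x0, SmAt SH x ∧ (SH x)ᴴ = SH x) ∧
  ∃ c > 0, ∀ᶠ x in 𝓝 x0, 0 ≤ γ x → 0 ≤ ρ x → ∀ v, c * (γ x + ρ x) * nq v ≤ rq (SH x * H x) v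
lemma HD.mk1 (h : HD x0 T r s R ν q e K) {Γ J : E → MC n} {γ ρ : E → ℝ} (hΓ : SmAt Γ x0) (hJ : SmAt J x0)
    (hγ : ∀ x, ContDiffAt ℝ ∞ γ x) (hρ : ∀ x, ContDiffAt ℝ ∞ ρ x) (γ0 : γ x0 = 0) (ρ0 : ρ x0 = 0)
    (h1 : ∀ ξ ∈ R, ∀ u, u ≠ 0 → T x0 *ᵥ u = (ξ:ℂ) • u → 0 < rq (K ξ * aeval (T x0) ((X - C ξ) ^ (ν ξ - 1) * q ξ) * Γ x0) u)
    (h2 : ∀ ξ ∈ R, ∀ u, u ≠ 0 → T x0 *ᵥ u = (ξ:ℂ) • u → 0 < rq (K ξ * aeval (T x0) ((X - C ξ) ^ (ν ξ - 1) * q ξ) * J x0) u)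
    {g : ℝ[X]} (hg : ∀ ξ ∈ R, 0 < g.eval ξ) {L : MC n} {S : E → MC n} (hS0 : S x0 = (aeval (T x0) (epol R e))ᴴ * L * aeval (T x0) (epol R e))
    (hS : ∀ᶠ x in 𝓝 x0, SmAt S x ∧ (S x)ᴴ = S x ∧ ∀ v, 0 ≤ rq (S x * (I • T x)) v) :
    ∃ SH, GH x0 (fun x => I • T x + (γ x : ℂ) • Γ x + (ρ x : ℂ) • J x) SH γ ρ ∧ SH x0 = bez s (r x0) (T x0) (wmat (T x0) R e K) * aeval (T x0) g + S x0 := by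
  have hs := h.hr.self_of_nhds.2.1
  set w := wmat (T x0) R e K with hw
  set gm := aeval (T x0) g with hgm
  set w' := (1 / 2 : ℂ) • (w * gm + gmᴴ * w) with hw'
  have hwh : wᴴ = w := h.lad.wherm
  have hw'h : w'ᴴ = w' := by
    rw [hw']; simp [conjTranspose_smul, conjTranspose_mul, hwh, add_comm]
  have hgc : gm * T x0 = T x0 * gm := by
    have := aevalR_comm (T x0) g X
    rwa [aeval_X] at this
  have hb : bez s (r x0) (T x0) w' = bez s (r x0) (T x0) w * gm := by
    rw [hw', bez_smul, bez_add, bez_mul_right hgc, bez_mul_left hgc, ← aevalR_sym (bez_sym hs h.lad.ann w) g]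
    module
  have h0 := h.S0 hw'h
  have hSm : ∀ᶠ x in 𝓝 x0, SmAt (fun x => bez s (r x) (T x) w' + S x) x := by
    filter_upwards [h0, hS] with x a b using a.1.add b.1
  have hpos : ∀ᶠ x in 𝓝 x0, ∀ v, 0 ≤ rq ((bez s (r x) (T x) w' + S x) * (I • T x)) v := by
    filter_upwards [h0, hS] with x a b v
    rw [add_mul, rq_add, a.2.2, zero_add]; exact b.2.2 v
  obtain ⟨K1, K2, hK1, hK2, hc⟩ := HYP (S0 := fun x => bez s (r x) (T x) w' + S x) hSm.self_of_nhds h.hT.self_of_nhds hΓ hJ (hγ x0) (hρ x0) γ0 ρ0 hpos (by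
    intro ξ u hu hTu
    have hm := h.lad.mem hu hTu
    simp only [hb, hS0]
    rw [h.lad.eigpos hs hm hTu]
    exact mul_pos (hg ξ hm) (h1 ξ hm u hu hTu)) (by
    intro ξ u hu hTu
    have hm := h.lad.mem hu hTu
    simp only [hb, hS0]
    rw [h.lad.eigpos hs hm hTu]
    exact mul_pos (hg ξ hm) (h2 ξ hm u hu hTu))
  refine ⟨fun x => bez s (r x) (T x) w' + S x + (γ x : ℂ) • K1 + (ρ x : ℂ) • K2, ⟨?_, hc⟩, ?_⟩
  · filter_upwards [h0, hS, hSm] with x a b c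
    refine ⟨(c.add (SmAt.smul (contDiffAt_ofReal (hγ x)) (SmAt.const K1))).add (SmAt.smul (contDiffAt_ofReal (hρ x)) (SmAt.const K2)), ?_⟩
    simp [conjTranspose_smul, hK1, hK2, a.2.1, b.2.1]
  · simp [γ0, ρ0, hb]
lemma small_form (X : MC n) {ε : ℝ} (hε : 0 < ε) : ∃ b > 0, ∀ v, |b * rq X v| ≤ ε * nq v := by
  set B := ∑ i, ∑ j, ‖X i j‖ with hB
  have hB0 : 0 ≤ B := Finset.sum_nonneg fun i _ => Finset.sum_nonneg fun j _ => norm_nonneg _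
  refine ⟨ε / (B + 1), by positivity, fun v => ?_⟩
  rw [abs_mul, abs_of_pos (by positivity : 0 < ε / (B + 1))]
  have h1 := abs_rq_le X v
  have := nq_nonneg v
  calc ε / (B + 1) * |rq X v| ≤ ε / (B + 1) * ((B + 1) * nq v) := by gcongr; linarith
    _ = ε * nq v := by field_simp
open Classical in
/-- exponent -/
def exP (ν : ℝ → ℕ) (q : ℝ → ℝ[X]) (K : ℝ → MC n) (ξ : ℝ) : ℕ := if PD ((((q ξ).eval ξ : ℝ) : ℂ) • K ξ) then ν ξ / 2 else ν ξ - ν ξ / 2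
theorem HD.sym (h : HD x0 T r s R ν q e K) {Γ J : E → MC n} {γ ρ : E → ℝ} (hΓ : SmAt Γ x0) (hJ : SmAt J x0)
    (hγ : ∀ x, ContDiffAt ℝ ∞ γ x) (hρ : ∀ x, ContDiffAt ℝ ∞ ρ x) (γ0 : γ x0 = 0) (ρ0 : ρ x0 = 0)
    (h1 : ∀ ξ ∈ R, ∀ u, u ≠ 0 → T x0 *ᵥ u = (ξ:ℂ) • u → 0 < rq (K ξ * aeval (T x0) ((X - C ξ) ^ (ν ξ - 1) * q ξ) * Γ x0) u)
    (h2 : ∀ ξ ∈ R, ∀ u, u ≠ 0 → T x0 *ᵥ u = (ξ:ℂ) • u → 0 < rq (K ξ * aeval (T x0) ((X - C ξ) ^ (ν ξ - 1) * q ξ) * J x0) u) :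
    ∃ mp mn : MC n, (∀ z, mp *ᵥ z = 0 → ∃ y, z = mn *ᵥ y) ∧
      (∀ L ε : ℝ, 0 < ε → ∃ SH, GH x0 (fun x => I • T x + (γ x : ℂ) • Γ x + (ρ x : ℂ) • J x) SH γ ρ ∧ ∀ v, L * nq (mp *ᵥ v) - ε * nq v ≤ rq (SH x0) v) ∧
      (∀ L ε : ℝ, 0 < ε → ∃ SH, GH x0 (fun x => I • T x + (γ x : ℂ) • Γ x + (ρ x : ℂ) • J x) SH γ ρ ∧ ∀ v, L * nq (mn *ᵥ v) - ε * nq v ≤ - rq (SH x0) v) := by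
  have hs := h.hr.self_of_nhds.2.1
  obtain ⟨P, Kl, hP, hKl, hSe⟩ := h.Se
  set Q := aeval (T x0) (epol R e) with hQ
  have hexle : ∀ ξ, exP ν q K ξ ≤ ν ξ := by intro ξ; unfold exP; split_ifs <;> omega
  refine ⟨mm (T x0) R e (exP ν q K) (P * Q), mm (T x0) R e (fun ξ => ν ξ - exP ν q K ξ) ((1 - P) * Q), ?_, ?_, ?_⟩
  · intro z hz
    exact h.lad.kercont (fun ξ _ => by have := hexle ξ; omega) hP hz
  · intro L ε hε
    obtain ⟨g, hg, a, ha, hPD⟩ := h.lad.dual hs (σ := 1) one_ne_zero (D := P * Q) hKl (ex := exP ν q K) (fun ξ hξ => by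
      refine ⟨hexle ξ, fun j hj => ?_⟩
      unfold exP at hj
      split_ifs at hj with hc
      · exact ⟨by omega, fun _ => by rwa [one_mul]⟩
      · exact ⟨by omega, fun _ => by omega⟩) L (half_pos hε)
    obtain ⟨b, hb, hbb⟩ := small_form (((1 - P) * Q)ᴴ * Kl * ((1 - P) * Q)) (half_pos hε)
    obtain ⟨S, hS0, hS⟩ := hSe a b ha hb
    obtain ⟨SH, hSH, hSH0⟩ := h.mk1 hΓ hJ hγ hρ γ0 ρ0 h1 h2 hg hS0 hS
    refine ⟨SH, hSH, fun v => ?_⟩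
    have i1 := hPD.nonneg v
    have i2 := abs_le.1 (hbb v)
    simp only [rq_add, rq_sub, rq_smul, rq_conj, rq_ctmul, rq_one, one_mul] at i1
    rw [hSH0, rq_add, hS0, rq_conj, rq_lyap, mulVec_mulVec, mulVec_mulVec]
    rw [rq_conj] at i2
    linarith [i2.1, i2.2]
  · intro L ε hε
    obtain ⟨g, hg, a, ha, hPD⟩ := h.lad.dual hs (σ := -1) (by norm_num) (D := (1 - P) * Q) hKl (ex := fun ξ => ν ξ - exP ν q K ξ) (fun ξ hξ => by
      refine ⟨by simp, fun j hj => ?_⟩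
      have := hexle ξ
      unfold exP at hj this
      split_ifs at hj this with hc
      · exact ⟨by omega, fun _ => by omega⟩
      · refine ⟨by omega, fun _ => ?_⟩
        have hqn := (h.lad.rd ξ hξ).qne
        rcases h.lad.Kd ξ hξ with hK | hK <;> rcases lt_or_gt_of_ne hqn with hl | hl
        · intro v hv
          rw [rq_smul]; nlinarith [hK v hv]
        · exact absurd (fun v hv => by rw [rq_smul]; exact mul_pos hl (hK v hv)) hc
        · refine absurd (fun v hv => ?_) hc
          have := hK v hv
          rw [rq_neg] at this
          rw [rq_smul]; nlinarith
        · intro v hv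
          have := hK v hv
          rw [rq_neg] at this
          rw [rq_smul]; nlinarith) L (half_pos hε)
    obtain ⟨b, hb, hbb⟩ := small_form ((P * Q)ᴴ * Kl * (P * Q)) (half_pos hε)
    obtain ⟨S, hS0, hS⟩ := hSe b a hb ha
    obtain ⟨SH, hSH, hSH0⟩ := h.mk1 hΓ hJ hγ hρ γ0 ρ0 h1 h2 hg hS0 hS
    refine ⟨SH, hSH, fun v => ?_⟩
    have i1 := hPD.nonneg v
    have i2 := abs_le.1 (hbb v)
    simp only [rq_add, rq_sub, rq_smul, rq_conj, rq_ctmul, rq_one, one_mul] at i1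
    rw [hSH0, rq_add, hS0, rq_conj, rq_lyap, mulVec_mulVec, mulVec_mulVec]
    rw [rq_conj] at i2
    linarith [i2.1, i2.2]
end
end
section
variable {n : Type*} [Fintype n] [DecidableEq n]
variable {E : Type*} [NormedAddCommGroup E] [NormedSpace ℝ E]
/-- good symmetrizer -/
def GS (x0 : E) (G S : E → Matrix (n ⊕ n) (n ⊕ n) ℂ) (γ ρ : E → ℝ) : Prop := (∀ᶠ x in 𝓝 x0, SmAt S x ∧ (S x)ᴴ = S x) ∧
  ∃ c > 0, ∀ᶠ x in 𝓝 x0, 0 ≤ γ x → 0 ≤ ρ x → ∀ U, c * ρ x * (γ x + ρ x) * nq U ≤ rq (S x * G x) U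
lemma ker_dims {a b c d X0 : MC n} {X : Matrix (n ⊕ n) (n ⊕ n) ℂ} (hX : X.det ≠ 0) (h1 : ∀ z, a *ᵥ z = 0 → ∃ y, z = c *ᵥ y)
    (h2 : ∀ z, b *ᵥ z = 0 → ∃ y, z = d *ᵥ y) :
    Module.finrank ℂ (LinearMap.ker (fromBlocks a 0 0 b * X).mulVecLin) + Module.finrank ℂ (LinearMap.ker (fromBlocks c 0 0 d * X).mulVecLin) ≤
      Fintype.card (n ⊕ n) := by
  have hinj : Function.Injective X.mulVecLin := Matrix.mulVec_injective_of_isUnit ((Matrix.isUnit_iff_isUnit_det _).2 hX.isUnit)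
  have hr : (fromBlocks c 0 0 d * X).rank = (fromBlocks c 0 0 d).rank := Matrix.rank_mul_eq_left_of_isUnit_det _ _ hX.isUnit
  have hk := LinearMap.finrank_range_add_finrank_ker (fromBlocks c 0 0 d * X).mulVecLin
  have hsub : (LinearMap.ker (fromBlocks a 0 0 b * X).mulVecLin).map X.mulVecLin ≤ LinearMap.range (fromBlocks c 0 0 d).mulVecLin := by
    rintro _ ⟨U, hU, rfl⟩
    simp only [SetLike.mem_coe, LinearMap.mem_ker, Matrix.mulVecLin_apply] at hU ⊢
    rw [← mulVec_mulVec] at hU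
    set V := X *ᵥ U
    rw [fromBlocks_mulVec] at hU
    have u1 : a *ᵥ (V ∘ Sum.inl) = 0 := by
      have := congrArg (fun f => f ∘ Sum.inl) hU
      simpa using this
    have u2 : b *ᵥ (V ∘ Sum.inr) = 0 := by
      have := congrArg (fun f => f ∘ Sum.inr) hU
      simpa using this
    obtain ⟨y1, hy1⟩ := h1 _ u1
    obtain ⟨y2, hy2⟩ := h2 _ u2
    refine ⟨Sum.elim y1 y2, ?_⟩
    rw [Matrix.mulVecLin_apply, fromBlocks_mulVec, Sum.elim_comp_inl, Sum.elim_comp_inr, ← hy1, ← hy2]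
    simp
  have h3 := Submodule.finrank_mono hsub
  rw [← LinearEquiv.finrank_eq (Submodule.equivMapOfInjective X.mulVecLin hinj (LinearMap.ker (fromBlocks a 0 0 b * X).mulVecLin))] at h3
  rw [Module.finrank_fintype_fun_eq_card] at hk
  unfold Matrix.rank at hr
  omega
lemma lyap_pos {Kp Pp : MC n} (hK : PD Kp) (L : ℝ) {ε : ℝ} (hε : 0 < ε) :
    ∃ a > 0, ∃ b > 0, ∀ w, L * nq (Pp *ᵥ w) - ε * nq w ≤ a * rq Kp (Pp *ᵥ w) - b * rq Kp ((1 - Pp) *ᵥ w) := by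
  obtain ⟨c, hc, hb⟩ := hK.bound
  obtain ⟨b, hb0, hbb⟩ := small_form ((1 - Pp)ᴴ * Kp * (1 - Pp)) hε
  refine ⟨(|L| + 1) / c, by positivity, b, hb0, fun w => ?_⟩
  have i1 := hb (Pp *ᵥ w)
  have i2 := (abs_le.1 (hbb w)).2
  rw [rq_conj] at i2
  have i3 := nq_nonneg (Pp *ᵥ w)
  have i4 : (|L| + 1) / c * (c * nq (Pp *ᵥ w)) ≤ (|L| + 1) / c * rq Kp (Pp *ᵥ w) := by gcongr
  have i5 : (|L| + 1) / c * (c * nq (Pp *ᵥ w)) = (|L| + 1) * nq (Pp *ᵥ w) := by field_simp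
  have i6 : L * nq (Pp *ᵥ w) ≤ |L| * nq (Pp *ᵥ w) := by gcongr; exact le_abs_self L
  linarith
lemma ASM1 {x0 : E} {H F12 F21 F22 : E → MC n} {X G : E → Matrix (n ⊕ n) (n ⊕ n) ℂ} {γ ρ : E → ℝ}
    (h12 : SmAt F12 x0) (h21 : SmAt F21 x0) (h22 : SmAt F22 x0) (hX : ∀ᶠ x in 𝓝 x0, SmAt X x)
    (hγ : ContDiffAt ℝ ∞ γ x0) (hρ : ContDiffAt ℝ ∞ ρ x0) (γ0 : γ x0 = 0) (ρ0 : ρ x0 = 0) (hdet : (X x0).det ≠ 0)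
    (hG : ∀ᶠ x in 𝓝 x0, X x * G x = fromBlocks ((ρ x : ℂ) • H x) ((ρ x ^ 2 : ℝ) • F12 x) ((ρ x ^ 2 : ℝ) • F21 x) (F22 x) * X x)
    {Kp Pp : MC n} (hKh : Kpᴴ = Kp) {a b : ℝ} (hly : PD (lyap Kp Pp a b * F22 x0)) {SH : E → MC n} (hSH : GH x0 H SH γ ρ) :
    GS x0 G (fun x => (X x)ᴴ * fromBlocks (SH x) 0 0 (lyap Kp Pp a b) * X x) γ ρ := by
  refine ⟨?_, BLK hSH.1.self_of_nhds.1 h12 h21 h22 hX.self_of_nhds hγ hρ γ0 ρ0 hSH.2 hly hdet hG⟩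
  filter_upwards [hX, hSH.1] with x hx hs
  refine ⟨(hx.ct.mul (SmAt.fromBlocks hs.1 (SmAt.const 0) (SmAt.const 0) (SmAt.const _))).mul hx, ?_⟩
  simp [conjTranspose_mul, fromBlocks_conjTranspose, hs.2, lyap_herm hKh, mul_assoc]
theorem ASM {x0 : E} {H F12 F21 F22 : E → MC n} {X G : E → Matrix (n ⊕ n) (n ⊕ n) ℂ} {γ ρ : E → ℝ}
    (h12 : SmAt F12 x0) (h21 : SmAt F21 x0) (h22 : SmAt F22 x0) (hX : ∀ᶠ x in 𝓝 x0, SmAt X x)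
    (hγ : ContDiffAt ℝ ∞ γ x0) (hρ : ContDiffAt ℝ ∞ ρ x0) (γ0 : γ x0 = 0) (ρ0 : ρ x0 = 0) (hdet : (X x0).det ≠ 0)
    (hG : ∀ᶠ x in 𝓝 x0, X x * G x = fromBlocks ((ρ x : ℂ) • H x) ((ρ x ^ 2 : ℝ) • F12 x) ((ρ x ^ 2 : ℝ) • F21 x) (F22 x) * X x)
    (hP : ∀ (μ : ℂ) v, v ≠ 0 → F22 x0 *ᵥ v = μ • v → μ.re ≠ 0)
    (hH : ∃ mp mn : MC n, (∀ z, mp *ᵥ z = 0 → ∃ y, z = mn *ᵥ y) ∧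
      (∀ L ε : ℝ, 0 < ε → ∃ SH, GH x0 H SH γ ρ ∧ ∀ v, L * nq (mp *ᵥ v) - ε * nq v ≤ rq (SH x0) v) ∧
      (∀ L ε : ℝ, 0 < ε → ∃ SH, GH x0 H SH γ ρ ∧ ∀ v, L * nq (mn *ᵥ v) - ε * nq v ≤ - rq (SH x0) v)) :
    ∃ Φp Φn : Matrix (n ⊕ n) (n ⊕ n) ℂ,
      Module.finrank ℂ (LinearMap.ker Φp.mulVecLin) + Module.finrank ℂ (LinearMap.ker Φn.mulVecLin) ≤ Fintype.card (n ⊕ n) ∧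
      (∀ L ε : ℝ, 0 < ε → ∃ S, GS x0 G S γ ρ ∧ ∀ v, L * nq (Φp *ᵥ v) - ε * nq v ≤ rq (S x0) v) ∧
      (∀ L ε : ℝ, 0 < ε → ∃ S, GS x0 G S γ ρ ∧ ∀ v, L * nq (Φn *ᵥ v) - ε * nq v ≤ - rq (S x0) v) := by
  obtain ⟨mp, mn, hk, hp, hn⟩ := hH
  obtain ⟨f, hf⟩ := SSLp _ hP
  set Pp := Polynomial.aeval (F22 x0) f
  obtain ⟨Kp, hKh, hKp, hly⟩ := hf.exists_lyap
  have hel : ∀ a b : MC n, ∀ U, nq ((fromBlocks a 0 0 b * X x0) *ᵥ U) = nq (a *ᵥ ((X x0 *ᵥ U) ∘ Sum.inl)) + nq (b *ᵥ ((X x0 *ᵥ U) ∘ Sum.inr)) := by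
    intro a b U
    rw [← mulVec_mulVec, fromBlocks_mulVec, nq_elim]; simp
  have hnX : ∀ U, nq (X x0 *ᵥ U) = nq ((X x0 *ᵥ U) ∘ Sum.inl) + nq ((X x0 *ᵥ U) ∘ Sum.inr) := by
    intro U; rw [← nq_elim, Sum.elim_comp_inl_inr]
  have hrq : ∀ a b : MC n, ∀ U, rq ((X x0)ᴴ * fromBlocks a 0 0 b * X x0) U = rq a ((X x0 *ᵥ U) ∘ Sum.inl) + rq b ((X x0 *ᵥ U) ∘ Sum.inr) := by
    intro a b U
    rw [rq_conj, ← rq_diag, Sum.elim_comp_inl_inr]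
  have asm := @ASM1 n _ _ E _ _ x0 H F12 F21 F22 X G γ ρ h12 h21 h22 hX hγ hρ γ0 ρ0 hdet hG Kp Pp hKh
  refine ⟨fromBlocks mp 0 0 Pp * X x0, fromBlocks mn 0 0 (1 - Pp) * X x0, ker_dims (X0 := 1) hdet hk ?_, ?_, ?_⟩
  · intro z hz
    exact ⟨z, by rw [sub_mulVec, hz]; simp⟩
  · intro L ε hε
    obtain ⟨ε', hε', hsm⟩ := small_form ((X x0)ᴴ * X x0) hε
    obtain ⟨SH, hSH, hSH0⟩ := hp L ε' hε'
    obtain ⟨a, ha, b, hb, hab⟩ := lyap_pos (Pp := Pp) hKp L hε'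
    refine ⟨_, asm (hly a b ha hb) hSH, fun U => ?_⟩
    simp only [hrq, hel, rq_lyap]
    have i1 := (abs_le.1 (hsm U)).2
    rw [rq_ctmul, hnX] at i1
    have i2 := hSH0 ((X x0 *ᵥ U) ∘ Sum.inl)
    have i3 := hab ((X x0 *ᵥ U) ∘ Sum.inr)
    linarith
  · intro L ε hε
    obtain ⟨ε', hε', hsm⟩ := small_form ((X x0)ᴴ * X x0) hε
    obtain ⟨SH, hSH, hSH0⟩ := hn L ε' hε'
    obtain ⟨a, ha, b, hb, hab⟩ := lyap_pos (Pp := 1 - Pp) hKp L hε'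
    refine ⟨_, asm (hly b a hb ha) hSH, fun U => ?_⟩
    simp only [hrq, hel, rq_lyap]
    have i1 := (abs_le.1 (hsm U)).2
    rw [rq_ctmul, hnX] at i1
    have i2 := hSH0 ((X x0 *ᵥ U) ∘ Sum.inl)
    have i3 := hab ((X x0 *ᵥ U) ∘ Sum.inr)
    rw [sub_sub_cancel] at i3
    linarith
end
section
variable {n : Type*} [Fintype n] [DecidableEq n]
open Polynomial in
lemma aeval_cmap {N : ℕ} (T : MR N) (q : ℝ[X]) : aeval (cmap T) q = cmap (aeval T q) := by
  have := Polynomial.aeval_algHom_apply (AlgHom.mapMatrix (m := Fin N) (Algebra.ofId ℝ ℂ)) T q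
  exact this
lemma cmap_mul {N : ℕ} (a b : MR N) : cmap (a * b) = cmap a * cmap b :=
  Matrix.map_mul (f := Complex.ofRealHom) (L := a) (M := b)
lemma cmap_add {N : ℕ} (a b : MR N) : cmap (a + b) = cmap a + cmap b := by ext; simp [cmap]
lemma cmap_neg {N : ℕ} (a : MR N) : cmap (-a) = -cmap a := by ext; simp [cmap]
lemma cmap_smul {N : ℕ} (t : ℝ) (a : MR N) : cmap (t • a) = (t:ℂ) • cmap a := by ext; simp [cmap]
lemma cmap_one {N : ℕ} : cmap (1 : MR N) = 1 := by ext i j; by_cases h : i = j <;> simp [cmap, h, Matrix.one_apply]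
lemma cmap_sum {N : ℕ} {ι : Type*} (s : Finset ι) (f : ι → MR N) : cmap (∑ i ∈ s, f i) = ∑ i ∈ s, cmap (f i) := by
  ext; simp [cmap, Matrix.sum_apply]
lemma rq_congr {K M : MC n} {u : n → ℂ} (h : K *ᵥ u = M *ᵥ u) : rq K u = rq M u := by unfold rq; rw [h]
def Ae {N m : ℕ} (A : Fin (m + 1) → MR N) (η : Fin m → ℝ) : MR N := ∑ j : Fin m, η j • A j.castSucc
def Tm {N m : ℕ} (A : Fin (m + 1) → MR N) (τ : ℝ) (η : Fin m → ℝ) : MR N :=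
  -((A (Fin.last m))⁻¹ * (Ae A η + τ • (1 : MR N)))
lemma Ae_snoc {N m : ℕ} (A : Fin (m + 1) → MR N) (η : Fin m → ℝ) (ξ : ℝ) :
    ∑ j, (Fin.snoc η ξ : Fin (m+1) → ℝ) j • A j = Ae A η + ξ • A (Fin.last m) := by
  rw [Fin.sum_univ_castSucc]; simp [Ae]
lemma sA_snoc {N m : ℕ} (A : Fin (m + 1) → MR N) (η : Fin m → ℝ) (ξ : ℝ) :
    sA A (Fin.snoc η ξ : Fin (m+1) → ℝ) = cmap (Ae A η + ξ • A (Fin.last m)) := by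
  rw [← Ae_snoc, cmap_sum]; simp [sA, cmap_smul]
lemma Tm_eq {N m : ℕ} {A : Fin (m + 1) → MR N} (hd : (A (Fin.last m)).det ≠ 0) (τ : ℝ) (η : Fin m → ℝ) :
    A (Fin.last m) * Tm A τ η = -(Ae A η + τ • (1 : MR N)) := by
  rw [Tm, mul_neg, ← mul_assoc, mul_nonsing_inv _ hd.isUnit, one_mul]
lemma snoc_ne {m : ℕ} {η : Fin m → ℝ} {ξ : ℝ} (h : ξ ≠ 0 ∨ η ≠ 0) : (Fin.snoc η ξ : Fin (m+1) → ℝ) ≠ 0 := by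
  intro h0
  rcases h with h | h
  · exact h (by simpa using congrFun h0 (Fin.last m))
  · exact h (funext fun j => by simpa using congrFun h0 j.castSucc)
/-- constant multiplicity at a point -/
def H1pt {N m : ℕ} (A : Fin (m + 1) → MR N) (s : ℕ) : Prop := ∀ ξ : Fin (m+1) → ℝ, ξ ≠ 0 → RS s (∑ j, ξ j • A j)
variable {N m : ℕ} {A : Fin (m + 1) → MR N} {B : Fin (m + 1) → Fin (m + 1) → MR N} {c : ℝ} {s : ℕ}
lemma H1pt.a (h : H1pt A s) {η : Fin m → ℝ} {ξ : ℝ} (hn : ξ ≠ 0 ∨ η ≠ 0) : RS s (Ae A η + ξ • A (Fin.last m)) := by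
  rw [← Ae_snoc]; exact h _ (snoc_ne hn)
lemma H1pt.b (h : H1pt A s) (η : Fin m → ℝ) (t : ℝ) : RS s (A (Fin.last m) + t • Ae A η) := by
  have := h.a (η := t • η) (ξ := 1) (Or.inl one_ne_zero)
  rwa [one_smul, add_comm, show Ae A (t • η) = t • Ae A η by simp [Ae, Finset.smul_sum, mul_smul]] at this
lemma eig_eq (hd : (A (Fin.last m)).det ≠ 0) {τ ξ : ℝ} {η : Fin m → ℝ} {u : Fin N → ℂ}
    (hu : cmap (Tm A τ η) *ᵥ u = (ξ:ℂ) • u) : cmap (Ae A η + ξ • A (Fin.last m) + τ • (1 : MR N)) *ᵥ u = 0 := by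
  have e : Ae A η + ξ • A (Fin.last m) + τ • (1 : MR N) = ξ • A (Fin.last m) - A (Fin.last m) * Tm A τ η := by
    rw [Tm_eq hd]; abel
  rw [e, sub_eq_add_neg, cmap_add, cmap_neg, cmap_mul, cmap_smul, add_mulVec, neg_mulVec, ← mulVec_mulVec, hu, mulVec_smul, smul_mulVec]
  simp
open Polynomial in
lemma KX (h : H2pt A B c) (hc : 0 < c) (h1 : H1pt A s) (hd : (A (Fin.last m)).det ≠ 0) {τ : ℝ} {η : Fin m → ℝ} (hζ : τ ≠ 0 ∨ η ≠ 0)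
    (ξ : ℝ) {q : ℝ[X]} (hq : rpol s (Ae A η) (A (Fin.last m)) τ = (X - C ξ) * q) :
    ∃ K : MC (Fin N), Kᴴ = K ∧ (PD K ∨ PD (-K)) ∧ ∀ u, cmap (Tm A τ η) *ᵥ u = (ξ:ℂ) • u →
      (∃ v, u = aeval (cmap (Tm A τ η)) q *ᵥ v) ∧ (u ≠ 0 → 0 < rq (K * aeval (cmap (Tm A τ η)) q * (-(cmap (A (Fin.last m)))⁻¹)) u ∧
        ∀ J : MC (Fin N), J *ᵥ u = -((cmap (A (Fin.last m)))⁻¹ *ᵥ (sB B (Fin.snoc η ξ : Fin (m+1) → ℝ) *ᵥ u)) →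
          0 < rq (K * aeval (cmap (Tm A τ η)) q * J) u) := by
  by_cases hn : ξ ≠ 0 ∨ η ≠ 0
  swap
  · push Not at hn
    obtain ⟨rfl, rfl⟩ := hn
    have hτ : τ ≠ 0 := by simpa using hζ
    refine ⟨1, by simp, Or.inl PD_one, fun u hu => ?_⟩
    have h0 := eig_eq hd hu
    have e : Ae A 0 + (0:ℝ) • A (Fin.last m) + τ • (1 : MR N) = τ • (1 : MR N) := by simp [Ae]
    rw [e, cmap_smul, cmap_one, smul_mulVec, one_mulVec] at h0
    have hu0 : u = 0 := (smul_eq_zero.1 h0).resolve_left (by exact_mod_cast hτ)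
    exact ⟨⟨0, by simp [hu0]⟩, fun hne => absurd hu0 hne⟩
  obtain ⟨-, -, -, hR⟩ := RAD (s := s) (a := Ae A η) (b := A (Fin.last m)) (T := Tm A τ η) (τ := τ) (fun ξ hξ => h1.a (Or.inl hξ))
    (fun t => h1.b η t) hd (Tm_eq hd τ η)
  obtain ⟨k, hk, π, Z, p1, p2, p3, p4, p5⟩ := hR ξ (h1.a hn) q hq
  have q1 : cmap π * cmap π = cmap π := by rw [← cmap_mul, p1]
  have hfix : ∀ u, cmap (Tm A τ η) *ᵥ u = (ξ:ℂ) • u → cmap π *ᵥ u = u := fun u hu => by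
    conv_lhs => rw [p4, cmap_add, cmap_mul, add_mulVec, ← mulVec_mulVec, eig_eq hd hu]
    simp [cmap_one]
  have hsum : 0 < c * ∑ j, ((Fin.snoc η ξ : Fin (m+1) → ℝ) j)^2 := by
    refine mul_pos hc ?_
    obtain ⟨j, hj⟩ := Function.ne_iff.1 (snoc_ne hn)
    exact Finset.sum_pos' (fun i _ => sq_nonneg _) ⟨j, Finset.mem_univ _, sq_pos_of_ne_zero hj⟩
  have hEP := compress (sA A (Fin.snoc η ξ : Fin (m+1) → ℝ)) (sB B (Fin.snoc η ξ : Fin (m+1) → ℝ)) (cmap π) (-τ) q1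
    (by rw [sA_snoc, ← cmap_mul, p2, cmap_smul]) (fun u hu => by
      conv_lhs => rw [p4, cmap_add, cmap_mul, add_mulVec, ← mulVec_mulVec, cmap_add _ (τ • 1), add_mulVec, ← sA_snoc, hu, cmap_smul, cmap_one, smul_mulVec, one_mulVec]
      simp)
    (by rw [sA_snoc, ← cmap_mul, p3, cmap_smul]) _ hsum (fun s hs => h.sc _ hs)
  obtain ⟨K, Kh, Kp, Kq⟩ := DL2 _ hEP
  have hdc : (cmap (A (Fin.last m))).det ≠ 0 := by rw [cmap_det]; exact_mod_cast hd
  have hinv := mul_nonsing_inv _ hdc.isUnit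
  have hP : aeval (cmap (Tm A τ η)) q = (k:ℂ) • (cmap π * cmap (A (Fin.last m))) := by rw [aeval_cmap, p5, cmap_smul, cmap_mul]
  have hk' : (k:ℂ) ≠ 0 := by exact_mod_cast hk
  have hk2 : 0 < k * k := mul_self_pos.2 hk
  refine ⟨((-k:ℝ):ℂ) • K, by rw [conjTranspose_smul, Kh]; simp, ?_, fun u hu => ⟨⟨(k:ℂ)⁻¹ • ((cmap (A (Fin.last m)))⁻¹ *ᵥ u), ?_⟩, fun hu0 => ⟨?_, fun J hJ => ?_⟩⟩⟩
  · rcases lt_or_gt_of_ne hk with h' | h'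
    · left; intro v hv
      rw [rq_smul]; have := Kp v hv; nlinarith
    · right; intro v hv
      rw [rq_neg, rq_smul]; have := Kp v hv; nlinarith
  · rw [hP, smul_mulVec, mulVec_smul, smul_smul, mul_inv_cancel₀ hk', one_smul, mulVec_mulVec, mul_assoc, hinv, mul_one, hfix u hu]
  · rw [rq_congr (M := ((k*k:ℝ):ℂ) • K), rq_smul]
    · exact mul_pos hk2 (Kp u hu0)
    · have : (cmap π * cmap (A (Fin.last m)) * (cmap (A (Fin.last m)))⁻¹) *ᵥ u = u := by rw [mul_assoc, hinv, mul_one, hfix u hu]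
      rw [hP, mul_neg, neg_mulVec, mul_smul_comm, smul_mul_assoc, mul_assoc, smul_mul_assoc, smul_smul, smul_mulVec, ← mulVec_mulVec, this, smul_mulVec]
      push_cast
      rw [← neg_smul]; congr 1; ring
  · rw [rq_congr (M := ((k*k:ℝ):ℂ) • (K * (cmap π * sB B (Fin.snoc η ξ : Fin (m+1) → ℝ) * cmap π + (1 - cmap π)))), rq_smul]
    · exact mul_pos hk2 (Kq u hu0)
    · have e1 : (cmap π * sB B (Fin.snoc η ξ : Fin (m+1) → ℝ) * cmap π + (1 - cmap π)) *ᵥ u = cmap π *ᵥ (sB B (Fin.snoc η ξ : Fin (m+1) → ℝ) *ᵥ u) := by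
        rw [add_mulVec, ← mulVec_mulVec, hfix u hu, sub_mulVec, hfix u hu, ← mulVec_mulVec]; simp
      rw [smul_mulVec, ← mulVec_mulVec _ K, e1, hP, ← mulVec_mulVec, hJ, mul_smul_comm, Matrix.mulVec_neg, mulVec_mulVec, smul_mul_assoc, smul_mul_assoc, smul_mul_assoc, mul_assoc, mul_assoc, hinv, mul_one, smul_smul, smul_mulVec, ← neg_smul, mulVec_mulVec, mulVec_mulVec, mulVec_mulVec]
      congr 1; push_cast; ring
end
section
variable {N m : ℕ} {A : Fin (m + 1) → MR N} {B : Fin (m + 1) → Fin (m + 1) → MR N} {c : ℝ} {s : ℕ}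
def Hm (A : Fin (m + 1) → MR N) (ζ : Freq m) : MC (Fin N) :=
  I • cmap (Tm A ζ.1 ζ.2.1) + (ζ.2.2:ℂ) • (-(cmap (A (Fin.last m)))⁻¹)
def Cm (B : Fin (m + 1) → Fin (m + 1) → MR N) (η : Fin m → ℝ) : MC (Fin N) :=
  ∑ j : Fin m, (I * (η j : ℂ)) • (cmap (B j.castSucc (Fin.last m)) + cmap (B (Fin.last m) j.castSucc))
def Bm (B : Fin (m + 1) → Fin (m + 1) → MR N) (η : Fin m → ℝ) : MC (Fin N) :=
  ∑ j : Fin m, ∑ k : Fin m, ((η j * η k : ℝ) : ℂ) • cmap (B j.castSucc k.castSucc)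
def Rm (A : Fin (m + 1) → MR N) (B : Fin (m + 1) → Fin (m + 1) → MR N) (ζ : Freq m) : MC (Fin N) :=
  (cmap (B (Fin.last m) (Fin.last m)))⁻¹ * (Bm B ζ.2.1 - Cm B ζ.2.1 * Hm A ζ) - Hm A ζ * Hm A ζ
def Pm (A : Fin (m + 1) → MR N) (B : Fin (m + 1) → Fin (m + 1) → MR N) (ζ : Freq m) (ρ : ℝ) : MC (Fin N) :=
  (cmap (B (Fin.last m) (Fin.last m)))⁻¹ * (cmap (A (Fin.last m)) - (ρ:ℂ) • Cm B ζ.2.1) - (ρ:ℂ) • Hm A ζ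
lemma calA_sc (ζ : Freq m) (ρ : ℝ) : calA A B (ρ • ζ) = (cmap (B (Fin.last m) (Fin.last m)))⁻¹ * (cmap (A (Fin.last m)) - (ρ:ℂ) • Cm B ζ.2.1) := by
  unfold calA Cm
  rw [Finset.smul_sum]
  congr 2
  refine Finset.sum_congr rfl fun j _ => ?_
  rw [smul_smul]; congr 1
  simp; ring
lemma AdH (hd : (A (Fin.last m)).det ≠ 0) (ζ : Freq m) : cmap (A (Fin.last m)) * Hm A ζ =
    -((I * (ζ.1 : ℂ) + (ζ.2.2 : ℂ)) • (1 : MC (Fin N)) + ∑ j : Fin m, (I * (ζ.2.1 j : ℂ)) • cmap (A j.castSucc)) := by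
  have hdc : (cmap (A (Fin.last m))).det ≠ 0 := by rw [cmap_det]; exact_mod_cast hd
  have hinv := mul_nonsing_inv _ hdc.isUnit
  rw [Hm, mul_add, mul_smul_comm, mul_smul_comm, mul_neg, hinv, ← cmap_mul, Tm_eq hd, cmap_neg, cmap_add, cmap_smul, cmap_one, Ae, cmap_sum]
  simp only [cmap_smul, mul_smul, ← Finset.smul_sum]
  module
lemma calM_sc (hd : (A (Fin.last m)).det ≠ 0) (ζ : Freq m) (ρ : ℝ) : calM A B (ρ • ζ) =
    (cmap (B (Fin.last m) (Fin.last m)))⁻¹ * (-((ρ:ℂ) • (cmap (A (Fin.last m)) * Hm A ζ)) + ((ρ:ℂ)^2) • Bm B ζ.2.1) := by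
  rw [AdH hd]
  unfold calM Bm
  congr 2
  · rw [smul_neg, neg_neg, smul_add, smul_smul, Finset.smul_sum]
    congr 1
    · congr 1; simp; ring
    · refine Finset.sum_congr rfl fun j _ => ?_
      rw [smul_smul]; congr 1; simp; ring
  · rw [Finset.smul_sum]
    refine Finset.sum_congr rfl fun j _ => ?_
    rw [Finset.smul_sum]
    refine Finset.sum_congr rfl fun k _ => ?_
    rw [smul_smul]; congr 1; simp; ring
lemma Hyp3 (hd : (A (Fin.last m)).det ≠ 0) (ζ : Freq m) (ρ : ℝ) :
    calM A B (ρ • ζ) + (ρ:ℂ) • (calA A B (ρ • ζ) * Hm A ζ) - ((ρ:ℂ)^2) • (Hm A ζ * Hm A ζ) = ((ρ:ℂ)^2) • Rm A B ζ := by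
  rw [calA_sc, calM_sc hd, Rm]
  simp only [mul_add, mul_sub, sub_mul, smul_sub, mul_neg, mul_smul_comm, smul_mul_assoc, mul_assoc, smul_smul, pow_two]
  abel
lemma sB_snoc (η : Fin m → ℝ) (ξ : ℝ) : I • sB B (Fin.snoc η ξ : Fin (m+1) → ℝ) =
    I • Bm B η + (ξ:ℂ) • Cm B η + (I * (ξ:ℂ)^2) • cmap (B (Fin.last m) (Fin.last m)) := by
  unfold sB Bm Cm
  simp only [Fin.sum_univ_castSucc, Fin.snoc_castSucc, Fin.snoc_last]
  rw [Finset.sum_add_distrib]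
  simp only [smul_add, Finset.smul_sum, smul_smul, Finset.sum_add_distrib]
  have e1 : ∀ j : Fin m, I * ((η j * ξ : ℝ):ℂ) = ξ * (I * η j) := fun j => by push_cast; ring
  have e2 : ∀ j : Fin m, I * ((ξ * η j : ℝ):ℂ) = ξ * (I * η j) := fun j => by push_cast; ring
  have e3 : I * ((ξ * ξ : ℝ):ℂ) = I * ξ^2 := by push_cast; ring
  simp only [e1, e2, e3]
  abel
lemma Jeig (hd : (A (Fin.last m)).det ≠ 0) (hB : (cmap (B (Fin.last m) (Fin.last m))).det ≠ 0) {ζ : Freq m} (hγ : ζ.2.2 = 0) {ξ : ℝ} {u : Fin N → ℂ}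
    (hu : cmap (Tm A ζ.1 ζ.2.1) *ᵥ u = (ξ:ℂ) • u) :
    (-(Ym 0 (Pm A B ζ 0) (Hm A ζ) * Rm A B ζ)) *ᵥ u = -((cmap (A (Fin.last m)))⁻¹ *ᵥ (sB B (Fin.snoc ζ.2.1 ξ : Fin (m+1) → ℝ) *ᵥ u)) := by
  have hdc : (cmap (A (Fin.last m))).det ≠ 0 := by rw [cmap_det]; exact_mod_cast hd
  have hBi := Matrix.nonsing_inv_mul _ hB.isUnit
  have hBi' := mul_nonsing_inv _ hB.isUnit
  have hH : Hm A ζ *ᵥ u = (I * ξ) • u := by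
    rw [Hm, hγ, add_mulVec, smul_mulVec, hu, smul_smul]; simp
  have hY : Ym 0 (Pm A B ζ 0) (Hm A ζ) = (cmap (A (Fin.last m)))⁻¹ * cmap (B (Fin.last m) (Fin.last m)) := by
    simp only [Ym, Pm, Complex.ofReal_zero, zero_smul, add_zero, sub_zero]
    rw [Matrix.mul_inv_rev, Matrix.nonsing_inv_nonsing_inv _ hB.isUnit]
  have hR : I • (Rm A B ζ *ᵥ u) = (cmap (B (Fin.last m) (Fin.last m)))⁻¹ *ᵥ ((I • sB B (Fin.snoc ζ.2.1 ξ : Fin (m+1) → ℝ)) *ᵥ u) := by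
    rw [sB_snoc, Rm, sub_mulVec, ← mulVec_mulVec, ← mulVec_mulVec, hH, mulVec_smul, hH, sub_mulVec, ← mulVec_mulVec, hH]
    simp only [add_mulVec, smul_mulVec, mulVec_smul, mulVec_add, mulVec_sub, smul_sub, smul_smul]
    rw [mulVec_mulVec, mulVec_mulVec _ _ (cmap (B (Fin.last m) (Fin.last m))), hBi, one_mulVec, sub_sub, sub_eq_add_neg, neg_add, ← neg_smul, ← neg_smul]
    have e1 : -(I * (I * (ξ:ℂ))) = ξ := by rw [← mul_assoc, Complex.I_mul_I]; ring
    have e2 : -(I * (I * (ξ:ℂ) * (I * ξ))) = I * (ξ:ℂ)^2 := by linear_combination (-I * (ξ:ℂ)^2) * Complex.I_mul_I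
    rw [e1, e2, add_assoc, mulVec_mulVec]
  have hR' : Rm A B ζ *ᵥ u = (cmap (B (Fin.last m) (Fin.last m)))⁻¹ *ᵥ (sB B (Fin.snoc ζ.2.1 ξ : Fin (m+1) → ℝ) *ᵥ u) := by
    rw [smul_mulVec, mulVec_smul] at hR
    exact smul_right_injective _ Complex.I_ne_zero hR
  rw [neg_mulVec, ← mulVec_mulVec, hR', hY, mulVec_mulVec, mul_assoc, hBi', mul_one]
end
section
variable {M N m : ℕ}
abbrev XX (M m : ℕ) := (Fin M → ℝ) × Freq m × ℝ
lemma cofR {f : XX M m → ℝ} {x : XX M m} (h : ContDiffAt ℝ ∞ f x) : ContDiffAt ℝ ∞ (fun y => (f y : ℂ)) x := contDiffAt_ofReal h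
lemma cτ (x : XX M m) : ContDiffAt ℝ ∞ (fun y : XX M m => y.2.1.1) x := by fun_prop
lemma cη (j : Fin m) (x : XX M m) : ContDiffAt ℝ ∞ (fun y : XX M m => y.2.1.2.1 j) x := by fun_prop
lemma cγ (x : XX M m) : ContDiffAt ℝ ∞ (fun y : XX M m => y.2.1.2.2) x := by fun_prop
lemma cρ (x : XX M m) : ContDiffAt ℝ ∞ (fun y : XX M m => y.2.2) x := by fun_prop
variable {A : Fin (m + 1) → (Fin M → ℝ) → MR N} {B : Fin (m + 1) → Fin (m + 1) → (Fin M → ℝ) → MR N} {x : XX M m}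
lemma sm_Ae (hA : ∀ j, SmAt (fun y : XX M m => A j y.1) x) : SmAt (fun y : XX M m => Ae (fun j => A j y.1) y.2.1.2.1) x :=
  SmAt.sum _ fun j _ => SmAt.smul (cη j x) (hA _)
lemma sm_Tm (hA : ∀ j, SmAt (fun y : XX M m => A j y.1) x) (hd : (A (Fin.last m) x.1).det ≠ 0) :
    SmAt (fun y : XX M m => cmap (Tm (fun j => A j y.1) y.2.1.1 y.2.1.2.1)) x :=
  SmAt.ofReal (SmAt.neg (SmAt.mul (SmAt.inv (hA _) hd) (SmAt.add (sm_Ae hA) (SmAt.smul (cτ x) (SmAt.const _)))))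
lemma sm_Ga (hA : ∀ j, SmAt (fun y : XX M m => A j y.1) x) (hd : (A (Fin.last m) x.1).det ≠ 0) :
    SmAt (fun y : XX M m => -(cmap (A (Fin.last m) y.1))⁻¹) x :=
  SmAt.neg (SmAt.inv (SmAt.ofReal (hA _)) (by
    change (cmap (A (Fin.last m) x.1)).det ≠ 0
    rw [cmap_det]; exact_mod_cast hd))
lemma sm_Hm (hA : ∀ j, SmAt (fun y : XX M m => A j y.1) x) (hd : (A (Fin.last m) x.1).det ≠ 0) :
    SmAt (fun y : XX M m => Hm (fun j => A j y.1) y.2.1) x :=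
  SmAt.add (SmAt.smul contDiffAt_const (sm_Tm hA hd)) (SmAt.smul (cofR (cγ x)) (sm_Ga hA hd))
lemma sm_Cm (hB : ∀ j k, SmAt (fun y : XX M m => B j k y.1) x) : SmAt (fun y : XX M m => Cm (fun j k => B j k y.1) y.2.1.2.1) x :=
  SmAt.sum _ fun j _ => SmAt.smul (contDiffAt_const.mul (cofR (cη j x))) (SmAt.add (SmAt.ofReal (hB _ _)) (SmAt.ofReal (hB _ _)))
lemma sm_Bm (hB : ∀ j k, SmAt (fun y : XX M m => B j k y.1) x) : SmAt (fun y : XX M m => Bm (fun j k => B j k y.1) y.2.1.2.1) x :=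
  SmAt.sum _ fun j _ => SmAt.sum _ fun k _ => SmAt.smul (cofR ((cη j x).mul (cη k x))) (SmAt.ofReal (hB _ _))
lemma sm_Rm (hA : ∀ j, SmAt (fun y : XX M m => A j y.1) x) (hd : (A (Fin.last m) x.1).det ≠ 0)
    (hB : ∀ j k, SmAt (fun y : XX M m => B j k y.1) x) (hb : (cmap (B (Fin.last m) (Fin.last m) x.1)).det ≠ 0) :
    SmAt (fun y : XX M m => Rm (fun j => A j y.1) (fun j k => B j k y.1) y.2.1) x :=
  SmAt.sub (SmAt.mul (SmAt.inv (SmAt.ofReal (hB _ _)) hb) (SmAt.sub (sm_Bm hB) (SmAt.mul (sm_Cm hB) (sm_Hm hA hd)))) (SmAt.mul (sm_Hm hA hd) (sm_Hm hA hd))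
lemma sm_Pm (hA : ∀ j, SmAt (fun y : XX M m => A j y.1) x) (hd : (A (Fin.last m) x.1).det ≠ 0)
    (hB : ∀ j k, SmAt (fun y : XX M m => B j k y.1) x) (hb : (cmap (B (Fin.last m) (Fin.last m) x.1)).det ≠ 0) :
    SmAt (fun y : XX M m => Pm (fun j => A j y.1) (fun j k => B j k y.1) y.2.1 y.2.2) x :=
  SmAt.sub (SmAt.mul (SmAt.inv (SmAt.ofReal (hB _ _)) hb) (SmAt.sub (SmAt.ofReal (hA _)) (SmAt.smul (cofR (cρ x)) (sm_Cm hB)))) (SmAt.smul (cofR (cρ x)) (sm_Hm hA hd))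
lemma sm_Ym {P H : XX M m → MC (Fin N)} (hP : SmAt P x) (hH : SmAt H x) (hd : (P x).det ≠ 0) : SmAt (fun y => Ym y.2.2 (P y) (H y)) x :=
  SmAt.add (SmAt.inv hP hd) (SmAt.smul (cofR (cρ x)) (SmAt.mul hH (SmAt.mul (SmAt.inv hP hd) (SmAt.inv hP hd))))
lemma sm_Xm {P H : XX M m → MC (Fin N)} (hP : SmAt P x) (hH : SmAt H x) (hd : (P x).det ≠ 0) : SmAt (fun y => Xm y.2.2 (P y) (H y)) x :=
  SmAt.fromBlocks (SmAt.add (SmAt.const _) (SmAt.smul (cofR (cρ x)) (SmAt.mul (sm_Ym hP hH hd) hH))) (SmAt.neg (sm_Ym hP hH hd))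
    (SmAt.neg (SmAt.smul (cofR (cρ x)) hH)) (SmAt.const _)
open Polynomial in
theorem MAIN {𝒪 : Set (Fin M → ℝ)} (hO : IsOpen 𝒪) (h0 : HypH0 𝒪 A B) {s : ℕ} (h1 : ∀ p ∈ 𝒪, H1pt (fun j => A j p) s)
    {c : ℝ} (hc : 0 < c) (h2 : ∀ p ∈ 𝒪, H2pt (fun j => A j p) (fun j k => B j k p) c) (h3 : ∀ p ∈ 𝒪, (A (Fin.last m) p).det ≠ 0)
    {p₀ : Fin M → ℝ} (hp₀ : p₀ ∈ 𝒪) {ζ₀ : Freq m} (hζ₀ : ζ₀.1 ≠ 0 ∨ ζ₀.2.1 ≠ 0) (hγ₀ : ζ₀.2.2 = 0) :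
    ∃ Φp Φn : Matrix (Fin N ⊕ Fin N) (Fin N ⊕ Fin N) ℂ,
      Module.finrank ℂ (LinearMap.ker Φp.mulVecLin) + Module.finrank ℂ (LinearMap.ker Φn.mulVecLin) ≤ Fintype.card (Fin N ⊕ Fin N) ∧
      (∀ L ε : ℝ, 0 < ε → ∃ S, GS ((p₀, ζ₀, 0) : XX M m) (fun x => calG (fun j => A j x.1) (fun j k => B j k x.1) (x.2.2 • x.2.1)) S (fun x => x.2.1.2.2) (fun x => x.2.2) ∧
        ∀ v, L * nq (Φp *ᵥ v) - ε * nq v ≤ rq (S (p₀, ζ₀, 0)) v) ∧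
      (∀ L ε : ℝ, 0 < ε → ∃ S, GS ((p₀, ζ₀, 0) : XX M m) (fun x => calG (fun j => A j x.1) (fun j k => B j k x.1) (x.2.2 • x.2.1)) S (fun x => x.2.1.2.2) (fun x => x.2.2) ∧
        ∀ v, L * nq (Φn *ᵥ v) - ε * nq v ≤ - rq (S (p₀, ζ₀, 0)) v) := by
  have hev : ∀ᶠ x : XX M m in 𝓝 (p₀, ζ₀, 0), x.1 ∈ 𝒪 := continuous_fst.continuousAt.eventually_mem (hO.mem_nhds hp₀)
  have hA : ∀ x : XX M m, x.1 ∈ 𝒪 → ∀ j, SmAt (fun y : XX M m => A j y.1) x := fun x hx j i k =>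
    ((h0.1 j i k).contDiffAt (hO.mem_nhds hx)).comp x contDiffAt_fst
  have hB : ∀ x : XX M m, x.1 ∈ 𝒪 → ∀ j k, SmAt (fun y : XX M m => B j k y.1) x := fun x hx j l i k =>
    ((h0.2 j l i k).contDiffAt (hO.mem_nhds hx)).comp x contDiffAt_fst
  have hb : ∀ p ∈ 𝒪, (cmap (B (Fin.last m) (Fin.last m) p)).det ≠ 0 := fun p hp => (h2 p hp).Bdd hc
  have smH := sm_Hm (hA (p₀, ζ₀, 0) hp₀) (h3 _ hp₀)
  have smR := sm_Rm (hA (p₀, ζ₀, 0) hp₀) (h3 _ hp₀) (hB (p₀, ζ₀, 0) hp₀) (hb _ hp₀)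
  have smP := sm_Pm (hA (p₀, ζ₀, 0) hp₀) (h3 _ hp₀) (hB (p₀, ζ₀, 0) hp₀) (hb _ hp₀)
  have hP0 : Pm (fun j => A j p₀) (fun j k => B j k p₀) ζ₀ 0 = (cmap (B (Fin.last m) (Fin.last m) p₀))⁻¹ * cmap (A (Fin.last m) p₀) := by simp [Pm]
  have hPd0 : (Pm (fun j => A j p₀) (fun j k => B j k p₀) ζ₀ 0).det ≠ 0 := by
    rw [hP0, Matrix.det_mul, Matrix.det_nonsing_inv, Ring.inverse_eq_inv']
    refine mul_ne_zero (inv_ne_zero (hb _ hp₀)) ?_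
    rw [cmap_det]; exact_mod_cast h3 _ hp₀
  have hPd : ∀ᶠ x : XX M m in 𝓝 (p₀, ζ₀, 0), (Pm (fun j => A j x.1) (fun j k => B j k x.1) x.2.1 x.2.2).det ≠ 0 :=
    (SmAt.det smP).continuousAt.eventually_ne hPd0
  have smY := sm_Ym smP smH hPd0
  have smPi := SmAt.inv smP hPd0
  refine ASM (H := fun x => I • cmap (Tm (fun j => A j x.1) x.2.1.1 x.2.1.2.1) + ((x.2.1.2.2:ℝ):ℂ) • (-(cmap (A (Fin.last m) x.1))⁻¹) +
      ((x.2.2:ℝ):ℂ) • (-(Ym x.2.2 (Pm (fun j => A j x.1) (fun j k => B j k x.1) x.2.1 x.2.2) (Hm (fun j => A j x.1) x.2.1) * Rm (fun j => A j x.1) (fun j k => B j k x.1) x.2.1)))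
    (X := fun x => Xm x.2.2 (Pm (fun j => A j x.1) (fun j k => B j k x.1) x.2.1 x.2.2) (Hm (fun j => A j x.1) x.2.1))
    (SmAt.sub (SmAt.mul smH (SmAt.mul smH (SmAt.mul smPi smPi))) (SmAt.mul smY (SmAt.mul smR smY))) smR
    (SmAt.add smP (SmAt.smul ((cofR (cρ _)).pow 2) (SmAt.mul smR smY))) ?_ (cγ _) (cρ _) hγ₀ rfl (Xm_det _ _) ?_ ?_ ?_
  · filter_upwards [hev, hPd] with x hx hx'
    exact sm_Xm (sm_Pm (hA x hx) (h3 _ hx) (hB x hx) (hb _ hx)) (sm_Hm (hA x hx) (h3 _ hx)) hx'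
  · filter_upwards [hev, hPd] with x hx hx'
    exact conjX hx' (by rw [calA_sc, Pm]; abel) (Hyp3 (h3 _ hx) _ _)
  · intro μ v hv hμ
    have e : (Pm (fun j => A j p₀) (fun j k => B j k p₀) ζ₀ 0 + (((0:ℝ):ℂ))^2 • (Rm (fun j => A j p₀) (fun j k => B j k p₀) ζ₀ * Ym 0 (Pm (fun j => A j p₀) (fun j k => B j k p₀) ζ₀ 0) (Hm (fun j => A j p₀) ζ₀)))
        = (cmap (B (Fin.last m) (Fin.last m) p₀))⁻¹ * cmap (A (Fin.last m) p₀) := by rw [hP0]; simp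
    exact (h2 _ hp₀).P0 hc (h3 _ hp₀) μ v hv (e ▸ hμ)
  have hrad : ∀ x : XX M m, x.1 ∈ 𝒪 → _ := fun x hx => RAD (s := s) (a := Ae (fun j => A j x.1) x.2.1.2.1) (b := A (Fin.last m) x.1) (T := Tm (fun j => A j x.1) x.2.1.1 x.2.1.2.1) (τ := x.2.1.1)
    (fun ξ hξ => (h1 _ hx).a (Or.inl hξ)) (fun t => (h1 _ hx).b _ t) (h3 _ hx) (Tm_eq (A := fun j => A j x.1) (h3 _ hx) _ _)
  set r0 := rpol s (Ae (fun j => A j p₀) ζ₀.2.1) (A (Fin.last m) p₀) ζ₀.1 with hr0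
  have hne : r0 ≠ 0 := (hrad (p₀, ζ₀, 0) hp₀).1.ne_zero
  have hall : ∀ ξ : ℝ, ∃ (ν : ℕ) (q e : ℝ[X]) (K : MC (Fin N)), ξ ∈ r0.roots.toFinset → RD r0 ξ ν q e ∧ Kᴴ = K ∧ (PD K ∨ PD (-K)) ∧
      ∀ u, cmap (Tm (fun j => A j p₀) ζ₀.1 ζ₀.2.1) *ᵥ u = (ξ:ℂ) • u →
      (∃ v, u = aeval (cmap (Tm (fun j => A j p₀) ζ₀.1 ζ₀.2.1)) ((X - C ξ)^(ν - 1) * q) *ᵥ v) ∧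
      (u ≠ 0 → 0 < rq (K * aeval (cmap (Tm (fun j => A j p₀) ζ₀.1 ζ₀.2.1)) ((X - C ξ)^(ν - 1) * q) * (-(cmap (A (Fin.last m) p₀))⁻¹)) u ∧
        ∀ J : MC (Fin N), J *ᵥ u = -((cmap (A (Fin.last m) p₀))⁻¹ *ᵥ (sB (fun j k => B j k p₀) (Fin.snoc ζ₀.2.1 ξ : Fin (m+1) → ℝ) *ᵥ u)) →
          0 < rq (K * aeval (cmap (Tm (fun j => A j p₀) ζ₀.1 ζ₀.2.1)) ((X - C ξ)^(ν - 1) * q) * J) u) := by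
    intro ξ
    by_cases hξ : ξ ∈ r0.roots.toFinset
    · obtain ⟨ν, q, e, hRD⟩ := RD.ex hne (ξ := ξ) (by simpa [hne] using hξ)
      obtain ⟨K, k1, k2, k3⟩ := KX (h2 _ hp₀) hc (h1 _ hp₀) (h3 _ hp₀) hζ₀ ξ (q := (X - C ξ)^(ν - 1) * q) (by
        rw [← hr0, hRD.fac, ← mul_assoc, ← pow_succ', Nat.sub_add_cancel hRD.pos])
      exact ⟨ν, q, e, K, fun _ => ⟨hRD, k1, k2, k3⟩⟩
    · exact ⟨0, 0, 0, 0, fun h => absurd h hξ⟩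
  choose ν q e K hK using hall
  have hHD : HD ((p₀, ζ₀, 0) : XX M m) (fun x => cmap (Tm (fun j => A j x.1) x.2.1.1 x.2.1.2.1)) (fun x => rpol s (Ae (fun j => A j x.1) x.2.1.2.1) (A (Fin.last m) x.1) x.2.1.1) s r0.roots.toFinset ν q e K := by
    refine ⟨?_, ?_, ⟨?_, fun ξ hξ => (hK ξ hξ).1, fun ξ hξ => by simpa [hne] using hξ, fun ξ hξ => (hK ξ hξ).2.1, fun ξ hξ => (hK ξ hξ).2.2.1,
      fun ξ hξ u hu => ((hK ξ hξ).2.2.2 u hu).1⟩⟩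
    · filter_upwards [hev] with x hx
      exact sm_Tm (hA x hx) (h3 _ hx)
    · filter_upwards [hev] with x hx
      obtain ⟨-, r2, r3, -⟩ := hrad x hx
      refine ⟨fun k => rpol_smooth (sm_Ae (hA x hx)) (hA x hx _) (cτ x) (fun ξ hξ => (h1 _ hx).a (Or.inl hξ)) ?_ (h3 _ hx) k, r2.le, ?_⟩
      · have := (h1 _ hx).b x.2.1.2.1 0
        rwa [zero_smul, add_zero] at this
      · rw [aeval_cmap, r3]; ext; simp [cmap]
    · have := (hrad (p₀, ζ₀, 0) hp₀).2.2.1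
      change aeval (cmap (Tm (fun j => A j p₀) ζ₀.1 ζ₀.2.1)) r0 = 0
      rw [aeval_cmap, this]; ext; simp [cmap]
  exact hHD.sym (sm_Ga (hA _ hp₀) (h3 _ hp₀)) (SmAt.neg (SmAt.mul smY smR)) cγ cρ hγ₀ rfl (fun ξ hξ u hu0 hu => (((hK ξ hξ).2.2.2 u hu).2 hu0).1)
    (fun ξ hξ u hu0 hu => (((hK ξ hξ).2.2.2 u hu).2 hu0).2 _ (Jeig (h3 _ hp₀) (hb _ hp₀) hγ₀ hu))
end
section
variable {n : Type*} [Fintype n] [DecidableEq n]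
lemma nq_norm (U : EuclideanSpace ℂ n) : ‖U‖ ^ 2 = nq U.ofLp := by rw [EuclideanSpace.norm_sq_eq]; rfl
lemma inner_rq (S : MC n) (U : EuclideanSpace ℂ n) : (inner ℂ (Matrix.toEuclideanLin S U) U : ℂ).re = rq S U.ofLp := by
  rw [EuclideanSpace.inner_eq_star_dotProduct, rq, Matrix.star_dotProduct, ← Complex.conj_re]
  have : (Matrix.toEuclideanLin S U).ofLp = S *ᵥ U.ofLp := rfl
  rw [this]
  congr 1
  rw [dotProduct_comm]; rfl
lemma PJ (Φ : MC n) : ∃ Em Ep : Submodule ℂ (EuclideanSpace ℂ n), ∃ hc : IsCompl Em Ep, ∃ Q : MC n, Φ * Q = 0 ∧ (∀ v, Φ *ᵥ v = 0 → Q *ᵥ v = v) ∧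
    Module.finrank ℂ Em = Module.finrank ℂ (LinearMap.ker Φ.mulVecLin) ∧
    ∀ U, ‖Submodule.projectionOnto Em Ep hc U‖ ^ 2 = nq (Q *ᵥ U.ofLp) ∧ ‖Submodule.projectionOnto Ep Em hc.symm U‖ ^ 2 = nq ((1 - Q) *ᵥ U.ofLp) := by
  set e := WithLp.linearEquiv 2 ℂ (n → ℂ)
  set Em : Submodule ℂ (EuclideanSpace ℂ n) := (LinearMap.ker Φ.mulVecLin).map (e.symm : (n → ℂ) →ₗ[ℂ] EuclideanSpace ℂ n)
  have hmem : ∀ U, U ∈ Em ↔ Φ *ᵥ U.ofLp = 0 := fun U => by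
    constructor
    · rintro ⟨v, hv, rfl⟩
      exact hv
    · intro h
      exact ⟨U.ofLp, h, rfl⟩
  obtain ⟨Ep, hc⟩ := Submodule.exists_isCompl Em
  set f : EuclideanSpace ℂ n →ₗ[ℂ] EuclideanSpace ℂ n := Em.subtype ∘ₗ Submodule.projectionOnto Em Ep hc
  set Q := Matrix.toEuclideanLin.symm f
  have hQ : ∀ U : EuclideanSpace ℂ n, Q *ᵥ U.ofLp = (f U).ofLp := fun U => by
    have : Matrix.toEuclideanLin Q = f := LinearEquiv.apply_symm_apply _ _
    rw [← this]; rfl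
  refine ⟨Em, Ep, hc, Q, ?_, ?_, ?_, fun U => ⟨?_, ?_⟩⟩
  · refine Matrix.ext_of_mulVec_single fun i => ?_
    rw [← mulVec_mulVec, zero_mulVec]
    have := hQ (WithLp.toLp 2 (Pi.single i 1))
    rw [show (WithLp.toLp 2 (Pi.single i (1:ℂ) : n → ℂ)).ofLp = Pi.single i 1 from rfl] at this
    rw [this]
    exact (hmem _).1 (Submodule.coe_mem _)
  · intro v hv
    have h1 := hQ (WithLp.toLp 2 v)
    have h2 : (WithLp.toLp 2 v : EuclideanSpace ℂ n) ∈ Em := (hmem _).2 hv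
    have h3 : f (WithLp.toLp 2 v) = WithLp.toLp 2 v := by
      have := Submodule.projectionOnto_apply_left hc ⟨_, h2⟩
      simp only [f, LinearMap.comp_apply, this, Submodule.subtype_apply]
    rw [h3] at h1
    exact h1
  · exact LinearEquiv.finrank_map_eq e.symm _
  · rw [hQ, ← nq_norm]; rfl
  · rw [sub_mulVec, one_mulVec, hQ, show U.ofLp - (f U).ofLp = (U - f U).ofLp from rfl, ← nq_norm]
    have h := Submodule.projection_add_projection_eq_self hc U
    rw [show U - f U = ((Submodule.projectionOnto Ep Em hc.symm U : Ep) : EuclideanSpace ℂ n) from sub_eq_of_eq_add' h.symm]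
    rfl
lemma CPL {Φ Q : MC n} (h1 : Φ * Q = 0) (h2 : ∀ v, Φ *ᵥ v = 0 → Q *ᵥ v = v) : ∃ c > 0, ∀ v, c * nq ((1 - Q) *ᵥ v) ≤ nq (Φ *ᵥ v) := by
  have hp : PD (Φᴴ * Φ + Qᴴ * Q) := fun v hv => by
    rw [rq_add, rq_ctmul, rq_ctmul]
    have i1 := nq_nonneg (Φ *ᵥ v)
    have i2 := nq_nonneg (Q *ᵥ v)
    rcases i1.eq_or_lt with h | h
    · rcases i2.eq_or_lt with h' | h'
      · exact absurd ((h2 v (nq_eq_zero.1 h.symm)).symm.trans (nq_eq_zero.1 h'.symm)) hv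
      · linarith
    · linarith
  obtain ⟨c, hc, hb⟩ := hp.bound
  refine ⟨c, hc, fun v => (hb _).trans (le_of_eq ?_)⟩
  rw [rq_add, rq_ctmul, rq_ctmul]
  have e1 : Q *ᵥ ((1 - Q) *ᵥ v) = 0 := by
    rw [sub_mulVec, one_mulVec, mulVec_sub, h2 (Q *ᵥ v) (by rw [mulVec_mulVec, h1, zero_mulVec]), sub_self]
  have e2 : Φ *ᵥ ((1 - Q) *ᵥ v) = Φ *ᵥ v := by
    rw [sub_mulVec, one_mulVec, mulVec_sub, mulVec_mulVec, h1, zero_mulVec, sub_zero]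
  rw [e1, e2, nq_eq_zero.2 rfl, add_zero]
lemma nq_split (Q : MC n) (v : n → ℂ) : nq v ≤ 2 * nq ((1 - Q) *ᵥ v) + 2 * nq (Q *ᵥ v) := by
  unfold nq
  rw [Finset.mul_sum, Finset.mul_sum, ← Finset.sum_add_distrib]
  refine Finset.sum_le_sum fun i _ => ?_
  have : v i = ((1 - Q) *ᵥ v) i + (Q *ᵥ v) i := by rw [sub_mulVec]; simp
  have h := norm_add_le (((1 - Q) *ᵥ v) i) ((Q *ᵥ v) i)
  rw [← this] at h
  nlinarith [norm_nonneg (v i), sq_nonneg (‖((1 - Q) *ᵥ v) i‖ - ‖(Q *ᵥ v) i‖)]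
variable {E : Type*} [NormedAddCommGroup E] [NormedSpace ℝ E]
lemma IIm {Φ Q : MC n} (h1 : Φ * Q = 0) (h2 : ∀ v, Φ *ᵥ v = 0 → Q *ᵥ v = v) (κ : ℝ) : ∃ L : ℝ, ∃ ε > 0, ∀ (x0 : E) (S : E → MC n), SmAt S x0 →
    (∀ v, L * nq (Φ *ᵥ v) - ε * nq v ≤ rq (S x0) v) → ∀ᶠ x in 𝓝 x0, ∀ v, κ ^ 2 * nq ((1 - Q) *ᵥ v) - nq (Q *ᵥ v) ≤ rq (S x) v := by
  obtain ⟨c, hc, hb⟩ := CPL h1 h2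
  refine ⟨(κ^2 + 1) / c, 1 / 4, by norm_num, fun x0 S hS h => ?_⟩
  have hs : SmAt (fun x => S x - (κ^2 : ℝ) • ((1 - Q)ᴴ * (1 - Q)) + Qᴴ * Q) x0 := (SmAt.sub hS (SmAt.const _)).add (SmAt.const _)
  have key := PD.near hs.cont (c := 1/4) rfl (fun v => ?_) (c' := 0) (by norm_num)
  · filter_upwards [key] with x hx v
    have := hx v
    rw [rq_add, rq_sub, rq_rsmul, rq_ctmul, rq_ctmul] at this
    linarith
  · have i1 := h v
    have i2 : (κ^2 + 1) / c * (c * nq ((1 - Q) *ᵥ v)) ≤ (κ^2 + 1) / c * nq (Φ *ᵥ v) := by gcongr; exact hb v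
    have i3 : (κ^2 + 1) / c * (c * nq ((1 - Q) *ᵥ v)) = (κ^2 + 1) * nq ((1 - Q) *ᵥ v) := by field_simp
    have i4 := nq_split Q v
    rw [rq_add, rq_sub, rq_rsmul, rq_ctmul, rq_ctmul]
    linarith
lemma fr_ker {Φ Q : MC n} (h1 : Φ * Q = 0) (h2 : ∀ v, Φ *ᵥ v = 0 → Q *ᵥ v = v) :
    Module.finrank ℂ (LinearMap.ker Φ.mulVecLin) + Module.finrank ℂ (LinearMap.ker Q.mulVecLin) = Fintype.card n := by
  have : LinearMap.ker Φ.mulVecLin = LinearMap.range Q.mulVecLin := by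
    ext v
    simp only [LinearMap.mem_ker, LinearMap.mem_range, Matrix.mulVecLin_apply]
    exact ⟨fun h => ⟨v, h2 v h⟩, by rintro ⟨w, rfl⟩; rw [mulVec_mulVec, h1, zero_mulVec]⟩
  rw [this, LinearMap.finrank_range_add_finrank_ker, Module.finrank_fintype_fun_eq_card]
end
end KS
end
end

noncomputable section

/-- Theorem 4.1. Construction of Kreiss-type symmetrizers at frequency
boundary points `γ̲̌ = 0`. -/
theorem exists_symmetrizer {M N m : ℕ} (𝒪 : Set (Fin M → ℝ)) (hO : IsOpen 𝒪)
    (A : Fin (m + 1) → (Fin M → ℝ) → Matrix (Fin N) (Fin N) ℝ)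
    (B : Fin (m + 1) → Fin (m + 1) → (Fin M → ℝ) → Matrix (Fin N) (Fin N) ℝ)
    (h0 : HypH0 𝒪 A B) (h1 : HypH1 𝒪 A) (h2 : HypH2 𝒪 A B) (h3 : HypH3 𝒪 A)
    (p₀ : Fin M → ℝ) (hp₀ : p₀ ∈ 𝒪) (ζ₀ : Freq m) (hζ₀ : ζ₀ ≠ 0) (hγ₀ : ζ₀.2.2 = 0) :
    ∃ Em Ep : Submodule ℂ (EuclideanSpace ℂ (Fin N ⊕ Fin N)), ∃ hc : IsCompl Em Ep,
      Module.finrank ℂ Em = N ∧ Module.finrank ℂ Ep = N ∧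
      ∀ κ : ℝ, 1 ≤ κ →
        ∃ Ω : Set ((Fin M → ℝ) × Freq m × ℝ), IsOpen Ω ∧ (p₀, ζ₀, (0 : ℝ)) ∈ Ω ∧
        ∃ S : (Fin M → ℝ) × Freq m × ℝ → Matrix (Fin N ⊕ Fin N) (Fin N ⊕ Fin N) ℂ,
        ∃ c > (0 : ℝ),
          (∀ i j, ContDiffOn ℝ ∞ (fun x => S x i j) Ω) ∧
          (∀ x ∈ Ω, (S x)ᴴ = S x) ∧
          (∀ x ∈ Ω, ∀ U : EuclideanSpace ℂ (Fin N ⊕ Fin N),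
            κ ^ 2 * ‖Submodule.linearProjOfIsCompl Ep Em hc.symm U‖ ^ 2 -
              ‖Submodule.linearProjOfIsCompl Em Ep hc U‖ ^ 2 ≤
            (inner ℂ (Matrix.toEuclideanLin (S x) U) U : ℂ).re) ∧
          (∀ x ∈ Ω, 0 ≤ x.2.2 → 0 ≤ x.2.1.2.2 →
            ∀ U : EuclideanSpace ℂ (Fin N ⊕ Fin N),
              c * x.2.2 * (x.2.1.2.2 + x.2.2) * ‖U‖ ^ 2 ≤
              (inner ℂ (Matrix.toEuclideanLin
                  (S x * calG (fun j => A j x.1) (fun j k => B j k x.1) (x.2.2 • x.2.1)) U)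
                U : ℂ).re) := by
  obtain ⟨c, hc, h2c⟩ := KS.H2pt_of h2
  obtain ⟨mult, hm⟩ := h1
  have h1p : ∀ p ∈ 𝒪, KS.H1pt (fun j => A j p) (Multiset.card mult) := fun p hp ξ hξ =>
    KS.RS_of (hm p hp ξ hξ).1 (hm p hp ξ hξ).2.1 (hm p hp ξ hξ).2.2
  have hζ : ζ₀.1 ≠ 0 ∨ ζ₀.2.1 ≠ 0 := by
    by_contra hcon
    push Not at hcon
    exact hζ₀ (Prod.ext hcon.1 (Prod.ext hcon.2 hγ₀))
  obtain ⟨Φp, Φn, hdim, hp, hn⟩ := KS.MAIN hO h0 h1p hc h2c h3 hp₀ hζ hγ₀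
  obtain ⟨Em, Ep, hcm, Q, q1, q2, q3, q4⟩ := KS.PJ Φp
  obtain ⟨-, -, -, Qn, n1, n2, -, -⟩ := KS.PJ Φn
  have hpath : Filter.Tendsto (fun t : ℝ => ((p₀, ζ₀, t) : KS.XX M m)) (nhdsWithin 0 (Set.Ioi 0)) (nhds (p₀, ζ₀, 0)) := by
    have : Continuous fun t : ℝ => ((p₀, ζ₀, t) : KS.XX M m) := by fun_prop
    exact (this.tendsto 0).mono_left nhdsWithin_le_nhds
  have hidx : ∀ t : ℝ, 0 < t → _ := fun t ht => KS.calG_index (h2c _ hp₀) hc (t • ζ₀) (smul_ne_zero ht.ne' hζ₀) (by simp [hγ₀])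
  have hPD : ∀ S, KS.GS ((p₀, ζ₀, 0) : KS.XX M m) (fun x => calG (fun j => A j x.1) (fun j k => B j k x.1) (x.2.2 • x.2.1)) S (fun x => x.2.1.2.2) (fun x => x.2.2) →
      ∀ᶠ t in nhdsWithin (0:ℝ) (Set.Ioi 0), 0 < t ∧ (S (p₀, ζ₀, t))ᴴ = S (p₀, ζ₀, t) ∧ KS.PD (S (p₀, ζ₀, t) * calG (fun j => A j p₀) (fun j k => B j k p₀) (t • ζ₀)) := by
    rintro S ⟨s1, k, hk, s2⟩
    filter_upwards [hpath.eventually s1, hpath.eventually s2, self_mem_nhdsWithin] with t t1 t2 (t3 : 0 < t)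
    refine ⟨t3, t1.2, fun v hv => lt_of_lt_of_le ?_ (t2 (by simp [hγ₀]) t3.le v)⟩
    have := KS.nq_pos hv
    simp only [hγ₀, zero_add]
    positivity
  have hcard : Fintype.card (Fin N ⊕ Fin N) = N + N := by simp
  rw [hcard] at hdim
  have dp := KS.fr_ker q1 q2
  have dn := KS.fr_ker n1 n2
  rw [hcard] at dp dn
  have dp2 : Module.finrank ℂ (LinearMap.ker Q.mulVecLin) ≤ N := by
    obtain ⟨L, ε, hε, hL⟩ := KS.IIm (E := KS.XX M m) q1 q2 1
    obtain ⟨S, hS, hS0⟩ := hp L ε hε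
    obtain ⟨t, ⟨t1, t2, t3⟩, t4⟩ := ((hPD S hS).and (hpath.eventually (hL _ S hS.1.self_of_nhds.1 hS0))).exists
    obtain ⟨P, hP, hr⟩ := hidx t t1
    refine le_trans (hP.dim_pos t2 t3 _ ?_) hr.le
    refine fun v hv hv0 => lt_of_lt_of_le ?_ (t4 v)
    have hv' : Q *ᵥ v = 0 := hv
    rw [Matrix.sub_mulVec, hv', KS.nq_eq_zero.2 rfl, Matrix.one_mulVec, sub_zero]
    have := KS.nq_pos hv0
    simpa using this
  have dn2 : Module.finrank ℂ (LinearMap.ker Qn.mulVecLin) + N ≤ N + N := by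
    obtain ⟨L, ε, hε, hL⟩ := KS.IIm (E := KS.XX M m) n1 n2 1
    obtain ⟨S, hS, hS0⟩ := hn L ε hε
    obtain ⟨t, ⟨t1, t2, t3⟩, t4⟩ := ((hPD S hS).and (hpath.eventually (hL _ (fun x => - S x) (KS.SmAt.neg hS.1.self_of_nhds.1)
      (fun v => by rw [KS.rq_neg]; exact hS0 v)))).exists
    obtain ⟨P, hP, hr⟩ := hidx t t1
    have hneg := hP.dim_neg t2 t3 (LinearMap.ker Qn.mulVecLin)
    rw [hr, hcard] at hneg
    refine hneg fun v hv hv0 => ?_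
    have h4 := t4 v
    have hv' : Qn *ᵥ v = 0 := hv
    rw [Matrix.sub_mulVec, hv', KS.nq_eq_zero.2 rfl, Matrix.one_mulVec, sub_zero, KS.rq_neg] at h4
    have := KS.nq_pos hv0
    simp only [one_pow, one_mul, sub_zero] at h4
    linarith
  have hEm : Module.finrank ℂ Em = N := by omega
  have hEp : Module.finrank ℂ Ep = N := by
    have := Submodule.finrank_add_eq_of_isCompl hcm
    rw [finrank_euclideanSpace, hcard] at this
    omega
  refine ⟨Em, Ep, hcm, hEm, hEp, fun κ hκ => ?_⟩
  obtain ⟨L, ε, hε, hL⟩ := KS.IIm (E := KS.XX M m) q1 q2 κ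
  obtain ⟨S, hS, hS0⟩ := hp L ε hε
  have hii := hL _ S hS.1.self_of_nhds.1 hS0
  obtain ⟨s1, k, hk, s2⟩ := hS
  obtain ⟨Ω, hΩ, hΩo, hΩm⟩ := eventually_nhds_iff.1 ((s1.and s2).and hii)
  refine ⟨Ω, hΩo, hΩm, S, k, hk, fun i j x hx => ((hΩ x hx).1.1.1 i j).contDiffWithinAt, fun x hx => (hΩ x hx).1.1.2, fun x hx U => ?_, fun x hx hρ hγ U => ?_⟩
  · rw [KS.inner_rq]
    have h := (hΩ x hx).2 U.ofLp
    rw [← (q4 U).1, ← (q4 U).2] at h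
    exact h
  · rw [KS.inner_rq, KS.nq_norm]
    exact (hΩ x hx).1.2 hγ hρ U.ofLp

end
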